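/- Suppose $f, g: S^{n-1} \to [0,\infty)$ are bounded measurable functions with $\int f\,d\sigma = \int g\,d\sigma = 1$, and set $s = \log(2\|f\|_\infty)\cdot\log(2\|g\|_\infty)$. Then if $s \leq cn$, $\left|\int_{\mathcal{V}_n} f(x)g(y)\,d\sigma_\mathcal{V}(x,y) - 1\right| \leq Cs/n$, for universal constants $c, C > 0$. -/

import Mathlib

open MeasureTheory Metric

/-- The uniform (rotation-invariant) probability measure on the unit sphere
`S^{n-1} ⊂ ℝⁿ`. -/
noncomputable def uSphere (n : ℕ) : Measure (sphere (0 : EuclideanSpace ℝ (Fin n)) 1) :=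
  ((volume : Measure (EuclideanSpace ℝ (Fin n))).toSphere Set.univ)⁻¹ •
    (volume : Measure (EuclideanSpace ℝ (Fin n))).toSphere

/-- The map between unit spheres induced by a linear isometry. -/
noncomputable def sphereMap {m n : ℕ}
    (e : EuclideanSpace ℝ (Fin m) →ₗᵢ[ℝ] EuclideanSpace ℝ (Fin n))
    (ω : sphere (0 : EuclideanSpace ℝ (Fin m)) 1) :
    sphere (0 : EuclideanSpace ℝ (Fin n)) 1 :=
  ⟨e ω, by
    have hω : ‖(ω : EuclideanSpace ℝ (Fin m))‖ = 1 := mem_sphere_zero_iff_norm.mp ω.2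
    simp [mem_sphere_zero_iff_norm, e.norm_map, hω]⟩

/-- The average of `f : S^{n-1} → ℝ` over the equator parametrized by the linear
isometry `e : ℝ^{n-1} → ℝⁿ` (whose range is the hyperplane orthogonal to a point). -/
noncomputable def equatorAvg {n : ℕ} (f : sphere (0 : EuclideanSpace ℝ (Fin n)) 1 → ℝ)
    (e : EuclideanSpace ℝ (Fin (n - 1)) →ₗᵢ[ℝ] EuclideanSpace ℝ (Fin n)) : ℝ :=
  ∫ ω, f (sphereMap e ω) ∂uSphere (n - 1)

open ProbabilityTheory
open scoped ENNReal NNReal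

theorem integrable_cexp_quadratic_gaussianReal {p : ℝ} (hp : p < 1) (c d : ℂ) :
    Integrable (fun x : ℝ ↦ Complex.exp (p * x ^ 2 / 2 + c * x + d)) (gaussianReal 0 1) := by
  rw [gaussianReal_of_var_ne_zero 0 one_ne_zero,
    integrable_withDensity_iff_integrable_smul' (measurable_gaussianPDF 0 1)
      (Filter.Eventually.of_forall fun x ↦ ENNReal.ofReal_lt_top)]
  have hb : 0 < (((1 - p) / 2 : ℝ) : ℂ).re := by
    rw [Complex.ofReal_re]; linarith
  refine ((integrable_cexp_quadratic hb c d).const_mul ((√(2 * Real.pi))⁻¹ : ℝ)).congr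
    (Filter.Eventually.of_forall fun x ↦ ?_)
  beta_reduce
  rw [toReal_gaussianPDF, gaussianPDFReal, Complex.real_smul]
  push_cast
  rw [mul_assoc, ← Complex.exp_add]
  simp only [mul_one]
  congr 2
  ring

theorem integral_cexp_quadratic_gaussianReal {p : ℝ} (hp : p < 1) (c d : ℂ) :
    ∫ x : ℝ, Complex.exp (p * x ^ 2 / 2 + c * x + d) ∂gaussianReal 0 1
      = ((√(1 - p))⁻¹ : ℝ) * Complex.exp (d + c ^ 2 / (2 * (1 - p))) := by
  rw [integral_gaussianReal_eq_integral_smul one_ne_zero]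
  have hb : ((-((1 - p) / 2) : ℝ) : ℂ).re < 0 := by
    rw [Complex.ofReal_re]; linarith
  have key := integral_cexp_quadratic hb c d
  have h1 : ∀ x : ℝ, gaussianPDFReal 0 1 x • Complex.exp (p * x ^ 2 / 2 + c * x + d)
      = ((√(2 * Real.pi))⁻¹ : ℝ) *
        Complex.exp (((-((1 - p) / 2) : ℝ) : ℂ) * x ^ 2 + c * x + d) := by
    intro x
    rw [gaussianPDFReal, Complex.real_smul]
    push_cast
    rw [mul_assoc, ← Complex.exp_add]
    simp only [mul_one]
    congr 2
    ring
  simp_rw [h1]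
  rw [integral_const_mul, key]
  have hp' : (0 : ℝ) < 1 - p := by linarith
  have hpc : (1 - (p : ℂ)) ≠ 0 := by
    rw [← Complex.ofReal_one, ← Complex.ofReal_sub]; exact_mod_cast hp'.ne'
  have h2 : ((Real.pi : ℂ) / -((-((1 - p) / 2) : ℝ) : ℂ)) ^ (1 / 2 : ℂ)
      = ((√(2 * Real.pi / (1 - p)) : ℝ) : ℂ) := by
    rw [Real.sqrt_eq_rpow, Complex.ofReal_cpow (by positivity)]
    congr 1
    · push_cast
      field_simp
    · push_cast; rfl
  rw [h2, ← mul_assoc, ← Complex.ofReal_mul]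
  congr 2
  · rw [Real.sqrt_div (by positivity)]
    have := Real.sqrt_pos.mpr hp'
    have : 0 < √(2 * Real.pi) := by positivity
    field_simp
  · push_cast
    field_simp
    ring

/-- The Mehler kernel with parameter `z` on the real line, relative to the standard Gaussian
measure. The number `r` stands for `z ^ 2`, which is assumed real. -/
noncomputable def mehler (z : ℂ) (r x y : ℝ) : ℂ :=
  ((√(1 - r))⁻¹ : ℝ) *
    Complex.exp ((2 * z * x * y - r * ((x : ℂ) ^ 2 + (y : ℂ) ^ 2)) / (2 * (1 - r)))

theorem mehler_comm (z : ℂ) (r x y : ℝ) : mehler z r x y = mehler z r y x := by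
  simp only [mehler]; congr 3; ring

theorem mehler_zero (x y : ℝ) : mehler 0 0 x y = 1 := by simp [mehler]

theorem conj_mehler (z : ℂ) (r x y : ℝ) :
    (starRingEnd ℂ) (mehler z r x y) = mehler ((starRingEnd ℂ) z) r x y := by
  simp only [mehler, map_mul, Complex.conj_ofReal, ← Complex.exp_conj, map_div₀, map_sub, map_add,
    map_pow, map_one, map_ofNat]

theorem continuous_mehler (z : ℂ) (r : ℝ) :
    Continuous fun p : ℝ × ℝ ↦ mehler z r p.1 p.2 := by
  unfold mehler; fun_prop

theorem integrable_mehler_mul_mehler (z w : ℂ) {r r' : ℝ} (hr : |r| < 1) (hr' : |r'| < 1)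
    (x y : ℝ) : Integrable (fun u ↦ mehler z r x u * mehler w r' u y) (gaussianReal 0 1) := by
  obtain ⟨h1, h2⟩ := abs_lt.1 hr
  obtain ⟨h3, h4⟩ := abs_lt.1 hr'
  have e1 : 0 < 1 - r := by linarith
  have e2 : 0 < 1 - r' := by linarith
  have e1c : (1 - (r : ℂ)) ≠ 0 := by
    rw [← Complex.ofReal_one, ← Complex.ofReal_sub]; exact_mod_cast e1.ne'
  have e2c : (1 - (r' : ℂ)) ≠ 0 := by
    rw [← Complex.ofReal_one, ← Complex.ofReal_sub]; exact_mod_cast e2.ne'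
  have hp : -(r / (1 - r) + r' / (1 - r')) < 1 := by
    have : 0 < 1 + (r / (1 - r) + r' / (1 - r')) := by
      have : 1 + (r / (1 - r) + r' / (1 - r')) = (1 - r * r') / ((1 - r) * (1 - r')) := by
        field_simp; ring
      rw [this]
      have : r * r' < 1 := by
        have := abs_mul r r'
        have := le_abs_self (r * r')
        nlinarith [abs_nonneg r, abs_nonneg r']
      have : 0 < 1 - r * r' := by linarith
      positivity
    linarith
  refine ((integrable_cexp_quadratic_gaussianReal hp (z * x / (1 - r) + w * y / (1 - r'))
    (-(r * x ^ 2 / (2 * (1 - r)) + r' * y ^ 2 / (2 * (1 - r'))))).const_mul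
      (((√(1 - r))⁻¹ : ℝ) * ((√(1 - r'))⁻¹ : ℝ) : ℂ)).congr
    (Filter.Eventually.of_forall fun u ↦ ?_)
  simp only [mehler]
  rw [mul_mul_mul_comm, ← Complex.exp_add]
  congr 2
  push_cast
  field_simp
  ring

theorem integral_mehler_mul_mehler {z w : ℂ} {r r' : ℝ} (hz : z ^ 2 = r) (hw : w ^ 2 = r')
    (hr : |r| < 1) (hr' : |r'| < 1) (x y : ℝ) :
    ∫ u, mehler z r x u * mehler w r' u y ∂gaussianReal 0 1 = mehler (z * w) (r * r') x y := by
  obtain ⟨h1, h2⟩ := abs_lt.1 hr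
  obtain ⟨h3, h4⟩ := abs_lt.1 hr'
  have e1 : 0 < 1 - r := by linarith
  have e2 : 0 < 1 - r' := by linarith
  have e1c : (1 - (r : ℂ)) ≠ 0 := by
    rw [← Complex.ofReal_one, ← Complex.ofReal_sub]; exact_mod_cast e1.ne'
  have e2c : (1 - (r' : ℂ)) ≠ 0 := by
    rw [← Complex.ofReal_one, ← Complex.ofReal_sub]; exact_mod_cast e2.ne'
  have e3 : 0 < 1 - r * r' := by
    have := abs_mul r r'
    have := le_abs_self (r * r')
    nlinarith [abs_nonneg r, abs_nonneg r']
  have e3c : (1 - (r : ℂ) * r') ≠ 0 := by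
    rw [← Complex.ofReal_one, ← Complex.ofReal_mul, ← Complex.ofReal_sub]; exact_mod_cast e3.ne'
  have hq : 1 - -(r / (1 - r) + r' / (1 - r')) = (1 - r * r') / ((1 - r) * (1 - r')) := by
    field_simp; ring
  have hp : -(r / (1 - r) + r' / (1 - r')) < 1 := by
    have : 0 < 1 - -(r / (1 - r) + r' / (1 - r')) := by
      rw [hq]; positivity
    linarith
  have key := integral_cexp_quadratic_gaussianReal hp (z * x / (1 - r) + w * y / (1 - r'))
    (-(r * x ^ 2 / (2 * (1 - r)) + r' * y ^ 2 / (2 * (1 - r'))))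
  have hfun : ∀ u : ℝ, mehler z r x u * mehler w r' u y
      = (((√(1 - r))⁻¹ : ℝ) * ((√(1 - r'))⁻¹ : ℝ) : ℂ) *
        Complex.exp (((-(r / (1 - r) + r' / (1 - r')) : ℝ) : ℂ) * u ^ 2 / 2
          + (z * x / (1 - r) + w * y / (1 - r')) * u
          + (-(r * x ^ 2 / (2 * (1 - r)) + r' * y ^ 2 / (2 * (1 - r'))))) := by
    intro u
    simp only [mehler]
    rw [mul_mul_mul_comm, ← Complex.exp_add]
    congr 2
    push_cast
    field_simp
    ring
  simp_rw [hfun]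
  rw [integral_const_mul, key, ← mul_assoc, ← Complex.ofReal_mul, ← Complex.ofReal_mul, mehler]
  congr 2
  · rw [hq, Real.sqrt_div e3.le, Real.sqrt_mul e1.le]
    have := Real.sqrt_pos.mpr e1
    have := Real.sqrt_pos.mpr e2
    have := Real.sqrt_pos.mpr e3
    field_simp
  · have hqc : (1 - ((-(r / (1 - r) + r' / (1 - r')) : ℝ) : ℂ))
        = (1 - r * r') / ((1 - r) * (1 - r')) := by
      rw [← Complex.ofReal_one, ← Complex.ofReal_sub, hq]; push_cast; rfl
    rw [hqc]
    have hexp : (z * x / (1 - r) + w * y / (1 - r')) ^ 2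
        = r * x ^ 2 / (1 - r) ^ 2 + r' * y ^ 2 / (1 - r') ^ 2
          + 2 * (z * w) * x * y / ((1 - r) * (1 - r')) := by
      rw [← hz, ← hw] at *
      field_simp
      ring
    rw [hexp]
    push_cast
    field_simp
    ring

theorem integral_mehler {z : ℂ} {r : ℝ} (hz : z ^ 2 = r) (hr : |r| < 1) (x : ℝ) :
    ∫ u, mehler z r x u ∂gaussianReal 0 1 = 1 := by
  have := integral_mehler_mul_mehler (w := 0) (r' := 0) hz (by simp) hr (by simp) x 0
  simpa [mehler_zero] using this

theorem integrable_mehler (z : ℂ) {r : ℝ} (hr : |r| < 1) (x : ℝ) :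
    Integrable (fun u ↦ mehler z r x u) (gaussianReal 0 1) := by
  have := integrable_mehler_mul_mehler z 0 (r' := 0) hr (by simp) x 0
  simpa [mehler_zero] using this

theorem mehler_diag (a x : ℝ) (ha : |a| < 1) : mehler a (a ^ 2) x x
    = ((√(1 - a ^ 2))⁻¹ : ℝ) *
      Complex.exp (((2 * a / (1 + a) : ℝ) : ℂ) * x ^ 2 / 2 + 0 * x + 0) := by
  obtain ⟨h1, h2⟩ := abs_lt.1 ha
  have e1 : (1 - (a : ℂ)) ≠ 0 := by
    rw [← Complex.ofReal_one, ← Complex.ofReal_sub]; exact_mod_cast (by linarith : 1 - a ≠ 0)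
  have e2 : (1 + (a : ℂ)) ≠ 0 := by
    rw [← Complex.ofReal_one, ← Complex.ofReal_add]
    exact_mod_cast (by linarith : 0 < 1 + a).ne'
  have e3 : (1 - (a : ℂ) ^ 2) = (1 - a) * (1 + a) := by ring
  rw [mehler]
  congr 2
  push_cast
  rw [e3]
  field_simp
  ring

theorem integrable_mehler_diag {a : ℝ} (ha : |a| < 1) :
    Integrable (fun x ↦ mehler a (a ^ 2) x x) (gaussianReal 0 1) := by
  obtain ⟨h1, h2⟩ := abs_lt.1 ha
  simp_rw [mehler_diag a _ ha]
  refine (integrable_cexp_quadratic_gaussianReal ?_ 0 0).const_mul _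
  rw [div_lt_one (by linarith)]; linarith

theorem integral_mehler_diag {a : ℝ} (ha : |a| < 1) :
    ∫ x, mehler a (a ^ 2) x x ∂gaussianReal 0 1 = ((1 - a)⁻¹ : ℝ) := by
  obtain ⟨h1, h2⟩ := abs_lt.1 ha
  have h3 : 0 < 1 - a := by linarith
  have h4 : 0 < 1 + a := by linarith
  simp_rw [mehler_diag a _ ha]
  rw [integral_const_mul, integral_cexp_quadratic_gaussianReal
    (by rw [div_lt_one (by linarith)]; linarith)]
  simp only [zero_add, ne_eq, OfNat.ofNat_ne_zero, not_false_eq_true, zero_pow, zero_div,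
    Complex.exp_zero, mul_one]
  rw [← Complex.ofReal_mul]
  congr 1
  have : 1 - 2 * a / (1 + a) = (1 - a) / (1 + a) := by field_simp; ring
  rw [this, ← mul_inv, ← Real.sqrt_mul (by nlinarith)]
  congr 1
  have : (1 - a ^ 2) * ((1 - a) / (1 + a)) = (1 - a) ^ 2 := by field_simp; ring
  rw [this, Real.sqrt_sq h3.le]

theorem norm_mehler_le {z : ℂ} {r q : ℝ} (hz : z ^ 2 = r) (hr : |r| < 1)
    (hq : ‖z‖ / (1 + ‖z‖) ≤ q) (x y : ℝ) :
    ‖mehler z r x y‖ ≤ (√(1 - r))⁻¹ * (Real.exp (q * x ^ 2 / 2) * Real.exp (q * y ^ 2 / 2)) := by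
  obtain ⟨h1, h2⟩ := abs_lt.1 hr
  have h3 : 0 < 1 - r := by linarith
  rw [mehler, norm_mul, Complex.norm_real, Real.norm_of_nonneg (by positivity), Complex.norm_exp,
    ← Real.exp_add]
  gcongr
  have hre : ((2 * z * x * y - r * ((x : ℂ) ^ 2 + (y : ℂ) ^ 2)) / (2 * (1 - r))).re
      = (2 * z.re * x * y - r * (x ^ 2 + y ^ 2)) / (2 * (1 - r)) := by
    have : (2 * (1 - (r : ℂ))) = ((2 * (1 - r) : ℝ) : ℂ) := by push_cast; rfl
    rw [this, Complex.div_ofReal_re]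
    congr 1
    have : (2 * z * x * y - r * ((x : ℂ) ^ 2 + (y : ℂ) ^ 2))
      = ((2 * x * y : ℝ) : ℂ) * z - ((r * (x ^ 2 + y ^ 2) : ℝ) : ℂ) := by push_cast; ring
    rw [this, Complex.sub_re, Complex.re_ofReal_mul, Complex.ofReal_re]
    ring
  rw [hre]
  have hnorm : ‖z‖ ^ 2 = |r| := by
    rw [← norm_pow, hz, Complex.norm_real, Real.norm_eq_abs]
  have hn1 : ‖z‖ < 1 := by nlinarith [norm_nonneg z]
  have hn0 := norm_nonneg z
  have hn2 : ‖z‖ ^ 2 = z.re ^ 2 + z.im ^ 2 := by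
    rw [Complex.sq_norm, Complex.normSq_apply]; ring
  have hzr : z.re ^ 2 - z.im ^ 2 = r := by
    have := congrArg Complex.re hz
    rw [Complex.ofReal_re, pow_two, Complex.mul_re] at this
    nlinarith
  have hzi : z.re * z.im = 0 := by
    have := congrArg Complex.im hz
    rw [Complex.ofReal_im, pow_two, Complex.mul_im] at this
    nlinarith
  have hS : 0 ≤ x ^ 2 + y ^ 2 := by positivity
  have main : (2 * z.re * x * y - r * (x ^ 2 + y ^ 2)) / (2 * (1 - r))
      ≤ ‖z‖ / (1 + ‖z‖) * (x ^ 2 + y ^ 2) / 2 := by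
    rw [div_le_div_iff₀ (by linarith) (by norm_num), div_mul_eq_mul_div, div_mul_eq_mul_div,
      le_div_iff₀ (by linarith)]
    rcases mul_eq_zero.1 hzi with h | h
    · have hrz : r = -‖z‖ ^ 2 := by rw [hn2, ← hzr, h]; ring
      rw [hrz, h]
      have : 0 ≤ ‖z‖ * (1 - ‖z‖) * (x ^ 2 + y ^ 2) := by
        have : 0 ≤ 1 - ‖z‖ := by linarith
        positivity
      nlinarith
    · have hrz : r = ‖z‖ ^ 2 := by rw [hn2, ← hzr, h]; ring
      have hre : z.re * (x * y) ≤ ‖z‖ * ((x ^ 2 + y ^ 2) / 2) := by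
        refine (le_abs_self _).trans ?_
        rw [abs_mul]
        gcongr
        · exact Complex.abs_re_le_norm z
        · rw [abs_le]; constructor <;> nlinarith [sq_nonneg (x - y), sq_nonneg (x + y)]
      rw [hrz]
      nlinarith [mul_le_mul_of_nonneg_right hre (by linarith : 0 ≤ 1 + ‖z‖)]
  calc _ ≤ _ := main
    _ ≤ q * (x ^ 2 + y ^ 2) / 2 := by gcongr
    _ = _ := by ring

/-- The Mehler kernel with real parameter, as a real-valued function. -/
noncomputable def mehlerReal (b x y : ℝ) : ℝ :=
  (√(1 - b ^ 2))⁻¹ * Real.exp ((2 * b * x * y - b ^ 2 * (x ^ 2 + y ^ 2)) / (2 * (1 - b ^ 2)))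

theorem ofReal_mehlerReal (b x y : ℝ) : (mehlerReal b x y : ℂ) = mehler b (b ^ 2) x y := by
  simp only [mehlerReal, mehler]; push_cast; rfl

theorem mehlerReal_nonneg (b x y : ℝ) : 0 ≤ mehlerReal b x y := by
  unfold mehlerReal; positivity

theorem mehlerReal_comm (b x y : ℝ) : mehlerReal b x y = mehlerReal b y x := by
  simp only [mehlerReal]; congr 3; ring

theorem continuous_mehlerReal (b : ℝ) :
    Continuous fun p : ℝ × ℝ ↦ mehlerReal b p.1 p.2 := by
  unfold mehlerReal; fun_prop

theorem abs_sq_lt_one {b : ℝ} (hb : |b| < 1) : |b ^ 2| < 1 := by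
  rw [abs_pow]; nlinarith [abs_nonneg b]

theorem integrable_mehlerReal {b : ℝ} (hb : |b| < 1) (x : ℝ) :
    Integrable (fun u ↦ mehlerReal b x u) (gaussianReal 0 1) := by
  have := (integrable_mehler b (abs_sq_lt_one hb) x).re
  refine this.congr (Filter.Eventually.of_forall fun u ↦ ?_)
  simp [← ofReal_mehlerReal]

theorem integral_mehlerReal {b : ℝ} (hb : |b| < 1) (x : ℝ) :
    ∫ u, mehlerReal b x u ∂gaussianReal 0 1 = 1 := by
  have := integral_mehler (z := b) (r := b ^ 2) (by push_cast; rfl) (abs_sq_lt_one hb) x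
  simp_rw [← ofReal_mehlerReal] at this
  rw [integral_complex_ofReal] at this
  exact_mod_cast this

theorem integrable_mehlerReal_mul {a b : ℝ} (ha : |a| < 1) (hb : |b| < 1) (x y : ℝ) :
    Integrable (fun u ↦ mehlerReal a x u * mehlerReal b u y) (gaussianReal 0 1) := by
  have := (integrable_mehler_mul_mehler a b (abs_sq_lt_one ha) (abs_sq_lt_one hb) x y).re
  refine this.congr (Filter.Eventually.of_forall fun u ↦ ?_)
  simp [← ofReal_mehlerReal, ← Complex.ofReal_mul]

theorem integral_mehlerReal_mul {a b : ℝ} (ha : |a| < 1) (hb : |b| < 1) (x y : ℝ) :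
    ∫ u, mehlerReal a x u * mehlerReal b u y ∂gaussianReal 0 1 = mehlerReal (a * b) x y := by
  have := integral_mehler_mul_mehler (z := a) (w := b) (r := a ^ 2) (r' := b ^ 2)
    (by push_cast; rfl) (by push_cast; rfl) (abs_sq_lt_one ha) (abs_sq_lt_one hb) x y
  rw [← Complex.ofReal_mul, ← mul_pow] at this
  simp_rw [← ofReal_mehlerReal, ← Complex.ofReal_mul] at this
  rw [integral_complex_ofReal] at this
  exact_mod_cast this

theorem sum_range_even_odd {M : Type*} [AddCommMonoid M] (f : ℕ → M) (m : ℕ) :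
    ∑ k ∈ Finset.range (2 * m + 1), f k
      = ∑ j ∈ Finset.range (m + 1), f (2 * j) + ∑ j ∈ Finset.range m, f (2 * j + 1) := by
  induction m with
  | zero => simp
  | succ m ih =>
    rw [show 2 * (m + 1) + 1 = 2 * m + 1 + 1 + 1 by ring, Finset.sum_range_succ,
      Finset.sum_range_succ, ih, Finset.sum_range_succ (fun j ↦ f (2 * j)) (m + 1),
      Finset.sum_range_succ (fun j ↦ f (2 * j + 1)) m,
      show 2 * m + 1 + 1 = 2 * (m + 1) by ring]
    abel

theorem one_add_mul_le_even_pow (t : ℝ) (m : ℕ) : 1 - 2 * m * t ≤ (1 - t) ^ (2 * m) := by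
  have := one_add_mul_le_pow (a := -2 * t + t ^ 2) (by nlinarith [sq_nonneg (t - 1)]) m
  rw [pow_mul]
  calc 1 - 2 * m * t ≤ 1 + m * (-2 * t + t ^ 2) := by
        have : 0 ≤ (m : ℝ) * t ^ 2 := by positivity
        nlinarith
    _ ≤ _ := this
    _ = _ := by ring

/-- An even power is controlled by its linear part and its even part. -/
theorem one_add_even_pow_le (t : ℝ) (m : ℕ) : (1 + t) ^ (2 * m)
    ≤ 1 + 2 * m * t + 2 * ∑ j ∈ Finset.range m, ((2 * m).choose (2 * (j + 1))) * (t ^ 2) ^ (j + 1)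
    := by
  have h1 := one_add_mul_le_even_pow t m
  have h2 : (1 + t) ^ (2 * m) + (1 - t) ^ (2 * m)
      = 2 * ∑ j ∈ Finset.range (m + 1), ((2 * m).choose (2 * j)) * (t ^ 2) ^ j := by
    rw [add_comm 1 t, add_pow, show 1 - t = -t + 1 by ring, add_pow, sum_range_even_odd,
      sum_range_even_odd]
    simp only [one_pow, mul_one]
    rw [Finset.mul_sum, add_add_add_comm, ← Finset.sum_add_distrib, ← Finset.sum_add_distrib]
    have : ∀ j : ℕ, t ^ (2 * j + 1) * ((2 * m).choose (2 * j + 1))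
        + (-t) ^ (2 * j + 1) * ((2 * m).choose (2 * j + 1)) = 0 := fun j ↦ by
      rw [pow_succ, pow_succ, pow_mul, pow_mul, neg_sq]; ring
    simp only [this, Finset.sum_const_zero, add_zero]
    refine Finset.sum_congr rfl fun j _ ↦ ?_
    rw [pow_mul, pow_mul, neg_sq]; ring
  rw [Finset.sum_range_succ'] at h2
  simp only [mul_zero, Nat.choose_zero_right, Nat.cast_one, pow_zero, mul_one] at h2
  linarith

theorem choose_two_mul_mul_factorial_le {m j : ℕ} (hj : j ≤ m) :
    (2 * m).choose (2 * j) * j.factorial ≤ (2 * m) ^ j * m.choose j := by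
  induction j with
  | zero => simp
  | succ j ih =>
    have ih := ih (by omega)
    obtain ⟨d, rfl⟩ : ∃ d, m = j + 1 + d := ⟨m - (j + 1), by omega⟩
    have h1 := Nat.choose_succ_right_eq (2 * (j + 1 + d)) (2 * j)
    have h2 := Nat.choose_succ_right_eq (2 * (j + 1 + d)) (2 * j + 1)
    have h3 := Nat.choose_succ_right_eq (j + 1 + d) j
    rw [show 2 * (j + 1 + d) - 2 * j = 2 * d + 2 by omega] at h1
    rw [show 2 * (j + 1 + d) - (2 * j + 1) = 2 * d + 1 by omega] at h2
    rw [show j + 1 + d - j = d + 1 by omega] at h3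
    rw [show 2 * (j + 1) = 2 * j + 1 + 1 by ring, Nat.factorial_succ]
    generalize (2 * (j + 1 + d)).choose (2 * j + 1 + 1) = A at *
    generalize (2 * (j + 1 + d)).choose (2 * j + 1) = B at *
    generalize (2 * (j + 1 + d)).choose (2 * j) = D at *
    generalize (j + 1 + d).choose j = E at *
    generalize (j + 1 + d).choose (j + 1) = F at *
    generalize j.factorial = f at *
    set P := (2 * (j + 1 + d)) ^ j
    rw [pow_succ]
    change _ ≤ P * _ * _
    have hA : A * ((j + 1) * f) * ((2 * j + 1) * (2 * (j + 1)))
        = D * f * ((d + 1) * (2 * d + 1) * (2 * (j + 1))) := by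
      calc _ = (A * (2 * j + 1 + 1)) * (f * (j + 1) * (2 * j + 1)) := by ring
        _ = (B * (2 * j + 1)) * ((2 * d + 1) * f * (j + 1)) := by rw [h2]; ring
        _ = _ := by rw [h1]; ring
    refine Nat.le_of_mul_le_mul_right (c := (2 * j + 1) * (2 * (j + 1))) ?_ (by positivity)
    rw [hA]
    calc _ ≤ P * E * ((d + 1) * (2 * d + 1) * (2 * (j + 1))) := by gcongr
      _ = (E * (d + 1)) * (P * (2 * d + 1) * (2 * (j + 1))) := by ring
      _ = F * P * (2 * (j + 1)) * ((j + 1) * (2 * d + 1)) := by rw [← h3]; ring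
      _ ≤ F * P * (2 * (j + 1)) * ((2 * j + 1) * (2 * (j + 1 + d))) := by
        gcongr <;> omega
      _ = _ := by ring

theorem sq_integral_mul_le {α : Type*} [MeasurableSpace α] {μ : Measure α} {f g : α → ℝ}
    (hf : Integrable (fun x ↦ f x ^ 2) μ) (hg : Integrable (fun x ↦ g x ^ 2) μ)
    (hfg : Integrable (fun x ↦ f x * g x) μ) :
    (∫ x, f x * g x ∂μ) ^ 2 ≤ (∫ x, f x ^ 2 ∂μ) * ∫ x, g x ^ 2 ∂μ := by
  have key : ∀ t : ℝ, 0 ≤ (∫ x, g x ^ 2 ∂μ) * (t * t) + (2 * ∫ x, f x * g x ∂μ) * t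
      + ∫ x, f x ^ 2 ∂μ := by
    intro t
    have : ∫ x, (f x + t * g x) ^ 2 ∂μ = (∫ x, g x ^ 2 ∂μ) * (t * t)
        + (2 * ∫ x, f x * g x ∂μ) * t + ∫ x, f x ^ 2 ∂μ := by
      have h : ∀ x, (f x + t * g x) ^ 2 = t * t * g x ^ 2 + 2 * t * (f x * g x) + f x ^ 2 :=
        fun x ↦ by ring
      have e : Integrable (fun x ↦ t * t * g x ^ 2 + 2 * t * (f x * g x)) μ :=
        (hg.const_mul _).add (hfg.const_mul _)
      simp_rw [h]
      rw [integral_add e hf, integral_add (hg.const_mul _) (hfg.const_mul _), integral_const_mul,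
        integral_const_mul]
      ring
    rw [← this]
    exact integral_nonneg fun x ↦ sq_nonneg _
  have := discrim_le_zero key
  rw [discrim] at this
  nlinarith

theorem integrable_exp_gaussianReal : Integrable (fun x : ℝ ↦ Real.exp (3 * x ^ 2 / 8))
    (gaussianReal 0 1) := by
  refine (integrable_cexp_quadratic_gaussianReal (p := 3 / 4) (by norm_num) 0 0).re.congr
    (Filter.Eventually.of_forall fun x ↦ ?_)
  have : (((3 / 4 : ℝ) : ℂ) * x ^ 2 / 2 + 0 * x + 0) = ((3 * x ^ 2 / 8 : ℝ) : ℂ) := by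
    push_cast; ring
  simp only [this, ← Complex.ofReal_exp]
  rfl

theorem integral_exp_gaussianReal :
    ∫ x : ℝ, Real.exp (3 * x ^ 2 / 8) ∂gaussianReal 0 1 = 2 := by
  have h := integral_cexp_quadratic_gaussianReal (p := 3 / 4) (by norm_num) 0 0
  have : ∀ x : ℝ, (((3 / 4 : ℝ) : ℂ) * x ^ 2 / 2 + 0 * x + 0) = ((3 * x ^ 2 / 8 : ℝ) : ℂ) := by
    intro x; push_cast; ring
  simp_rw [this, ← Complex.ofReal_exp] at h
  rw [integral_complex_ofReal] at h
  have h4 : √(1 - 3 / 4 : ℝ) = 1 / 2 := by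
    rw [show (1 - 3 / 4 : ℝ) = (1 / 2) ^ 2 by norm_num, Real.sqrt_sq (by norm_num)]
  rw [h4] at h
  norm_num at h
  exact Complex.ofReal_injective (h.trans (by norm_num))

theorem mehlerReal_diag (a x : ℝ) (ha : |a| < 1) :
    mehlerReal a x x = (√(1 - a ^ 2))⁻¹ * Real.exp (a / (1 + a) * x ^ 2) := by
  obtain ⟨h1, h2⟩ := abs_lt.1 ha
  have e1 : (1 - a) ≠ 0 := by linarith
  have e2 : (1 + a) ≠ 0 := by linarith
  have e3 : (1 - a ^ 2) = (1 - a) * (1 + a) := by ring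
  rw [mehlerReal]
  congr 2
  rw [e3]
  field_simp
  ring

theorem mehlerReal_diag_sub_one_le {a : ℝ} (h0 : 0 ≤ a) (h1 : a ≤ 1 / 2) (x : ℝ) :
    mehlerReal a x x - 1 ≤ a * (x ^ 2 + 1) * Real.exp (a * (x ^ 2 + 1)) := by
  rw [mehlerReal_diag a x (by rw [abs_of_nonneg h0]; linarith)]
  have hx := sq_nonneg x
  have h2 : (√(1 - a ^ 2))⁻¹ ≤ Real.exp a := by
    rw [inv_le_comm₀ (Real.sqrt_pos.2 (by nlinarith)) (Real.exp_pos _), ← Real.exp_neg]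
    refine Real.le_sqrt_of_sq_le ?_
    rw [← Real.exp_nat_mul]
    have h5 : Real.exp ((2 : ℕ) * -a) * (1 + 2 * a) ≤ 1 := by
      have : 1 + 2 * a ≤ Real.exp (2 * a) := by linarith [Real.add_one_le_exp (2 * a)]
      calc _ ≤ Real.exp ((2 : ℕ) * -a) * Real.exp (2 * a) := by gcongr
        _ = 1 := by rw [← Real.exp_add]; norm_num
    have h6 : 1 ≤ (1 - a ^ 2) * (1 + 2 * a) := by nlinarith [mul_nonneg h0 h0]
    nlinarith
  have h3 : a / (1 + a) * x ^ 2 ≤ a * x ^ 2 := by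
    gcongr
    exact div_le_self h0 (by linarith)
  calc _ ≤ Real.exp a * Real.exp (a * x ^ 2) - 1 := by gcongr
    _ = Real.exp (a * (x ^ 2 + 1)) - 1 := by rw [← Real.exp_add]; congr 2; ring
    _ ≤ _ := by
      set u := a * (x ^ 2 + 1)
      have : (1 - u) * Real.exp u ≤ 1 := by
        calc (1 - u) * Real.exp u ≤ Real.exp (-u) * Real.exp u := by
              gcongr; linarith [Real.add_one_le_exp (-u)]
          _ = 1 := by rw [← Real.exp_add]; simp
      linarith

theorem pow_mehlerReal_diag_bound {a : ℝ} (h0 : 0 ≤ a) {j : ℕ} (hj : j * a ≤ 1 / 4) (x : ℝ) :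
    (a * (x ^ 2 + 1) * Real.exp (a * (x ^ 2 + 1))) ^ j
      ≤ (8 * a) ^ j * j.factorial * (3 / 2 * Real.exp (3 * x ^ 2 / 8)) := by
  have hx := sq_nonneg x
  have h1 := Real.pow_div_factorial_le_exp ((x ^ 2 + 1) / 8) (by positivity) j
  rw [div_le_iff₀ (by positivity)] at h1
  have h2 : Real.exp (3 / 8) ≤ 3 / 2 := by
    refine (Real.exp_bound' (by norm_num) (by norm_num) (n := 4) (by norm_num)).trans ?_
    norm_num [Finset.sum_range_succ, Nat.factorial]
  calc _ = (8 * a) ^ j * ((x ^ 2 + 1) / 8) ^ j * Real.exp (j * a * (x ^ 2 + 1)) := by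
        rw [mul_pow, ← Real.exp_nat_mul, ← mul_pow]; ring_nf
    _ ≤ (8 * a) ^ j * (Real.exp ((x ^ 2 + 1) / 8) * j.factorial)
          * Real.exp (1 / 4 * (x ^ 2 + 1)) := by gcongr
    _ = (8 * a) ^ j * j.factorial * (Real.exp (3 / 8) * Real.exp (3 * x ^ 2 / 8)) := by
        rw [← Real.exp_add]
        rw [show (3 / 8 + 3 * x ^ 2 / 8 : ℝ) = (x ^ 2 + 1) / 8 + 1 / 4 * (x ^ 2 + 1) by ring,
          Real.exp_add]
        ring
    _ ≤ _ := by gcongr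

/-- The noise operator on the real line. -/
noncomputable def mehlerOp (b : ℝ) (F : ℝ → ℝ) (x : ℝ) : ℝ :=
  ∫ y, mehlerReal b x y * F y ∂gaussianReal 0 1

theorem integrable_of_measurable_of_bounded {α : Type*} [MeasurableSpace α] {μ : Measure α}
    [IsFiniteMeasure μ] {f : α → ℝ} (hf : Measurable f) {M : ℝ} (h0 : ∀ x, 0 ≤ f x)
    (hM : ∀ x, f x ≤ M) : Integrable f μ :=
  Integrable.of_bound hf.aestronglyMeasurable M
    (Filter.Eventually.of_forall fun x ↦ by rw [Real.norm_of_nonneg (h0 x)]; exact hM x)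

section
variable {b M : ℝ} {F : ℝ → ℝ}

theorem integrable_mehlerReal_prod (hb : |b| < 1) :
    Integrable (fun p : ℝ × ℝ ↦ mehlerReal b p.1 p.2) ((gaussianReal 0 1).prod (gaussianReal 0 1))
    := by
  rw [integrable_prod_iff (continuous_mehlerReal b).aestronglyMeasurable]
  refine ⟨Filter.Eventually.of_forall fun x ↦ integrable_mehlerReal hb x, ?_⟩
  simp_rw [Real.norm_of_nonneg (mehlerReal_nonneg _ _ _), integral_mehlerReal hb]
  exact integrable_const _

theorem integrable_mehlerReal_mul_prod (hb : |b| < 1) (hF : Measurable F)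
    (h0 : ∀ x, 0 ≤ F x) (hM : ∀ x, F x ≤ M) :
    Integrable (fun p : ℝ × ℝ ↦ mehlerReal b p.1 p.2 * F p.2)
      ((gaussianReal 0 1).prod (gaussianReal 0 1)) := by
  refine ((integrable_mehlerReal_prod hb).mul_const M).mono'
    ((continuous_mehlerReal b).measurable.mul (hF.comp measurable_snd)).aestronglyMeasurable
    (Filter.Eventually.of_forall fun p ↦ ?_)
  have := mehlerReal_nonneg b p.1 p.2
  rw [Real.norm_of_nonneg (mul_nonneg this (h0 _))]
  gcongr
  exact hM _

theorem integrable_mehlerReal_mul_bounded (hb : |b| < 1) (hF : Measurable F)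
    (h0 : ∀ x, 0 ≤ F x) (hM : ∀ x, F x ≤ M) (x : ℝ) :
    Integrable (fun y ↦ mehlerReal b x y * F y) (gaussianReal 0 1) := by
  refine ((integrable_mehlerReal hb x).mul_const M).mono'
    (((continuous_mehlerReal b).measurable.comp measurable_prodMk_left).mul hF).aestronglyMeasurable
    (Filter.Eventually.of_forall fun y ↦ ?_)
  have := mehlerReal_nonneg b x y
  rw [Real.norm_of_nonneg (mul_nonneg this (h0 _))]
  gcongr
  exact hM _

theorem measurable_mehlerOp (hF : Measurable F) : Measurable (mehlerOp b F) := by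
  have : StronglyMeasurable fun p : ℝ × ℝ ↦ mehlerReal b p.1 p.2 * F p.2 :=
    ((continuous_mehlerReal b).measurable.mul (hF.comp measurable_snd)).stronglyMeasurable
  exact this.integral_prod_right'.measurable

theorem mehlerOp_nonneg (h0 : ∀ x, 0 ≤ F x) (x : ℝ) : 0 ≤ mehlerOp b F x :=
  integral_nonneg fun y ↦ mul_nonneg (mehlerReal_nonneg _ _ _) (h0 y)

theorem mehlerOp_le (hb : |b| < 1) (hF : Measurable F) (h0 : ∀ x, 0 ≤ F x) (hM : ∀ x, F x ≤ M)
    (x : ℝ) : mehlerOp b F x ≤ M := by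
  calc mehlerOp b F x ≤ ∫ y, mehlerReal b x y * M ∂gaussianReal 0 1 := by
        refine integral_mono (integrable_mehlerReal_mul_bounded hb hF h0 hM x)
          ((integrable_mehlerReal hb x).mul_const M) fun y ↦ ?_
        exact mul_le_mul_of_nonneg_left (hM y) (mehlerReal_nonneg _ _ _)
    _ = M := by rw [integral_mul_const, integral_mehlerReal hb, one_mul]

theorem integral_mehlerOp (hb : |b| < 1) (hF : Measurable F)
    (h0 : ∀ x, 0 ≤ F x) (hM : ∀ x, F x ≤ M) :
    ∫ x, mehlerOp b F x ∂gaussianReal 0 1 = ∫ x, F x ∂gaussianReal 0 1 := by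
  simp only [mehlerOp]
  rw [integral_integral_swap (f := fun x y ↦ mehlerReal b x y * F y)
    (integrable_mehlerReal_mul_prod hb hF h0 hM)]
  have h (y : ℝ) : ∫ x, mehlerReal b x y ∂gaussianReal 0 1 = 1 := by
    simp_rw [mehlerReal_comm b _ y]
    exact integral_mehlerReal hb y
  simp_rw [integral_mul_const, h, one_mul]

theorem sq_mehlerOp_sub_one_le (hb : |b| < 1) (hF : Measurable F)
    (h0 : ∀ x, 0 ≤ F x) (hM : ∀ x, F x ≤ M)
    (hF1 : ∫ x, F x ∂gaussianReal 0 1 = 1) (x : ℝ) :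
    (mehlerOp b F x - 1) ^ 2
      ≤ (mehlerReal (b ^ 2) x x - 1) * (∫ x, F x ^ 2 ∂gaussianReal 0 1 - 1) := by
  have hk := integrable_mehlerReal hb x
  have hkF := integrable_mehlerReal_mul_bounded hb hF h0 hM x
  have hFi : Integrable F (gaussianReal 0 1) := integrable_of_measurable_of_bounded hF h0 hM
  have hF2 : Integrable (fun x ↦ F x ^ 2) (gaussianReal 0 1) :=
    integrable_of_measurable_of_bounded (M := M ^ 2) (hF.pow_const 2) (fun x ↦ sq_nonneg _)
      fun x ↦ pow_le_pow_left₀ (h0 x) (hM x) 2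
  have hk2 : Integrable (fun y ↦ mehlerReal b x y ^ 2) (gaussianReal 0 1) := by
    refine (integrable_mehlerReal_mul hb hb x x).congr (Filter.Eventually.of_forall fun y ↦ ?_)
    simp only [mehlerReal_comm b y x, pow_two]
  have h1 : ∫ y, (mehlerReal b x y - 1) * (F y - 1) ∂gaussianReal 0 1 = mehlerOp b F x - 1 := by
    have : ∀ y, (mehlerReal b x y - 1) * (F y - 1)
      = (mehlerReal b x y * F y - mehlerReal b x y) - (F y - 1) := fun y ↦ by ring
    simp_rw [this]
    have e0 : Integrable (fun y ↦ mehlerReal b x y * F y - mehlerReal b x y) (gaussianReal 0 1) :=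
      hkF.sub hk
    have e1 : Integrable (fun y ↦ F y - 1) (gaussianReal 0 1) := hFi.sub (integrable_const _)
    rw [integral_sub e0 e1, integral_sub hkF hk,
      integral_sub hFi (integrable_const _), hF1, integral_mehlerReal hb]
    simp [mehlerOp]
  have e2 : Integrable (fun y ↦ mehlerReal b x y ^ 2 - 2 * mehlerReal b x y) (gaussianReal 0 1) :=
    hk2.sub (hk.const_mul 2)
  have e3 : Integrable (fun y ↦ F y ^ 2 - 2 * F y) (gaussianReal 0 1) := hF2.sub (hFi.const_mul 2)
  have s2 : ∀ y, (mehlerReal b x y - 1) ^ 2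
    = (mehlerReal b x y ^ 2 - 2 * mehlerReal b x y) + 1 := fun y ↦ by ring
  have s3 : ∀ y, (F y - 1) ^ 2 = (F y ^ 2 - 2 * F y) + 1 := fun y ↦ by ring
  have h2 : ∫ y, (mehlerReal b x y - 1) ^ 2 ∂gaussianReal 0 1 = mehlerReal (b ^ 2) x x - 1 := by
    simp_rw [s2]
    rw [integral_add e2 (integrable_const _), integral_sub hk2 (hk.const_mul 2),
      integral_const_mul, integral_mehlerReal hb]
    have := integral_mehlerReal_mul hb hb x x
    simp_rw [mehlerReal_comm b _ x, ← pow_two] at this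
    rw [this]
    simp; ring
  have h3 : ∫ y, (F y - 1) ^ 2 ∂gaussianReal 0 1 = ∫ x, F x ^ 2 ∂gaussianReal 0 1 - 1 := by
    simp_rw [s3]
    rw [integral_add e3 (integrable_const _), integral_sub hF2 (hFi.const_mul 2),
      integral_const_mul, hF1]
    simp; ring
  rw [← h1, ← h2, ← h3]
  refine sq_integral_mul_le ?_ ?_ ?_
  · simp_rw [s2]; exact e2.add (integrable_const _)
  · simp_rw [s3]; exact e3.add (integrable_const _)
  · have : ∀ y, (mehlerReal b x y - 1) * (F y - 1)
      = (mehlerReal b x y * F y - mehlerReal b x y) - (F y - 1) := fun y ↦ by ring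
    simp_rw [this]
    exact (hkF.sub hk).sub (hFi.sub (integrable_const _))

theorem integral_mehlerOp_pow_le_of_integral_eq_one (hb : |b| < 1) (hF : Measurable F)
    (h0 : ∀ x, 0 ≤ F x) (hM : ∀ x, F x ≤ M)
    {m : ℕ} (hm : 1 ≤ m)
    (hmb : 144 * m * b ^ 2 ≤ 1) (hF1 : ∫ x, F x ∂gaussianReal 0 1 = 1) :
    ∫ x, mehlerOp b F x ^ (2 * m) ∂gaussianReal 0 1 ≤ (∫ x, F x ^ 2 ∂gaussianReal 0 1) ^ m := by
  set D := ∫ x, F x ^ 2 ∂gaussianReal 0 1 - 1 with hD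
  set a := b ^ 2 with ha
  have ha0 : 0 ≤ a := sq_nonneg b
  have hm1 : (1 : ℝ) ≤ m := by exact_mod_cast hm
  have ha1 : a ≤ 1 / 2 := by nlinarith
  have hD0 : 0 ≤ D := by
    have hFi : Integrable F (gaussianReal 0 1) := integrable_of_measurable_of_bounded hF h0 hM
    have hF2 : Integrable (fun x ↦ F x ^ 2) (gaussianReal 0 1) :=
      integrable_of_measurable_of_bounded (M := M ^ 2) (hF.pow_const 2) (fun x ↦ sq_nonneg _)
        fun x ↦ pow_le_pow_left₀ (h0 x) (hM x) 2
    have := sq_integral_mul_le (μ := gaussianReal 0 1) (f := F) (g := fun _ ↦ 1) hF2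
      (by simp) (by simpa using hFi)
    simp [hF1] at this
    linarith
  set u := mehlerOp b F with hu
  have hum : Measurable u := measurable_mehlerOp hF
  have hu0 : ∀ x, 0 ≤ u x := mehlerOp_nonneg h0
  have huM : ∀ x, u x ≤ M := mehlerOp_le hb hF h0 hM
  have hui : Integrable u (gaussianReal 0 1) := integrable_of_measurable_of_bounded hum hu0 huM
  have hu1 : ∫ x, u x ∂gaussianReal 0 1 = 1 := (integral_mehlerOp hb hF h0 hM).trans hF1
  have hupow : Integrable (fun x ↦ u x ^ (2 * m)) (gaussianReal 0 1) :=
    integrable_of_measurable_of_bounded (M := M ^ (2 * m)) (hum.pow_const _)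
      (fun x ↦ pow_nonneg (hu0 x) _) fun x ↦ pow_le_pow_left₀ (hu0 x) (huM x) _
  set S := 2 * ∑ j ∈ Finset.range m, ((2 * m).choose (2 * (j + 1)) : ℝ) *
    (D ^ (j + 1) * ((8 * a) ^ (j + 1) * (j + 1).factorial)) with hS
  have hpt : ∀ x, u x ^ (2 * m)
      ≤ 1 + 2 * m * (u x - 1) + S * (3 / 2 * Real.exp (3 * x ^ 2 / 8)) := by
    intro x
    have h1 := one_add_even_pow_le (u x - 1) m
    rw [add_sub_cancel] at h1
    refine h1.trans (add_le_add le_rfl ?_)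
    rw [hS, mul_assoc, Finset.sum_mul]
    refine mul_le_mul_of_nonneg_left (Finset.sum_le_sum fun j hj ↦ ?_) (by norm_num)
    have hj' : j + 1 ≤ m := by simpa using hj
    have hj2 : ((j + 1 : ℕ) : ℝ) * a ≤ 1 / 4 := by
      have : ((j + 1 : ℕ) : ℝ) ≤ m := by exact_mod_cast hj'
      nlinarith
    have h2 : ((u x - 1) ^ 2) ≤ D * (a * (x ^ 2 + 1) * Real.exp (a * (x ^ 2 + 1))) := by
      refine (sq_mehlerOp_sub_one_le hb hF h0 hM hF1 x).trans ?_
      rw [mul_comm]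
      exact mul_le_mul_of_nonneg_left (mehlerReal_diag_sub_one_le ha0 ha1 x) hD0
    rw [mul_assoc]
    gcongr
    calc ((u x - 1) ^ 2) ^ (j + 1)
        ≤ (D * (a * (x ^ 2 + 1) * Real.exp (a * (x ^ 2 + 1)))) ^ (j + 1) := by gcongr
      _ ≤ D ^ (j + 1) * ((8 * a) ^ (j + 1) * (j + 1).factorial
          * (3 / 2 * Real.exp (3 * x ^ 2 / 8))) := by
        rw [mul_pow]
        gcongr
        exact pow_mehlerReal_diag_bound ha0 hj2 x
      _ = _ := by ring
  have hi0 : Integrable (fun x ↦ 2 * m * (u x - 1)) (gaussianReal 0 1) :=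
    (hui.sub (integrable_const _)).const_mul _
  have hi1 : Integrable (fun x ↦ 1 + 2 * m * (u x - 1)) (gaussianReal 0 1) :=
    (integrable_const _).add hi0
  have hi2 : Integrable (fun x ↦ S * (3 / 2 * Real.exp (3 * x ^ 2 / 8))) (gaussianReal 0 1) :=
    (integrable_exp_gaussianReal.const_mul _).const_mul _
  have hint : ∫ x, u x ^ (2 * m) ∂gaussianReal 0 1 ≤ 1 + 3 * S := by
    refine (integral_mono hupow (hi1.add hi2) hpt).trans ?_
    have e : ∫ x, (1 + 2 * m * (u x - 1)) ∂gaussianReal 0 1 = 1 := by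
      rw [integral_add (integrable_const _) hi0,
        integral_const_mul, integral_sub hui (integrable_const _), hu1]
      simp
    simp only [Pi.add_apply]
    rw [integral_add hi1 hi2, e, integral_const_mul, integral_const_mul,
      integral_exp_gaussianReal]
    linarith
  refine hint.trans ?_
  have hexp : (∫ x, F x ^ 2 ∂gaussianReal 0 1) = D + 1 := by rw [hD]; ring
  rw [hexp, add_pow, Finset.sum_range_succ', hS, ← mul_assoc, Finset.mul_sum, add_comm (1 : ℝ)]
  simp only [one_pow, mul_one, pow_zero, Nat.choose_zero_right, Nat.cast_one]
  refine add_le_add (Finset.sum_le_sum fun j hj ↦ ?_) le_rfl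
  have hj' : j + 1 ≤ m := by simpa using hj
  have hc : ((2 * m).choose (2 * (j + 1)) : ℝ) * (j + 1).factorial
      ≤ (2 * m) ^ (j + 1) * m.choose (j + 1) := by
    exact_mod_cast choose_two_mul_mul_factorial_le hj'
  calc _ = 6 * (D ^ (j + 1) * (8 * a) ^ (j + 1)
        * (((2 * m).choose (2 * (j + 1)) : ℝ) * (j + 1).factorial)) := by ring
    _ ≤ 6 * (D ^ (j + 1) * (8 * a) ^ (j + 1) * ((2 * m) ^ (j + 1) * m.choose (j + 1))) := by
      gcongr
    _ = (6 * (16 * m * a) ^ (j + 1)) * (D ^ (j + 1) * m.choose (j + 1)) := by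
      have : (16 * m * a) ^ (j + 1) = (8 * a) ^ (j + 1) * (2 * m) ^ (j + 1) := by
        rw [← mul_pow]; congr 1; ring
      rw [this]; ring
    _ ≤ 1 * (D ^ (j + 1) * m.choose (j + 1)) := by
      gcongr
      rw [pow_succ]
      have h9 : 16 * m * a ≤ 1 / 9 := by linarith
      have h10 : (16 * m * a) ^ j ≤ 1 := pow_le_one₀ (by positivity) (by linarith)
      have : 0 ≤ 16 * m * a := by positivity
      nlinarith
    _ = _ := one_mul _

/-- A weak form of hypercontractivity on the real line. -/
theorem integral_mehlerOp_pow_le (hb : |b| < 1) (hF : Measurable F)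
    (h0 : ∀ x, 0 ≤ F x) (hM : ∀ x, F x ≤ M)
    {m : ℕ} (hm : 1 ≤ m) (hmb : 144 * m * b ^ 2 ≤ 1) :
    ∫ x, mehlerOp b F x ^ (2 * m) ∂gaussianReal 0 1 ≤ (∫ x, F x ^ 2 ∂gaussianReal 0 1) ^ m := by
  have hFi : Integrable F (gaussianReal 0 1) := integrable_of_measurable_of_bounded hF h0 hM
  rcases (integral_nonneg h0 : 0 ≤ ∫ x, F x ∂gaussianReal 0 1).eq_or_lt with h | h
  · have hF0 : F =ᵐ[gaussianReal 0 1] 0 := (integral_eq_zero_iff_of_nonneg h0 hFi).1 h.symm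
    have hz : ∀ x, mehlerOp b F x = 0 := fun x ↦ by
      rw [mehlerOp, integral_congr_ae (g := fun _ ↦ (0 : ℝ)), integral_zero]
      filter_upwards [hF0] with y hy
      simp [hy]
    have hz' : ∀ x, mehlerOp b F x ^ (2 * m) = 0 := fun x ↦ by rw [hz, zero_pow (by omega)]
    simp_rw [hz', integral_zero]
    have : 0 ≤ ∫ x, F x ^ 2 ∂gaussianReal 0 1 := integral_nonneg fun x ↦ sq_nonneg _
    positivity
  · set A := ∫ x, F x ∂gaussianReal 0 1
    have key := integral_mehlerOp_pow_le_of_integral_eq_one hb (F := fun x ↦ A⁻¹ * F x)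
      (hF.const_mul _) (M := A⁻¹ * M) (fun x ↦ mul_nonneg (by positivity) (h0 x))
      (fun x ↦ mul_le_mul_of_nonneg_left (hM x) (by positivity)) hm hmb
      (by rw [integral_const_mul, inv_mul_cancel₀ h.ne'])
    have e : ∀ x, mehlerOp b (fun x ↦ A⁻¹ * F x) x = A⁻¹ * mehlerOp b F x := fun x ↦ by
      simp only [mehlerOp]
      rw [← integral_const_mul]
      congr 1; ext y; ring
    simp_rw [e, mul_pow] at key
    rw [integral_const_mul, integral_const_mul, mul_pow, ← pow_mul] at key
    exact le_of_mul_le_mul_left key (by positivity)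
end

/-- The kernel `K` defines a bounded bilinear form on `L² × Lᵖ` with norm at most one. -/
def KernelBound {X : Type*} [MeasurableSpace X] (μ : Measure X) (K : X → X → ℝ≥0∞) (p : ℝ) : Prop :=
  ∀ F G : X → ℝ≥0∞, Measurable F → Measurable G → (∃ M : ℝ≥0, ∀ x, F x ≤ M) →
    ∫⁻ x, ∫⁻ y, F x * G y * K x y ∂μ ∂μ
      ≤ (∫⁻ x, F x ^ (2 : ℝ) ∂μ) ^ (1 / 2 : ℝ) * (∫⁻ x, G x ^ p ∂μ) ^ (1 / p)

theorem KernelBound.prod {X Y : Type*} [MeasurableSpace X] [MeasurableSpace Y] {μ : Measure X}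
    {ν : Measure Y} [IsProbabilityMeasure μ] [IsProbabilityMeasure ν] {K : X → X → ℝ≥0∞}
    {L : Y → Y → ℝ≥0∞} {p : ℝ} (hp : 0 < p) (hK : KernelBound μ K p) (hL : KernelBound ν L p)
    (hKm : Measurable (Function.uncurry K)) (hLm : Measurable (Function.uncurry L)) :
    KernelBound (μ.prod ν) (fun u v ↦ K u.1 v.1 * L u.2 v.2) p := by
  rintro F G hF hG ⟨M, hM⟩
  have hKm' : Measurable fun q : X × X ↦ K q.1 q.2 := hKm
  have hLm' : Measurable fun q : Y × Y ↦ L q.1 q.2 := hLm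
  set A : X → ℝ≥0∞ := fun x ↦ (∫⁻ x', F (x, x') ^ (2 : ℝ) ∂ν) ^ (1 / 2 : ℝ) with hA
  set B : X → ℝ≥0∞ := fun y ↦ (∫⁻ y', G (y, y') ^ p ∂ν) ^ (1 / p) with hB
  have hF2 : Measurable fun u ↦ F u ^ (2 : ℝ) := hF.pow_const _
  have hGp : Measurable fun u ↦ G u ^ p := hG.pow_const _
  have hAm : Measurable A := (hF2.lintegral_prod_right').pow_const _
  have hBm : Measurable B := (hGp.lintegral_prod_right').pow_const _
  have hAM : ∀ x, A x ≤ M := fun x ↦ by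
    calc A x ≤ (∫⁻ _, (M : ℝ≥0∞) ^ (2 : ℝ) ∂ν) ^ (1 / 2 : ℝ) := by
          simp only [hA]
          gcongr
          exact hM _
      _ = M := by
          rw [lintegral_const, measure_univ, mul_one, ← ENNReal.rpow_mul]
          norm_num
  have m1 : Measurable fun q : (X × Y) × (X × Y) ↦
      F q.1 * G q.2 * (K q.1.1 q.2.1 * L q.1.2 q.2.2) := by
    refine ((hF.comp measurable_fst).mul (hG.comp measurable_snd)).mul (Measurable.mul ?_ ?_)
    · exact hKm'.comp ((measurable_fst.comp measurable_fst).prodMk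
        (measurable_fst.comp measurable_snd))
    · exact hLm'.comp ((measurable_snd.comp measurable_fst).prodMk
        (measurable_snd.comp measurable_snd))
  calc ∫⁻ u, ∫⁻ v, F u * G v * (K u.1 v.1 * L u.2 v.2) ∂μ.prod ν ∂μ.prod ν
      = ∫⁻ x, ∫⁻ x', ∫⁻ y, ∫⁻ y', F (x, x') * G (y, y') * (K x y * L x' y') ∂ν ∂μ ∂ν ∂μ := by
        rw [lintegral_prod _ (m1.lintegral_prod_right').aemeasurable]
        refine lintegral_congr fun x ↦ lintegral_congr fun x' ↦ ?_
        have := m1.comp (measurable_prodMk_left (x := (x, x')))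
        exact lintegral_prod _ this.aemeasurable
    _ = ∫⁻ x, ∫⁻ y, ∫⁻ x', ∫⁻ y', F (x, x') * G (y, y') * (K x y * L x' y') ∂ν ∂ν ∂μ ∂μ := by
        refine lintegral_congr fun x ↦ ?_
        rw [lintegral_lintegral_swap]
        refine Measurable.aemeasurable ?_
        have : Measurable fun q : (Y × X) × Y ↦
            F (x, q.1.1) * G (q.1.2, q.2) * (K x q.1.2 * L q.1.1 q.2) := by
          refine m1.comp (Measurable.prodMk (f := fun q : (Y × X) × Y ↦ (x, q.1.1))
            (g := fun q : (Y × X) × Y ↦ (q.1.2, q.2)) ?_ ?_) <;> fun_prop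
        exact this.lintegral_prod_right'
    _ ≤ ∫⁻ x, ∫⁻ y, A x * B y * K x y ∂μ ∂μ := by
        refine lintegral_mono fun x ↦ lintegral_mono fun y ↦ ?_
        calc ∫⁻ x', ∫⁻ y', F (x, x') * G (y, y') * (K x y * L x' y') ∂ν ∂ν
            = ∫⁻ x', ∫⁻ y', K x y * (F (x, x') * G (y, y') * L x' y') ∂ν ∂ν := by
              refine lintegral_congr fun x' ↦ lintegral_congr fun y' ↦ ?_
              ring
          _ = K x y * ∫⁻ x', ∫⁻ y', F (x, x') * G (y, y') * L x' y' ∂ν ∂ν := by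
              have m2 : Measurable fun q : Y × Y ↦ F (x, q.1) * G (y, q.2) * L q.1 q.2 := by
                refine ((hF.comp ?_).mul (hG.comp ?_)).mul hLm' <;> fun_prop
              rw [← lintegral_const_mul _ m2.lintegral_prod_right']
              refine lintegral_congr fun x' ↦ ?_
              exact lintegral_const_mul _ (m2.comp (measurable_prodMk_left (x := x')))
          _ ≤ K x y * (A x * B y) := by
              gcongr
              exact hL (fun x' ↦ F (x, x')) (fun y' ↦ G (y, y')) (hF.comp measurable_prodMk_left)
                (hG.comp measurable_prodMk_left) ⟨M, fun x' ↦ hM _⟩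
          _ = _ := mul_comm _ _
    _ ≤ _ := hK A B hAm hBm ⟨M, hAM⟩
    _ = _ := by
        rw [lintegral_prod _ hF2.aemeasurable, lintegral_prod _ hGp.aemeasurable]
        simp only [hA, hB, ← ENNReal.rpow_mul]
        rw [show (1 / 2 * 2 : ℝ) = 1 by norm_num, show 1 / p * p = 1 by field_simp]
        simp only [ENNReal.rpow_one]

theorem KernelBound.comp_equiv {X Y : Type*} [MeasurableSpace X] [MeasurableSpace Y] {μ : Measure X}
    {ν : Measure Y} {K : Y → Y → ℝ≥0∞} {p : ℝ} (e : X ≃ᵐ Y) (he : MeasurePreserving e μ ν)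
    (hK : KernelBound ν K p) : KernelBound μ (fun x y ↦ K (e x) (e y)) p := by
  rintro F G hF hG ⟨M, hM⟩
  have h := hK (F ∘ e.symm) (G ∘ e.symm) (hF.comp e.symm.measurable) (hG.comp e.symm.measurable)
    ⟨M, fun x ↦ hM _⟩
  have hi : ∀ H : Y → ℝ≥0∞, ∫⁻ y, H y ∂ν = ∫⁻ x, H (e x) ∂μ := fun H ↦
    (he.lintegral_comp_emb e.measurableEmbedding H).symm
  simp_rw [hi] at h
  simpa using h

theorem KernelBound.pi {k : ℝ → ℝ → ℝ≥0∞} {γ : Measure ℝ} [IsProbabilityMeasure γ] {p : ℝ}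
    (hp : 0 < p) (hk : KernelBound γ k p) (hkm : Measurable (Function.uncurry k)) (n : ℕ) :
    KernelBound (Measure.pi fun _ : Fin n ↦ γ) (fun x y ↦ ∏ i, k (x i) (y i)) p := by
  induction n with
  | zero =>
    rintro F G hF hG ⟨M, hM⟩
    rw [Measure.pi_of_empty (x := fun i ↦ i.elim0)]
    simp only [lintegral_dirac, Finset.univ_eq_empty, Finset.prod_empty, mul_one,
      ← ENNReal.rpow_mul]
    rw [show (2 * (1 / 2) : ℝ) = 1 by norm_num, show p * (1 / p) = 1 by field_simp]
    simp
  | succ n ih =>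
    have hkm' : Measurable fun q : ℝ × ℝ ↦ k q.1 q.2 := hkm
    have hm : Measurable (Function.uncurry fun x y : Fin n → ℝ ↦ ∏ i, k (x i) (y i)) := by
      refine Finset.measurable_prod _ fun i _ ↦ ?_
      exact hkm'.comp (Measurable.prodMk (f := fun q : (Fin n → ℝ) × (Fin n → ℝ) ↦ q.1 i)
        (g := fun q : (Fin n → ℝ) × (Fin n → ℝ) ↦ q.2 i) (by fun_prop) (by fun_prop))
    have := (hk.prod hp ih hkm hm).comp_equiv _ (measurePreserving_piFinSuccAbove (fun _ ↦ γ) 0)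
    convert this using 3 with x y
    rw [Fin.prod_univ_succ]
    rfl

theorem kernelBound_mehlerReal {b : ℝ} (hb : |b| < 1) {m : ℕ} (hm : 1 ≤ m)
    (hmb : 144 * m * b ^ 2 ≤ 1) {p : ℝ} (hp : (2 * m : ℝ).HolderConjugate p) :
    KernelBound (gaussianReal 0 1) (fun x y ↦ ENNReal.ofReal (mehlerReal b x y)) p := by
  rintro F G hF hG ⟨M, hM⟩
  have hkm : Measurable fun q : ℝ × ℝ ↦ ENNReal.ofReal (mehlerReal b q.1 q.2) :=
    (continuous_mehlerReal b).measurable.ennreal_ofReal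
  have hFt : ∀ x, F x ≠ ∞ := fun x ↦ ne_top_of_le_ne_top ENNReal.coe_ne_top (hM x)
  set f : ℝ → ℝ := fun x ↦ (F x).toReal with hf
  have hfF : ∀ x, ENNReal.ofReal (f x) = F x := fun x ↦ ENNReal.ofReal_toReal (hFt x)
  have hfm : Measurable f := hF.ennreal_toReal
  have hf0 : ∀ x, 0 ≤ f x := fun x ↦ ENNReal.toReal_nonneg
  have hfM : ∀ x, f x ≤ M := fun x ↦ ENNReal.toReal_mono ENNReal.coe_ne_top (hM x)
  have hU : ∀ y, ∫⁻ x, F x * ENNReal.ofReal (mehlerReal b x y) ∂gaussianReal 0 1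
      = ENNReal.ofReal (mehlerOp b f y) := fun y ↦ by
    rw [mehlerOp, ofReal_integral_eq_lintegral_ofReal
      (integrable_mehlerReal_mul_bounded hb hfm hf0 hfM y)
      (Filter.Eventually.of_forall fun x ↦ mul_nonneg (mehlerReal_nonneg _ _ _) (hf0 x))]
    refine lintegral_congr fun x ↦ ?_
    rw [ENNReal.ofReal_mul (mehlerReal_nonneg _ _ _), hfF, mul_comm, mehlerReal_comm]
  have hopm : Measurable (mehlerOp b f) := measurable_mehlerOp hfm
  have hm0 : (0 : ℝ) < m := by exact_mod_cast hm
  calc ∫⁻ x, ∫⁻ y, F x * G y * ENNReal.ofReal (mehlerReal b x y) ∂gaussianReal 0 1 ∂gaussianReal 0 1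
      = ∫⁻ y, ∫⁻ x, F x * G y * ENNReal.ofReal (mehlerReal b x y) ∂gaussianReal 0 1
          ∂gaussianReal 0 1 := by
        rw [lintegral_lintegral_swap]
        exact (((hF.comp measurable_fst).mul (hG.comp measurable_snd)).mul hkm).aemeasurable
    _ = ∫⁻ y, (fun y ↦ ENNReal.ofReal (mehlerOp b f y)) y * G y ∂gaussianReal 0 1 := by
        refine lintegral_congr fun y ↦ ?_
        beta_reduce
        rw [← hU, ← lintegral_mul_const]
        · refine lintegral_congr fun x ↦ by ring
        · have := hkm.comp (measurable_prodMk_right (y := y))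
          exact hF.mul this
    _ ≤ (∫⁻ y, ENNReal.ofReal (mehlerOp b f y) ^ (2 * m : ℝ) ∂gaussianReal 0 1) ^ (1 / (2 * m : ℝ))
          * (∫⁻ y, G y ^ p ∂gaussianReal 0 1) ^ (1 / p) :=
        ENNReal.lintegral_mul_le_Lp_mul_Lq _ hp hopm.ennreal_ofReal.aemeasurable hG.aemeasurable
    _ ≤ _ := by
        gcongr ?_ * _
        have h1 : ∫⁻ y, ENNReal.ofReal (mehlerOp b f y) ^ (2 * m : ℝ) ∂gaussianReal 0 1
            = ENNReal.ofReal (∫ y, mehlerOp b f y ^ (2 * m) ∂gaussianReal 0 1) := by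
          have hn : ∀ y, 0 ≤ mehlerOp b f y := mehlerOp_nonneg hf0
          rw [ofReal_integral_eq_lintegral_ofReal
            (integrable_of_measurable_of_bounded (M := (M : ℝ) ^ (2 * m)) (hopm.pow_const _)
              (fun x ↦ pow_nonneg (hn x) _)
              fun x ↦ pow_le_pow_left₀ (hn x) (mehlerOp_le hb hfm hf0 hfM x) _)
            (Filter.Eventually.of_forall fun x ↦ pow_nonneg (hn x) _)]
          refine lintegral_congr fun y ↦ ?_
          rw [ENNReal.ofReal_pow (hn y), ← ENNReal.rpow_natCast]
          push_cast; rfl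
        have h2 : ENNReal.ofReal (∫ x, f x ^ 2 ∂gaussianReal 0 1)
            = ∫⁻ x, F x ^ (2 : ℝ) ∂gaussianReal 0 1 := by
          rw [ofReal_integral_eq_lintegral_ofReal
            (integrable_of_measurable_of_bounded (M := (M : ℝ) ^ 2) (hfm.pow_const _)
              (fun x ↦ sq_nonneg _) fun x ↦ pow_le_pow_left₀ (hf0 x) (hfM x) _)
            (Filter.Eventually.of_forall fun x ↦ sq_nonneg _)]
          refine lintegral_congr fun y ↦ ?_
          rw [ENNReal.ofReal_pow (hf0 y), hfF]
          norm_cast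
        rw [h1, ← h2]
        calc _ ≤ (ENNReal.ofReal ((∫ x, f x ^ 2 ∂gaussianReal 0 1) ^ m)) ^ (1 / (2 * m : ℝ)) := by
              gcongr
              exact integral_mehlerOp_pow_le hb hfm hf0 hfM hm hmb
          _ = _ := by
              rw [ENNReal.ofReal_pow (integral_nonneg fun x ↦ sq_nonneg _), ← ENNReal.rpow_natCast,
                ← ENNReal.rpow_mul]
              congr 1
              field_simp

/-- The standard Gaussian measure on `Fin n → ℝ`. -/
noncomputable abbrev gaussPi (n : ℕ) : Measure (Fin n → ℝ) := Measure.pi fun _ ↦ gaussianReal 0 1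

/-- The Mehler kernel on `Fin n → ℝ`. -/
noncomputable def mehlerPi {n : ℕ} (z : ℂ) (r : ℝ) (x y : Fin n → ℝ) : ℂ :=
  ∏ i, mehler z r (x i) (y i)

section
variable {n : ℕ}

theorem mehlerPi_comm (z : ℂ) (r : ℝ) (x y : Fin n → ℝ) : mehlerPi z r x y = mehlerPi z r y x := by
  simp only [mehlerPi, mehler_comm z r (x _)]

theorem mehlerPi_zero (x y : Fin n → ℝ) : mehlerPi 0 0 x y = 1 := by
  simp [mehlerPi, mehler_zero]

theorem conj_mehlerPi (z : ℂ) (r : ℝ) (x y : Fin n → ℝ) :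
    (starRingEnd ℂ) (mehlerPi z r x y) = mehlerPi ((starRingEnd ℂ) z) r x y := by
  simp only [mehlerPi, map_prod, conj_mehler]

theorem continuous_mehlerPi (z : ℂ) (r : ℝ) :
    Continuous fun p : (Fin n → ℝ) × (Fin n → ℝ) ↦ mehlerPi z r p.1 p.2 := by
  refine continuous_finsetProd _ fun i _ ↦ ?_
  exact (continuous_mehler z r).comp
    (f := fun p : (Fin n → ℝ) × (Fin n → ℝ) ↦ (p.1 i, p.2 i)) (by fun_prop)

theorem integrable_mehlerPi_mul (z w : ℂ) {r r' : ℝ} (hr : |r| < 1) (hr' : |r'| < 1)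
    (x y : Fin n → ℝ) :
    Integrable (fun u ↦ mehlerPi z r x u * mehlerPi w r' u y) (gaussPi n) := by
  simp only [mehlerPi, ← Finset.prod_mul_distrib]
  exact Integrable.fintype_prod (f := fun i u ↦ mehler z r (x i) u * mehler w r' u (y i))
    fun i ↦ integrable_mehler_mul_mehler z w hr hr' (x i) (y i)

theorem integral_mehlerPi_mul {z w : ℂ} {r r' : ℝ} (hz : z ^ 2 = r) (hw : w ^ 2 = r')
    (hr : |r| < 1) (hr' : |r'| < 1) (x y : Fin n → ℝ) :
    ∫ u, mehlerPi z r x u * mehlerPi w r' u y ∂gaussPi n = mehlerPi (z * w) (r * r') x y := by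
  simp only [mehlerPi, ← Finset.prod_mul_distrib]
  rw [integral_fintype_prod_eq_prod (f := fun i u ↦ mehler z r (x i) u * mehler w r' u (y i))]
  exact Finset.prod_congr rfl fun i _ ↦ integral_mehler_mul_mehler hz hw hr hr' (x i) (y i)

theorem integrable_mehlerPi_diag {a : ℝ} (ha : |a| < 1) :
    Integrable (fun x ↦ mehlerPi a (a ^ 2) x x) (gaussPi n) :=
  Integrable.fintype_prod (f := fun _ x ↦ mehler a (a ^ 2) x x) fun _ ↦ integrable_mehler_diag ha

theorem integral_mehlerPi_diag {a : ℝ} (ha : |a| < 1) :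
    ∫ x, mehlerPi a (a ^ 2) x x ∂gaussPi n = (((1 - a)⁻¹ ^ n : ℝ) : ℂ) := by
  simp only [mehlerPi]
  rw [integral_fintype_prod_eq_prod (f := fun _ x ↦ mehler a (a ^ 2) x x)]
  simp [integral_mehler_diag ha]

/-- The weight that dominates the Mehler kernel. -/
noncomputable def mehlerWeight {n : ℕ} (r : ℝ) (x : Fin n → ℝ) : ℝ :=
  ∏ i, (√(√(1 - r))⁻¹ * Real.exp (√|r| / (1 + √|r|) * x i ^ 2 / 2))

theorem mehlerWeight_nonneg (r : ℝ) (x : Fin n → ℝ) : 0 ≤ mehlerWeight r x := by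
  unfold mehlerWeight; positivity

theorem measurable_mehlerWeight (r : ℝ) : Measurable (mehlerWeight (n := n) r) := by
  unfold mehlerWeight; fun_prop

theorem norm_mehlerPi_le {z : ℂ} {r : ℝ} (hz : z ^ 2 = r) (hr : |r| < 1) (x y : Fin n → ℝ) :
    ‖mehlerPi z r x y‖ ≤ mehlerWeight r x * mehlerWeight r y := by
  have hn : ‖z‖ = √|r| := by
    rw [← Real.sqrt_sq (norm_nonneg z), ← norm_pow, hz, Complex.norm_real, Real.norm_eq_abs]
  rw [mehlerPi, norm_prod, mehlerWeight, mehlerWeight, ← Finset.prod_mul_distrib]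
  refine Finset.prod_le_prod (fun i _ ↦ norm_nonneg _) fun i _ ↦ ?_
  refine (norm_mehler_le hz hr le_rfl (x i) (y i)).trans_eq ?_
  have h0 : 0 ≤ (√(1 - r))⁻¹ := by positivity
  nth_rw 1 [← Real.mul_self_sqrt h0]
  rw [hn]
  ring

theorem memLp_mehlerWeight {r : ℝ} (hr : |r| < 1) :
    MemLp (mehlerWeight (n := n) r) 2 (gaussPi n) := by
  rw [memLp_two_iff_integrable_sq (measurable_mehlerWeight r).aestronglyMeasurable]
  simp only [mehlerWeight, ← Finset.prod_pow]
  refine Integrable.fintype_prod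
    (f := fun _ u ↦ (√(√(1 - r))⁻¹ * Real.exp (√|r| / (1 + √|r|) * u ^ 2 / 2)) ^ 2) fun i ↦ ?_
  have hs : √|r| < 1 := by
    rw [Real.sqrt_lt' one_pos]; simpa using hr
  have hs0 := Real.sqrt_nonneg |r|
  have hp : 2 * (√|r| / (1 + √|r|)) < 1 := by
    rw [mul_div_assoc', div_lt_one (by linarith)]; linarith
  refine (((integrable_cexp_quadratic_gaussianReal hp 0 0).re).const_mul (√(√(1 - r))⁻¹ ^ 2)).congr
    (Filter.Eventually.of_forall fun u ↦ ?_)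
  have : (((2 * (√|r| / (1 + √|r|)) : ℝ) : ℂ) * u ^ 2 / 2 + 0 * u + 0)
    = ((2 * (√|r| / (1 + √|r|)) * u ^ 2 / 2 : ℝ) : ℂ) := by push_cast; ring
  simp only [this, ← Complex.ofReal_exp, RCLike.re_to_complex, Complex.ofReal_re, mul_pow]
  rw [← Real.exp_nat_mul]
  congr 2
  push_cast
  ring

/-- A square root of a real number, chosen on the positive real or positive imaginary axis. -/
noncomputable def axisSqrt (r : ℝ) : ℂ := (√r : ℂ) + √(-r) * Complex.I

theorem axisSqrt_sq (r : ℝ) : axisSqrt r ^ 2 = r := by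
  rcases le_total 0 r with h | h
  · rw [axisSqrt, Real.sqrt_eq_zero_of_nonpos (neg_nonpos.2 h)]
    simp only [Complex.ofReal_zero, zero_mul, add_zero]
    exact_mod_cast Real.sq_sqrt h
  · rw [axisSqrt, Real.sqrt_eq_zero_of_nonpos h]
    simp only [Complex.ofReal_zero, zero_add, mul_pow, Complex.I_sq, mul_neg, mul_one]
    rw [← Complex.ofReal_pow, Real.sq_sqrt (neg_nonneg.2 h)]
    simp

/-- The even part of the Mehler kernel, parametrized by the square of its parameter. -/
noncomputable def evenMehler {n : ℕ} (r : ℝ) (x y : Fin n → ℝ) : ℝ :=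
  ((mehlerPi (axisSqrt r) r x y + mehlerPi (-axisSqrt r) r x y) / 2).re

theorem ofReal_evenMehler {z : ℂ} {r : ℝ} (hz : z ^ 2 = r) (x y : Fin n → ℝ) :
    (evenMehler r x y : ℂ) = (mehlerPi z r x y + mehlerPi (-z) r x y) / 2 := by
  have key : (evenMehler r x y : ℂ)
      = (mehlerPi (axisSqrt r) r x y + mehlerPi (-axisSqrt r) r x y) / 2 := by
    rw [evenMehler]
    refine Complex.conj_eq_iff_re.1 ?_
    have h : ((starRingEnd ℂ) (axisSqrt r)) ^ 2 = axisSqrt r ^ 2 := by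
      rw [← map_pow, axisSqrt_sq, Complex.conj_ofReal]
    rw [map_div₀, map_add, conj_mehlerPi, conj_mehlerPi, map_neg, map_ofNat]
    rcases sq_eq_sq_iff_eq_or_eq_neg.1 h with h | h
    · rw [h]
    · rw [h, neg_neg, add_comm]
  have h : z ^ 2 = axisSqrt r ^ 2 := by rw [hz, axisSqrt_sq]
  rw [key]
  rcases sq_eq_sq_iff_eq_or_eq_neg.1 h with h | h
  · rw [h]
  · rw [h, neg_neg, add_comm]

theorem evenMehler_comm (r : ℝ) (x y : Fin n → ℝ) : evenMehler r x y = evenMehler r y x := by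
  simp only [evenMehler, mehlerPi_comm _ r x y]

theorem evenMehler_zero (x y : Fin n → ℝ) : evenMehler 0 x y = 1 := by
  simp [evenMehler, axisSqrt, mehlerPi_zero]

theorem measurable_evenMehler (r : ℝ) :
    Measurable fun p : (Fin n → ℝ) × (Fin n → ℝ) ↦ evenMehler r p.1 p.2 := by
  refine Continuous.measurable (Complex.continuous_re.comp (Continuous.div_const ?_ _))
  exact (continuous_mehlerPi _ _).add (continuous_mehlerPi _ _)

theorem abs_evenMehler_le {r : ℝ} (hr : |r| < 1) (x y : Fin n → ℝ) :
    |evenMehler r x y| ≤ mehlerWeight r x * mehlerWeight r y := by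
  refine (Complex.abs_re_le_norm _).trans ?_
  rw [norm_div, Complex.norm_ofNat, div_le_iff₀ (by norm_num)]
  refine (norm_add_le _ _).trans ?_
  have h1 := norm_mehlerPi_le (axisSqrt_sq r) hr x y
  have h2 := norm_mehlerPi_le (z := -axisSqrt r) (by rw [neg_sq, axisSqrt_sq]) hr x y
  linarith

theorem integral_evenMehler_mul {r r' : ℝ} (hr : |r| < 1) (hr' : |r'| < 1) (x y : Fin n → ℝ) :
    ∫ u, evenMehler r x u * evenMehler r' u y ∂gaussPi n = evenMehler (r * r') x y := by
  have hz := axisSqrt_sq r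
  have hw := axisSqrt_sq r'
  set z := axisSqrt r
  set w := axisSqrt r'
  have hz' : (-z) ^ 2 = r := by rw [neg_sq, hz]
  have hw' : (-w) ^ 2 = r' := by rw [neg_sq, hw]
  refine Complex.ofReal_injective ?_
  rw [← integral_complex_ofReal, ofReal_evenMehler (z := z * w) (by
    rw [mul_pow, hz, hw]; push_cast; rfl)]
  have e : ∀ u, ((evenMehler r x u * evenMehler r' u y : ℝ) : ℂ)
      = ((mehlerPi z r x u * mehlerPi w r' u y + mehlerPi z r x u * mehlerPi (-w) r' u y)
        + (mehlerPi (-z) r x u * mehlerPi w r' u y + mehlerPi (-z) r x u * mehlerPi (-w) r' u y))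
        * (1 / 4) := fun u ↦ by
    rw [Complex.ofReal_mul, ofReal_evenMehler hz, ofReal_evenMehler hw]; ring
  have i (z w : ℂ) := integrable_mehlerPi_mul z w hr hr' x y
  have i1 : Integrable (fun u ↦ mehlerPi z r x u * mehlerPi w r' u y
    + mehlerPi z r x u * mehlerPi (-w) r' u y) (gaussPi n) := (i _ _).add (i _ _)
  have i2 : Integrable (fun u ↦ mehlerPi (-z) r x u * mehlerPi w r' u y
    + mehlerPi (-z) r x u * mehlerPi (-w) r' u y) (gaussPi n) := (i _ _).add (i _ _)
  simp_rw [e]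
  rw [integral_mul_const, integral_add i1 i2, integral_add (i _ _) (i _ _),
    integral_add (i _ _) (i _ _), integral_mehlerPi_mul hz hw hr hr',
    integral_mehlerPi_mul hz hw' hr hr', integral_mehlerPi_mul hz' hw hr hr',
    integral_mehlerPi_mul hz' hw' hr hr']
  rw [neg_mul_neg, mul_neg, neg_mul]
  ring

theorem integral_evenMehler {r : ℝ} (hr : |r| < 1) (x : Fin n → ℝ) :
    ∫ u, evenMehler r x u ∂gaussPi n = 1 := by
  have := integral_evenMehler_mul (r' := 0) hr (by simp) x 0
  simpa [evenMehler_zero] using this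

theorem integrable_evenMehler_diag {a : ℝ} (ha : |a| < 1) :
    Integrable (fun x ↦ evenMehler (a ^ 2) x x) (gaussPi n) := by
  have h1 := integrable_mehlerPi_diag (n := n) ha
  have h2 := integrable_mehlerPi_diag (n := n) (a := -a) (by rwa [abs_neg])
  rw [neg_sq] at h2
  refine ((h1.add h2).div_const 2).re.congr (Filter.Eventually.of_forall fun x ↦ ?_)
  have := ofReal_evenMehler (z := a) (r := a ^ 2) (by push_cast; rfl) x x
  simp only [Pi.add_apply, Complex.ofReal_neg, ← this, RCLike.re_to_complex, Complex.ofReal_re]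

theorem integral_evenMehler_diag {a : ℝ} (ha : |a| < 1) :
    ∫ x, evenMehler (a ^ 2) x x ∂gaussPi n = ((1 - a)⁻¹ ^ n + (1 + a)⁻¹ ^ n) / 2 := by
  have ha' : |-a| < 1 := by rwa [abs_neg]
  have h1 := integrable_mehlerPi_diag (n := n) ha
  have h2 := integrable_mehlerPi_diag (n := n) ha'
  have h3 := integral_mehlerPi_diag (n := n) ha'
  rw [neg_sq] at h2 h3
  rw [sub_neg_eq_add, Complex.ofReal_neg] at h3
  rw [Complex.ofReal_neg] at h2
  refine Complex.ofReal_injective ?_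
  rw [← integral_complex_ofReal]
  simp_rw [ofReal_evenMehler (z := a) (r := a ^ 2) (by push_cast; rfl)]
  rw [integral_div, integral_add h1 h2, h3, integral_mehlerPi_diag ha]
  push_cast
  rfl
end

section
variable {n : ℕ} {r r' : ℝ} {F G : (Fin n → ℝ) → ℝ}

/-- The even part of the Mehler semigroup, parametrized by the square of its parameter. -/
noncomputable def evenOp (r : ℝ) (F : (Fin n → ℝ) → ℝ) (x : Fin n → ℝ) : ℝ :=
  ∫ y, evenMehler r x y * F y ∂gaussPi n

theorem integrable_evenMehler_mul (hr : |r| < 1) (hF : MemLp F 2 (gaussPi n)) (x : Fin n → ℝ) :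
    Integrable (fun y ↦ evenMehler r x y * F y) (gaussPi n) := by
  have h1 : Integrable (fun y ↦ mehlerWeight r y * |F y|) (gaussPi n) :=
    (memLp_mehlerWeight hr).integrable_mul hF.abs
  refine (h1.const_mul (mehlerWeight r x)).mono'
    (((measurable_evenMehler r).comp
      (measurable_prodMk_left (x := x))).aestronglyMeasurable.mul hF.1)
    (Filter.Eventually.of_forall fun y ↦ ?_)
  rw [norm_mul, Real.norm_eq_abs, Real.norm_eq_abs, ← mul_assoc]
  gcongr
  exact abs_evenMehler_le hr x y

theorem integrable_evenMehler (hr : |r| < 1) (x : Fin n → ℝ) :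
    Integrable (fun y ↦ evenMehler r x y) (gaussPi n) := by
  simpa using integrable_evenMehler_mul hr (F := fun _ ↦ 1) (memLp_const 1) x

theorem abs_evenOp_le (hr : |r| < 1) (hF : MemLp F 2 (gaussPi n)) (x : Fin n → ℝ) :
    |evenOp r F x| ≤ mehlerWeight r x * ∫ y, mehlerWeight r y * |F y| ∂gaussPi n := by
  have h1 : Integrable (fun y ↦ mehlerWeight r y * |F y|) (gaussPi n) :=
    (memLp_mehlerWeight hr).integrable_mul hF.abs
  rw [evenOp, ← integral_const_mul]
  refine abs_integral_le_integral_abs.trans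
    (integral_mono (integrable_evenMehler_mul hr hF x).abs (h1.const_mul _) fun y ↦ ?_)
  simp only [abs_mul]
  rw [← mul_assoc]
  gcongr
  exact abs_evenMehler_le hr x y

theorem measurable_evenOp (hF : Measurable F) : Measurable (evenOp r F) := by
  have : StronglyMeasurable fun p : (Fin n → ℝ) × (Fin n → ℝ) ↦ evenMehler r p.1 p.2 * F p.2 :=
    ((measurable_evenMehler r).mul (hF.comp measurable_snd)).stronglyMeasurable
  exact this.integral_prod_right'.measurable

theorem memLp_evenOp (hr : |r| < 1) (hFm : Measurable F) (hF : MemLp F 2 (gaussPi n)) :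
    MemLp (evenOp r F) 2 (gaussPi n) := by
  refine MemLp.of_le_mul (c := ∫ y, mehlerWeight r y * |F y| ∂gaussPi n) (memLp_mehlerWeight hr)
    (measurable_evenOp hFm).aestronglyMeasurable (Filter.Eventually.of_forall fun x ↦ ?_)
  rw [Real.norm_eq_abs, Real.norm_of_nonneg (mehlerWeight_nonneg _ _), mul_comm]
  exact abs_evenOp_le hr hF x

theorem integral_mul_evenOp_comm (hr : |r| < 1) (hFm : Measurable F) (hGm : Measurable G)
    (hF : MemLp F 2 (gaussPi n)) (hG : MemLp G 2 (gaussPi n)) :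
    ∫ x, F x * evenOp r G x ∂gaussPi n = ∫ x, evenOp r F x * G x ∂gaussPi n := by
  have hi : Integrable (Function.uncurry fun x y ↦ F x * (evenMehler r x y * G y))
      ((gaussPi n).prod (gaussPi n)) := by
    have hw := memLp_mehlerWeight (n := n) hr
    have h1 : Integrable (fun p : (Fin n → ℝ) × (Fin n → ℝ) ↦
        (|F p.1| * mehlerWeight r p.1) * (mehlerWeight r p.2 * |G p.2|))
        ((gaussPi n).prod (gaussPi n)) :=
      Integrable.mul_prod (f := fun x ↦ |F x| * mehlerWeight r x)
        (g := fun x ↦ mehlerWeight r x * |G x|) (hF.abs.integrable_mul hw)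
      (hw.integrable_mul hG.abs)
    refine h1.mono' ((hFm.comp measurable_fst).mul
      ((measurable_evenMehler r).mul (hGm.comp measurable_snd))).aestronglyMeasurable
      (Filter.Eventually.of_forall fun p ↦ ?_)
    simp only [Function.uncurry, norm_mul, Real.norm_eq_abs]
    calc _ ≤ |F p.1| * ((mehlerWeight r p.1 * mehlerWeight r p.2) * |G p.2|) := by
          gcongr
          exact abs_evenMehler_le hr _ _
      _ = _ := by ring
  simp only [evenOp, ← integral_const_mul, ← integral_mul_const]
  rw [integral_integral_swap hi]
  refine integral_congr_ae (Filter.Eventually.of_forall fun y ↦ ?_)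
  refine integral_congr_ae (Filter.Eventually.of_forall fun x ↦ ?_)
  simp only [evenMehler_comm r x y]
  ring

theorem evenOp_evenOp (hr : |r| < 1) (hr' : |r'| < 1) (hGm : Measurable G)
    (hG : MemLp G 2 (gaussPi n)) (x : Fin n → ℝ) :
    evenOp r (evenOp r' G) x = evenOp (r * r') G x := by
  have hi : Integrable (Function.uncurry fun v y ↦ evenMehler r x v * (evenMehler r' v y * G y))
      ((gaussPi n).prod (gaussPi n)) := by
    have hw := memLp_mehlerWeight (n := n) hr
    have hw' := memLp_mehlerWeight (n := n) hr'
    have h1 : Integrable (fun p : (Fin n → ℝ) × (Fin n → ℝ) ↦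
        (mehlerWeight r p.1 * mehlerWeight r' p.1) * (mehlerWeight r' p.2 * |G p.2|))
        ((gaussPi n).prod (gaussPi n)) :=
      Integrable.mul_prod (f := fun x ↦ mehlerWeight r x * mehlerWeight r' x)
        (g := fun x ↦ mehlerWeight r' x * |G x|) (hw.integrable_mul hw') (hw'.integrable_mul hG.abs)
    have hm0 : Measurable fun v : Fin n → ℝ ↦ (x, v) := measurable_prodMk_left (x := x)
    have hm1 := (measurable_evenMehler r).comp hm0
    have hm : Measurable fun p : (Fin n → ℝ) × (Fin n → ℝ) ↦ evenMehler r x p.1 :=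
      hm1.comp measurable_fst
    refine (h1.const_mul (mehlerWeight r x)).mono' (hm.mul
      ((measurable_evenMehler r').mul (hGm.comp measurable_snd))).aestronglyMeasurable
      (Filter.Eventually.of_forall fun p ↦ ?_)
    simp only [Function.uncurry, norm_mul, Real.norm_eq_abs]
    have e1 := abs_evenMehler_le hr x p.1
    have e2 := abs_evenMehler_le hr' p.1 p.2
    have := mehlerWeight_nonneg r x
    have := mehlerWeight_nonneg r p.1
    calc _ ≤ (mehlerWeight r x * mehlerWeight r p.1) *
          ((mehlerWeight r' p.1 * mehlerWeight r' p.2) * |G p.2|) := by gcongr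
      _ = _ := by ring
  simp only [evenOp, ← integral_const_mul]
  rw [integral_integral_swap hi]
  refine integral_congr_ae (Filter.Eventually.of_forall fun y ↦ ?_)
  simp only [← mul_assoc]
  rw [integral_mul_const, integral_evenMehler_mul hr hr']

theorem evenOp_one (hr : |r| < 1) (x : Fin n → ℝ) : evenOp r (fun _ ↦ 1) x = 1 := by
  simp [evenOp, integral_evenMehler hr]

theorem integral_evenOp (hr : |r| < 1) (hFm : Measurable F) (hF : MemLp F 2 (gaussPi n)) :
    ∫ x, evenOp r F x ∂gaussPi n = ∫ x, F x ∂gaussPi n := by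
  have := integral_mul_evenOp_comm hr hFm (G := fun _ ↦ 1) measurable_const hF (memLp_const 1)
  simp only [evenOp_one hr, mul_one] at this
  exact this.symm

/-- The bilinear form of the even Mehler semigroup. -/
noncomputable def evenForm (r : ℝ) (F G : (Fin n → ℝ) → ℝ) : ℝ :=
  ∫ x, F x * evenOp r G x ∂gaussPi n

theorem evenForm_mul (hr : |r| < 1) (hr' : |r'| < 1) (hFm : Measurable F) (hGm : Measurable G)
    (hF : MemLp F 2 (gaussPi n)) (hG : MemLp G 2 (gaussPi n)) :
    evenForm (r * r') F G = ∫ x, evenOp r F x * evenOp r' G x ∂gaussPi n := by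
  rw [evenForm, ← integral_mul_evenOp_comm hr hFm (measurable_evenOp hGm) hF
    (memLp_evenOp hr' hGm hG)]
  simp_rw [evenOp_evenOp hr hr' hGm hG]

theorem evenForm_mul_sub_one (hr : |r| < 1) (hr' : |r'| < 1) (hFm : Measurable F)
    (hGm : Measurable G) (hF : MemLp F 2 (gaussPi n)) (hG : MemLp G 2 (gaussPi n))
    (hF1 : ∫ x, F x ∂gaussPi n = 1) (hG1 : ∫ x, G x ∂gaussPi n = 1) :
    evenForm (r * r') F G - 1
      = ∫ x, (evenOp r F x - 1) * (evenOp r' G x - 1) ∂gaussPi n := by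
  have hf := memLp_evenOp hr hFm hF
  have hg := memLp_evenOp hr' hGm hG
  have hfi := hf.integrable one_le_two
  have hgi := hg.integrable one_le_two
  have hfg : Integrable (fun x ↦ evenOp r F x * evenOp r' G x) (gaussPi n) := hf.integrable_mul hg
  rw [evenForm_mul hr hr' hFm hGm hF hG]
  have e : ∀ x, (evenOp r F x - 1) * (evenOp r' G x - 1)
    = (evenOp r F x * evenOp r' G x - evenOp r F x) - (evenOp r' G x - 1) := fun x ↦ by ring
  have i1 : Integrable (fun x ↦ evenOp r F x * evenOp r' G x - evenOp r F x) (gaussPi n) :=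
    hfg.sub hfi
  have i2 : Integrable (fun x ↦ evenOp r' G x - 1) (gaussPi n) := hgi.sub (integrable_const _)
  simp_rw [e]
  rw [integral_sub i1 i2, integral_sub hfg hfi, integral_sub hgi (integrable_const _),
    integral_evenOp hr hFm hF, integral_evenOp hr' hGm hG, hF1, hG1]
  simp

theorem evenForm_sq_sub_one (hr : |r| < 1) (hFm : Measurable F)
    (hF : MemLp F 2 (gaussPi n)) (hF1 : ∫ x, F x ∂gaussPi n = 1) :
    evenForm (r ^ 2) F F - 1 = ∫ x, (evenOp r F x - 1) ^ 2 ∂gaussPi n := by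
  rw [pow_two, evenForm_mul_sub_one hr hr hFm hFm hF hF hF1 hF1]
  simp only [pow_two]

theorem evenForm_sq_sub_one_nonneg (hr : |r| < 1) (hFm : Measurable F)
    (hF : MemLp F 2 (gaussPi n)) (hF1 : ∫ x, F x ∂gaussPi n = 1) :
    0 ≤ evenForm (r ^ 2) F F - 1 := by
  rw [evenForm_sq_sub_one hr hFm hF hF1]
  exact integral_nonneg fun x ↦ sq_nonneg _

theorem sq_evenForm_mul_sub_one_le (hr : |r| < 1) (hr' : |r'| < 1) (hFm : Measurable F)
    (hGm : Measurable G) (hF : MemLp F 2 (gaussPi n)) (hG : MemLp G 2 (gaussPi n))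
    (hF1 : ∫ x, F x ∂gaussPi n = 1) (hG1 : ∫ x, G x ∂gaussPi n = 1) :
    (evenForm (r * r') F G - 1) ^ 2
      ≤ (evenForm (r ^ 2) F F - 1) * (evenForm (r' ^ 2) G G - 1) := by
  have hf := (memLp_evenOp hr hFm hF).sub (memLp_const 1)
  have hg := (memLp_evenOp hr' hGm hG).sub (memLp_const 1)
  rw [evenForm_mul_sub_one hr hr' hFm hGm hF hG hF1 hG1, evenForm_sq_sub_one hr hFm hF hF1,
    evenForm_sq_sub_one hr' hGm hG hG1]
  exact sq_integral_mul_le (f := fun x ↦ evenOp r F x - 1) (g := fun x ↦ evenOp r' G x - 1)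
    hf.integrable_sq hg.integrable_sq (hf.integrable_mul hg)

theorem inv_one_sub_pow_add_le (n : ℕ) : ∃ C : ℝ, 0 ≤ C ∧ ∀ a : ℝ, 0 ≤ a → a ≤ 1 / 2 →
    ((1 - a)⁻¹ ^ n + (1 + a)⁻¹ ^ n) / 2 - 1 ≤ C * a ^ 2 := by
  have key : ∀ n : ℕ, ∃ C : ℝ, 0 ≤ C ∧ ∀ a : ℝ, 0 ≤ a → a ≤ 1 / 2 →
      (1 - a)⁻¹ ^ n + (1 + a)⁻¹ ^ n - 2 ≤ C * a ^ 2 ∧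
      (1 - a)⁻¹ ^ n - (1 + a)⁻¹ ^ n ≤ C * a := by
    intro n
    induction n with
    | zero => exact ⟨0, le_rfl, fun a _ _ ↦ by norm_num⟩
    | succ n ih =>
      obtain ⟨C, hC, h⟩ := ih
      refine ⟨4 * C + 8, by positivity, fun a h0 h1 ↦ ?_⟩
      obtain ⟨hs, hd⟩ := h a h0 h1
      have hp1 : 0 < 1 - a := by linarith
      have hp2 : 0 < 1 + a := by linarith
      have h12 : (1 - a)⁻¹ ^ (n + 1) = (1 + a) / (1 - a ^ 2) * (1 - a)⁻¹ ^ n := by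
        have : 1 - a ^ 2 = (1 - a) * (1 + a) := by ring
        rw [pow_succ, this]; field_simp
      have h13 : (1 + a)⁻¹ ^ (n + 1) = (1 - a) / (1 - a ^ 2) * (1 + a)⁻¹ ^ n := by
        have : 1 - a ^ 2 = (1 - a) * (1 + a) := by ring
        rw [pow_succ, this]; field_simp
      rw [h12, h13]
      have hD : 3 / 4 ≤ 1 - a ^ 2 := by nlinarith
      have hD0 : 0 < 1 - a ^ 2 := by linarith
      set p := (1 - a)⁻¹ ^ n
      set q := (1 + a)⁻¹ ^ n
      have ha2 : 0 ≤ C * a ^ 2 := by positivity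
      have ha1 : 0 ≤ C * a := by positivity
      constructor
      · have : (1 + a) / (1 - a ^ 2) * p + (1 - a) / (1 - a ^ 2) * q - 2
            = ((p + q - 2) + a * (p - q) + 2 * a ^ 2) / (1 - a ^ 2) := by field_simp; ring
        rw [this, div_le_iff₀ hD0]
        have : a * (p - q) ≤ a * (C * a) := by gcongr
        nlinarith [mul_nonneg ha2 (by linarith : 0 ≤ (1 - a ^ 2) - 3 / 4),
          mul_nonneg (sq_nonneg a) (by linarith : 0 ≤ (1 - a ^ 2) - 3 / 4)]
      · have : (1 + a) / (1 - a ^ 2) * p - (1 - a) / (1 - a ^ 2) * q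
            = ((p - q) + a * (p + q - 2) + 2 * a) / (1 - a ^ 2) := by field_simp; ring
        rw [this, div_le_iff₀ hD0]
        have h5 : a * (p + q - 2) ≤ a * (C * a ^ 2) := by gcongr
        have h6 : a * (C * a ^ 2) ≤ C * a := by
          have : a ^ 2 ≤ 1 := by nlinarith
          calc a * (C * a ^ 2) = C * a * a ^ 2 := by ring
            _ ≤ C * a * 1 := by gcongr
            _ = _ := mul_one _
        nlinarith [mul_nonneg ha1 (by linarith : 0 ≤ (1 - a ^ 2) - 3 / 4),
          mul_nonneg h0 (by linarith : 0 ≤ (1 - a ^ 2) - 3 / 4)]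
  obtain ⟨C, hC, h⟩ := key n
  exact ⟨C, hC, fun a h0 h1 ↦ by
    have := (h a h0 h1).1
    have : 0 ≤ C * a ^ 2 := by positivity
    linarith⟩

/-- The form vanishes to second order at `0`. -/
theorem exists_evenForm_sq_sub_one_le (hFm : Measurable F) {M : ℝ} (hM : ∀ x, |F x| ≤ M)
    (hF1 : ∫ x, F x ∂gaussPi n = 1) :
    ∃ C : ℝ, 0 ≤ C ∧ ∀ a : ℝ, 0 ≤ a → a ≤ 1 / 2 → evenForm (a ^ 2) F F - 1 ≤ C * a ^ 2 := by
  obtain ⟨C, hC, h⟩ := inv_one_sub_pow_add_le n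
  have hF : MemLp F 2 (gaussPi n) := MemLp.of_bound hFm.aestronglyMeasurable M
    (Filter.Eventually.of_forall hM)
  refine ⟨M ^ 2 * C, by positivity, fun a h0 h1 ↦ ?_⟩
  have ha : |a| < 1 := by rw [abs_of_nonneg h0]; linarith
  have ha2 : |a ^ 2| < 1 := abs_sq_lt_one ha
  have hF2 : ∫ x, F x ^ 2 ∂gaussPi n ≤ M ^ 2 := by
    calc ∫ x, F x ^ 2 ∂gaussPi n ≤ ∫ _, M ^ 2 ∂gaussPi n := by
          refine integral_mono hF.integrable_sq (integrable_const _) fun x ↦ ?_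
          exact sq_le_sq.2 ((hM x).trans (le_abs_self M))
      _ = M ^ 2 := by simp
  rw [evenForm_sq_sub_one ha hFm hF hF1]
  have hk2 : ∀ x : Fin n → ℝ, ∫ y, (evenMehler a x y - 1) ^ 2 ∂gaussPi n
      = evenMehler (a ^ 2) x x - 1 ∧
      Integrable (fun y ↦ (evenMehler a x y - 1) ^ 2) (gaussPi n) := by
    intro x
    have i0 := integrable_evenMehler ha x
    have i1 : Integrable (fun y ↦ evenMehler a x y * evenMehler a y x) (gaussPi n) := by
      simp_rw [evenMehler_comm a _ x]
      refine integrable_evenMehler_mul ha ?_ x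
      refine MemLp.of_le_mul (c := mehlerWeight a x) (memLp_mehlerWeight ha)
        ((measurable_evenMehler a).comp (measurable_prodMk_left (x := x))).aestronglyMeasurable
        (Filter.Eventually.of_forall fun y ↦ ?_)
      rw [Real.norm_eq_abs, Real.norm_of_nonneg (mehlerWeight_nonneg _ _)]
      exact abs_evenMehler_le ha x y
    have e : ∀ y, (evenMehler a x y - 1) ^ 2
        = (evenMehler a x y * evenMehler a y x - 2 * evenMehler a x y) + 1 := fun y ↦ by
      rw [evenMehler_comm a y x]; ring
    have i2 : Integrable (fun y ↦ evenMehler a x y * evenMehler a y x - 2 * evenMehler a x y)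
      (gaussPi n) := i1.sub (i0.const_mul 2)
    simp_rw [e]
    refine ⟨?_, i2.add (integrable_const _)⟩
    rw [integral_add i2 (integrable_const _), integral_sub i1 (i0.const_mul 2),
      integral_evenMehler_mul ha ha, integral_const_mul, integral_evenMehler ha, pow_two]
    simp; ring
  have hpt : ∀ x, (evenOp a F x - 1) ^ 2 ≤ (evenMehler (a ^ 2) x x - 1) * M ^ 2 := by
    intro x
    have i0 := integrable_evenMehler ha x
    have i1 := integrable_evenMehler_mul ha hF x
    have e : evenOp a F x - 1 = ∫ y, (evenMehler a x y - 1) * F y ∂gaussPi n := by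
      simp_rw [sub_mul, one_mul]
      rw [integral_sub i1 (hF.integrable one_le_two), hF1, evenOp]
    rw [e, ← (hk2 x).1]
    refine (sq_integral_mul_le (hk2 x).2 hF.integrable_sq ?_).trans ?_
    · simp_rw [sub_mul, one_mul]
      exact i1.sub (hF.integrable one_le_two)
    · gcongr
  have hf := (memLp_evenOp ha hFm hF).sub (memLp_const 1)
  have hd := integrable_evenMehler_diag (n := n) ha
  calc ∫ x, (evenOp a F x - 1) ^ 2 ∂gaussPi n
      ≤ ∫ x, (evenMehler (a ^ 2) x x - 1) * M ^ 2 ∂gaussPi n :=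
        integral_mono hf.integrable_sq ((hd.sub (integrable_const _)).mul_const _) hpt
    _ = (((1 - a)⁻¹ ^ n + (1 + a)⁻¹ ^ n) / 2 - 1) * M ^ 2 := by
        rw [integral_mul_const, integral_sub hd (integrable_const _),
          integral_evenMehler_diag ha]
        simp
    _ ≤ C * a ^ 2 * M ^ 2 := by gcongr; exact h a h0 h1
    _ = _ := by ring
end

section
variable {n : ℕ} {b M : ℝ} {F : (Fin n → ℝ) → ℝ}

/-- The Mehler operator with real parameter on `Fin n → ℝ`. -/
noncomputable def mehlerOpPi (b : ℝ) (F : (Fin n → ℝ) → ℝ) (x : Fin n → ℝ) : ℝ :=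
  ∫ y, (∏ i, mehlerReal b (x i) (y i)) * F y ∂gaussPi n

theorem continuous_prod_mehlerReal (b : ℝ) :
    Continuous fun p : (Fin n → ℝ) × (Fin n → ℝ) ↦ ∏ i, mehlerReal b (p.1 i) (p.2 i) := by
  refine continuous_finsetProd _ fun i _ ↦ ?_
  exact (continuous_mehlerReal b).comp
    (f := fun p : (Fin n → ℝ) × (Fin n → ℝ) ↦ (p.1 i, p.2 i)) (by fun_prop)

theorem prod_mehlerReal_nonneg (b : ℝ) (x y : Fin n → ℝ) : 0 ≤ ∏ i, mehlerReal b (x i) (y i) :=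
  Finset.prod_nonneg fun _ _ ↦ mehlerReal_nonneg _ _ _

theorem integrable_prod_mehlerReal (hb : |b| < 1) (x : Fin n → ℝ) :
    Integrable (fun y ↦ ∏ i, mehlerReal b (x i) (y i)) (gaussPi n) :=
  Integrable.fintype_prod (f := fun i y ↦ mehlerReal b (x i) y) fun i ↦
    integrable_mehlerReal hb (x i)

theorem integral_prod_mehlerReal (hb : |b| < 1) (x : Fin n → ℝ) :
    ∫ y, ∏ i, mehlerReal b (x i) (y i) ∂gaussPi n = 1 := by
  rw [integral_fintype_prod_eq_prod (f := fun i y ↦ mehlerReal b (x i) y)]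
  simp [integral_mehlerReal hb]

theorem measurable_prod_mehlerReal_right (b : ℝ) (x : Fin n → ℝ) :
    Measurable fun y : Fin n → ℝ ↦ ∏ i, mehlerReal b (x i) (y i) := by
  refine Finset.measurable_prod _ fun i _ ↦ ?_
  unfold mehlerReal
  fun_prop

theorem integrable_prod_mehlerReal_mul (hb : |b| < 1) (hF : Measurable F) (h0 : ∀ x, 0 ≤ F x)
    (hM : ∀ x, F x ≤ M) (x : Fin n → ℝ) :
    Integrable (fun y ↦ (∏ i, mehlerReal b (x i) (y i)) * F y) (gaussPi n) := by
  refine ((integrable_prod_mehlerReal hb x).mul_const M).mono'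
    ((measurable_prod_mehlerReal_right b x).mul hF).aestronglyMeasurable
    (Filter.Eventually.of_forall fun y ↦ ?_)
  rw [Real.norm_of_nonneg (mul_nonneg (prod_mehlerReal_nonneg _ _ _) (h0 y))]
  exact mul_le_mul_of_nonneg_left (hM y) (prod_mehlerReal_nonneg _ _ _)

theorem mehlerOpPi_nonneg (h0 : ∀ x, 0 ≤ F x) (x : Fin n → ℝ) : 0 ≤ mehlerOpPi b F x :=
  integral_nonneg fun y ↦ mul_nonneg (prod_mehlerReal_nonneg _ _ _) (h0 y)

theorem mehlerOpPi_le (hb : |b| < 1) (hF : Measurable F) (h0 : ∀ x, 0 ≤ F x)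
    (hM : ∀ x, F x ≤ M) (x : Fin n → ℝ) : mehlerOpPi b F x ≤ M := by
  calc mehlerOpPi b F x ≤ ∫ y, (∏ i, mehlerReal b (x i) (y i)) * M ∂gaussPi n :=
        integral_mono (integrable_prod_mehlerReal_mul hb hF h0 hM x)
          ((integrable_prod_mehlerReal hb x).mul_const M)
          fun y ↦ mul_le_mul_of_nonneg_left (hM y) (prod_mehlerReal_nonneg _ _ _)
    _ = M := by rw [integral_mul_const, integral_prod_mehlerReal hb, one_mul]

theorem measurable_mehlerOpPi (hF : Measurable F) : Measurable (mehlerOpPi b F) := by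
  have : StronglyMeasurable fun p : (Fin n → ℝ) × (Fin n → ℝ) ↦
      (∏ i, mehlerReal b (p.1 i) (p.2 i)) * F p.2 :=
    ((continuous_prod_mehlerReal b).measurable.mul (hF.comp measurable_snd)).stronglyMeasurable
  exact this.integral_prod_right'.measurable

/-- Hypercontractivity for bounded densities. -/
theorem integral_mehlerOpPi_sq_le (hb : |b| < 1) {m : ℕ} (hm : 1 ≤ m) (hmb : 144 * m * b ^ 2 ≤ 1)
    (hF : Measurable F) (h0 : ∀ x, 0 ≤ F x) (hM : ∀ x, F x ≤ M)
    (hF1 : ∫ x, F x ∂gaussPi n = 1) :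
    ∫ x, mehlerOpPi b F x ^ 2 ∂gaussPi n ≤ M ^ (1 / m : ℝ) := by
  have hM0 : 0 ≤ M := (h0 0).trans (hM 0)
  have hm0 : (1 : ℝ) ≤ m := by exact_mod_cast hm
  have hp := Real.HolderConjugate.conjExponent (p := (2 * m : ℝ)) (by linarith)
  set p := Real.conjExponent (2 * m : ℝ)
  have hp0 : 0 < p := hp.symm.pos
  have hp1 : 1 < p := hp.symm.lt
  have hkm : Measurable (Function.uncurry fun x y ↦ ENNReal.ofReal (mehlerReal b x y)) :=
    (continuous_mehlerReal b).measurable.ennreal_ofReal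
  have hK := (kernelBound_mehlerReal hb hm hmb hp).pi hp0 hkm n
  set u : (Fin n → ℝ) → ℝ≥0∞ := fun x ↦ ENNReal.ofReal (mehlerOpPi b F x) with hu
  set G : (Fin n → ℝ) → ℝ≥0∞ := fun x ↦ ENNReal.ofReal (F x) with hG
  have hum : Measurable u := (measurable_mehlerOpPi hF).ennreal_ofReal
  have hGm : Measurable G := hF.ennreal_ofReal
  have huM : ∀ x, u x ≤ M.toNNReal := fun x ↦
    ENNReal.ofReal_le_ofReal (mehlerOpPi_le hb hF h0 hM x)
  have hue : ∀ x, u x = ∫⁻ y, G y * ∏ i, ENNReal.ofReal (mehlerReal b (x i) (y i)) ∂gaussPi n := by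
    intro x
    simp only [hu, mehlerOpPi]
    rw [ofReal_integral_eq_lintegral_ofReal (integrable_prod_mehlerReal_mul hb hF h0 hM x)
      (Filter.Eventually.of_forall fun y ↦ mul_nonneg (prod_mehlerReal_nonneg _ _ _) (h0 y))]
    refine lintegral_congr fun y ↦ ?_
    rw [ENNReal.ofReal_mul (prod_mehlerReal_nonneg _ _ _),
      ENNReal.ofReal_prod_of_nonneg fun i _ ↦ mehlerReal_nonneg _ _ _, mul_comm]
  have h := hK u G hum hGm ⟨_, huM⟩
  set I := ∫⁻ x, u x ^ (2 : ℝ) ∂gaussPi n with hI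
  have hlhs : ∫⁻ x, ∫⁻ y, u x * G y * ∏ i, ENNReal.ofReal (mehlerReal b (x i) (y i)) ∂gaussPi n
      ∂gaussPi n = I := by
    refine lintegral_congr fun x ↦ ?_
    simp_rw [mul_assoc]
    rw [lintegral_const_mul' _ _ ENNReal.ofReal_ne_top, ← hue, ENNReal.rpow_two, pow_two]
  have hItop : I ≠ ∞ := by
    refine ne_top_of_le_ne_top (b := (M.toNNReal : ℝ≥0∞) ^ (2 : ℝ))
      (ENNReal.rpow_ne_top_of_nonneg (by norm_num) ENNReal.coe_ne_top) ?_
    calc I ≤ ∫⁻ _, (M.toNNReal : ℝ≥0∞) ^ (2 : ℝ) ∂gaussPi n :=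
          lintegral_mono fun x ↦ ENNReal.rpow_le_rpow (huM x) (by norm_num)
      _ = _ := by simp
  set J := ∫⁻ x, G x ^ p ∂gaussPi n with hJ
  have hJle : J ≤ ENNReal.ofReal M ^ (p - 1) := by
    calc J ≤ ∫⁻ x, ENNReal.ofReal M ^ (p - 1) * G x ∂gaussPi n := by
          refine lintegral_mono fun x ↦ ?_
          have : G x ^ p = G x ^ (p - 1) * G x := by
            conv_rhs => rw [← ENNReal.rpow_one (G x)]
            rw [← ENNReal.rpow_mul, ← ENNReal.rpow_add_of_nonneg _ _ (by linarith) zero_le_one]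
            simp
          rw [this]
          gcongr ?_ * _
          exact ENNReal.rpow_le_rpow (ENNReal.ofReal_le_ofReal (hM x)) (by linarith)
      _ = _ := by
          have hFi : Integrable F (gaussPi n) := integrable_of_measurable_of_bounded hF h0 hM
          rw [lintegral_const_mul _ hGm, hG, ← ofReal_integral_eq_lintegral_ofReal hFi
            (Filter.Eventually.of_forall h0), hF1]
          simp
  have hI2 : I ≤ I ^ (1 / 2 : ℝ) * J ^ (1 / p) := hlhs ▸ h
  have hI3 : I ≤ (J ^ (1 / p)) ^ 2 := by
    rcases eq_or_ne I 0 with h0 | h0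
    · rw [h0]; exact zero_le
    have hs : I = I ^ (1 / 2 : ℝ) * I ^ (1 / 2 : ℝ) := by
      rw [← ENNReal.rpow_add _ _ h0 hItop]; norm_num
    have hne : I ^ (1 / 2 : ℝ) ≠ 0 := by
      simp [ENNReal.rpow_eq_zero_iff, h0, hItop]
    have hnt : I ^ (1 / 2 : ℝ) ≠ ∞ := ENNReal.rpow_ne_top_of_nonneg (by norm_num) hItop
    have h4 : I ^ (1 / 2 : ℝ) ≤ J ^ (1 / p) := by
      rw [← ENNReal.mul_le_mul_iff_right hne hnt]
      exact hs ▸ hI2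
    calc I = (I ^ (1 / 2 : ℝ)) ^ 2 := by rw [pow_two]; exact hs
      _ ≤ _ := by gcongr
  have hI4 : I ≤ ENNReal.ofReal (M ^ (1 / m : ℝ)) := by
    calc I ≤ ((ENNReal.ofReal M ^ (p - 1)) ^ (1 / p)) ^ 2 := hI3.trans (by gcongr)
      _ = ENNReal.ofReal M ^ (1 / m : ℝ) := by
          rw [← ENNReal.rpow_mul, ← ENNReal.rpow_natCast, ← ENNReal.rpow_mul]
          congr 1
          have := hp.inv_add_inv_eq_one
          have h1 : p⁻¹ = 1 - (2 * m : ℝ)⁻¹ := by linarith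
          have h2 : (p - 1) * (1 / p) = 1 - p⁻¹ := by field_simp
          rw [h2, h1]; field_simp; push_cast; ring
      _ = _ := by rw [ENNReal.ofReal_rpow_of_nonneg hM0 (by positivity)]
  rw [integral_eq_lintegral_of_nonneg_ae (Filter.Eventually.of_forall fun x ↦ sq_nonneg _)
    ((measurable_mehlerOpPi hF).pow_const 2).aestronglyMeasurable]
  refine ENNReal.toReal_le_of_le_ofReal (by positivity) (le_trans (le_of_eq ?_) hI4)
  refine lintegral_congr fun x ↦ ?_
  rw [ENNReal.ofReal_pow (mehlerOpPi_nonneg h0 x), ENNReal.rpow_two]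

theorem evenOp_sq_eq (hb : |b| < 1) (hF : Measurable F) (h0 : ∀ x, 0 ≤ F x)
    (hM : ∀ x, F x ≤ M) (x : Fin n → ℝ) :
    evenOp (b ^ 2) F x = (mehlerOpPi b F x + mehlerOpPi (-b) F x) / 2 := by
  have hk : ∀ y, evenMehler (b ^ 2) x y
      = ((∏ i, mehlerReal b (x i) (y i)) + ∏ i, mehlerReal (-b) (x i) (y i)) / 2 := by
    intro y
    have h1 := ofReal_evenMehler (z := (b : ℂ)) (r := b ^ 2) (by push_cast; rfl) x y
    have h2 : ∀ c : ℝ, mehlerPi (c : ℂ) (c ^ 2) x y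
      = ((∏ i, mehlerReal c (x i) (y i) : ℝ) : ℂ) := by
      intro c
      rw [mehlerPi, Complex.ofReal_prod]
      exact Finset.prod_congr rfl fun i _ ↦ (ofReal_mehlerReal _ _ _).symm
    have h3 := h2 (-b)
    rw [neg_sq] at h3
    push_cast at h3
    rw [h2, h3] at h1
    exact_mod_cast h1
  have hb' : |-b| < 1 := by rwa [abs_neg]
  rw [evenOp, mehlerOpPi, mehlerOpPi,
    ← integral_add (integrable_prod_mehlerReal_mul hb hF h0 hM x)
      (integrable_prod_mehlerReal_mul hb' hF h0 hM x), ← integral_div]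
  refine integral_congr_ae (Filter.Eventually.of_forall fun y ↦ ?_)
  beta_reduce
  rw [hk]; ring

theorem one_le_of_integral_eq_one (hF : Measurable F) (h0 : ∀ x, 0 ≤ F x) (hM : ∀ x, F x ≤ M)
    (hF1 : ∫ x, F x ∂gaussPi n = 1) : 1 ≤ M := by
  calc (1 : ℝ) = ∫ x, F x ∂gaussPi n := hF1.symm
    _ ≤ ∫ _, M ∂gaussPi n :=
      integral_mono (integrable_of_measurable_of_bounded hF h0 hM) (integrable_const _) hM
    _ = M := by simp

theorem evenForm_sq_le_exp (hF : Measurable F) (h0 : ∀ x, 0 ≤ F x) (hM : ∀ x, F x ≤ M)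
    (hF1 : ∫ x, F x ∂gaussPi n = 1) {a : ℝ} (ha0 : 0 < a) (ha1 : a < 1) :
    evenForm (a ^ 2) F F ≤ Real.exp (288 * a * Real.log M) := by
  have hM1 := one_le_of_integral_eq_one hF h0 hM hF1
  have hMp : 0 < M := by linarith
  have hl : 0 ≤ Real.log M := Real.log_nonneg hM1
  have ha : |a| < 1 := by rwa [abs_of_pos ha0]
  have hF2 : MemLp F 2 (gaussPi n) := MemLp.of_bound hF.aestronglyMeasurable M
    (Filter.Eventually.of_forall fun x ↦ by rw [Real.norm_of_nonneg (h0 x)]; exact hM x)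
  obtain ⟨b, hb0, rfl⟩ : ∃ b : ℝ, 0 < b ∧ b ^ 2 = a :=
    ⟨√a, Real.sqrt_pos.2 ha0, Real.sq_sqrt ha0.le⟩
  have hb : |b| < 1 := by
    rw [abs_of_pos hb0]; nlinarith
  have hb' : |-b| < 1 := by rwa [abs_neg]
  have hbd : ∀ c : ℝ, |c| < 1 → ∀ x, mehlerOpPi c F x ∈ Set.Icc 0 M := fun c hc x ↦
    ⟨mehlerOpPi_nonneg h0 x, mehlerOpPi_le hc hF h0 hM x⟩
  have hev : ∀ x, evenOp (b ^ 2) F x ∈ Set.Icc 0 M := by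
    intro x
    rw [evenOp_sq_eq hb hF h0 hM]
    obtain ⟨h1, h2⟩ := hbd b hb x
    obtain ⟨h3, h4⟩ := hbd (-b) hb' x
    constructor <;> linarith
  have hEm := measurable_evenOp (r := b ^ 2) hF
  have hi2 : Integrable (fun x ↦ evenOp (b ^ 2) F x * evenOp (b ^ 2) F x) (gaussPi n) :=
    integrable_of_measurable_of_bounded (M := M * M) (hEm.mul hEm)
      (fun x ↦ mul_nonneg (hev x).1 (hev x).1)
      fun x ↦ mul_le_mul (hev x).2 (hev x).2 (hev x).1 hMp.le
  rw [pow_two (b ^ 2), evenForm_mul ha ha hF hF hF2 hF2]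
  rcases le_or_gt (144 * b ^ 2) 1 with hc | hc
  · set m := ⌊(144 * b ^ 2)⁻¹⌋₊ with hm
    have hinv : 1 ≤ (144 * b ^ 2)⁻¹ := (one_le_inv₀ (by positivity)).2 hc
    have hm1 : 1 ≤ m := (Nat.one_le_floor_iff _).2 hinv
    have hm1' : (1 : ℝ) ≤ m := by exact_mod_cast hm1
    have hmle : (m : ℝ) ≤ (144 * b ^ 2)⁻¹ := Nat.floor_le (by positivity)
    have hmlt : (144 * b ^ 2)⁻¹ < (m : ℝ) + 1 := Nat.lt_floor_add_one _
    have hmb : 144 * m * b ^ 2 ≤ 1 := by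
      calc 144 * m * b ^ 2 = (m : ℝ) * (144 * b ^ 2) := by ring
        _ ≤ (144 * b ^ 2)⁻¹ * (144 * b ^ 2) := by gcongr
        _ = 1 := inv_mul_cancel₀ (by positivity)
    have k1 := integral_mehlerOpPi_sq_le hb hm1 hmb hF h0 hM hF1
    have k2 := integral_mehlerOpPi_sq_le hb' hm1 (by rwa [neg_sq]) hF h0 hM hF1
    have is : ∀ c : ℝ, |c| < 1 → Integrable (fun x ↦ mehlerOpPi c F x ^ 2) (gaussPi n) :=
      fun c hc ↦ integrable_of_measurable_of_bounded (M := M ^ 2)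
        ((measurable_mehlerOpPi hF).pow_const 2) (fun x ↦ sq_nonneg _)
        fun x ↦ pow_le_pow_left₀ (hbd c hc x).1 (hbd c hc x).2 2
    calc ∫ x, evenOp (b ^ 2) F x * evenOp (b ^ 2) F x ∂gaussPi n
        ≤ ∫ x, (mehlerOpPi b F x ^ 2 + mehlerOpPi (-b) F x ^ 2) / 2 ∂gaussPi n := by
          refine integral_mono hi2 (((is b hb).add (is (-b) hb')).div_const 2) fun x ↦ ?_
          simp only [evenOp_sq_eq hb hF h0 hM]
          nlinarith [sq_nonneg (mehlerOpPi b F x - mehlerOpPi (-b) F x)]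
      _ ≤ M ^ (1 / m : ℝ) := by
          rw [integral_div, integral_add (is b hb) (is (-b) hb')]
          linarith
      _ = Real.exp (1 / m * Real.log M) := by rw [Real.rpow_def_of_pos hMp, mul_comm]
      _ ≤ _ := by
          gcongr
          rw [div_le_iff₀ (by linarith)]
          have : (144 * b ^ 2)⁻¹ * (144 * b ^ 2) = 1 := inv_mul_cancel₀ (by positivity)
          nlinarith [sq_nonneg b]
  · calc ∫ x, evenOp (b ^ 2) F x * evenOp (b ^ 2) F x ∂gaussPi n
        ≤ ∫ x, evenOp (b ^ 2) F x * M ∂gaussPi n := by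
          refine integral_mono hi2
            ((integrable_of_measurable_of_bounded hEm (fun x ↦ (hev x).1)
              fun x ↦ (hev x).2).mul_const M) fun x ↦ ?_
          exact mul_le_mul_of_nonneg_left (hev x).2 (hev x).1
      _ = Real.exp (Real.log M) := by
          rw [integral_mul_const, integral_evenOp ha hF hF2, hF1, one_mul, Real.exp_log hMp]
      _ ≤ _ := by
          gcongr
          nlinarith
end

/-- A log-convexity argument: a function which is `O(t)` at zero and satisfies
`β (a * b) ^ 2 ≤ β (a ^ 2) * β (b ^ 2)` has `β t / t` maximal at the right end point. -/
theorem le_div_mul_of_sq_le {β : ℝ → ℝ} {ρ C : ℝ} (hρ : 0 < ρ)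
    (hC : ∀ t, 0 < t → t ≤ ρ → β t ≤ C * t) (h0 : ∀ t, 0 < t → t ≤ ρ → 0 ≤ β t)
    (hβ : ∀ t, 0 < t → t ≤ ρ → β t ^ 2 ≤ β ρ * β (t ^ 2 / ρ)) {t : ℝ} (ht : 0 < t) (htρ : t ≤ ρ) :
    β t ≤ t / ρ * β ρ := by
  set A : Set ℝ := (fun t ↦ β t / t) '' Set.Ioc 0 ρ with hA
  have hbdd : BddAbove A := by
    refine ⟨C, ?_⟩
    rintro _ ⟨u, ⟨hu0, hu⟩, rfl⟩
    exact (div_le_iff₀ hu0).2 (hC u hu0 hu)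
  have hle : ∀ u, 0 < u → u ≤ ρ → β u / u ≤ sSup A := fun u h1 h2 ↦
    le_csSup hbdd ⟨u, ⟨h1, h2⟩, rfl⟩
  have hne : A.Nonempty := ⟨_, ρ, ⟨hρ, le_rfl⟩, rfl⟩
  have hψ0 : 0 ≤ β ρ / ρ := div_nonneg (h0 ρ hρ le_rfl) hρ.le
  have hS0 : 0 ≤ sSup A := hψ0.trans (hle ρ hρ le_rfl)
  have hsq : ∀ u, 0 < u → u ≤ ρ → β u / u ≤ √(β ρ / ρ * sSup A) := by
    intro u h1 h2
    refine Real.le_sqrt_of_sq_le ?_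
    have h3 : 0 < u ^ 2 / ρ := by positivity
    have h4 : u ^ 2 / ρ ≤ ρ := by rw [div_le_iff₀ hρ]; nlinarith
    calc (β u / u) ^ 2 = β u ^ 2 / u ^ 2 := by rw [div_pow]
      _ ≤ β ρ * β (u ^ 2 / ρ) / u ^ 2 := by gcongr; exact hβ u h1 h2
      _ = β ρ / ρ * (β (u ^ 2 / ρ) / (u ^ 2 / ρ)) := by field_simp
      _ ≤ _ := by gcongr; exact hle _ h3 h4
  have hS : sSup A ≤ √(β ρ / ρ * sSup A) := by
    refine csSup_le hne ?_
    rintro _ ⟨u, ⟨hu0, hu⟩, rfl⟩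
    exact hsq u hu0 hu
  have hS2 : sSup A ≤ β ρ / ρ := by
    have h5 : sSup A ^ 2 ≤ β ρ / ρ * sSup A := by
      calc sSup A ^ 2 ≤ √(β ρ / ρ * sSup A) ^ 2 := by gcongr
        _ = _ := Real.sq_sqrt (mul_nonneg hψ0 hS0)
    rcases hS0.eq_or_lt with h | h
    · rw [← h]; exact hψ0
    · rw [pow_two] at h5
      exact le_of_mul_le_mul_right h5 h
  have := (hle t ht htρ).trans hS2
  rw [div_le_iff₀ ht] at this
  calc β t ≤ _ := this
    _ = _ := by ring

section
variable {n : ℕ} {M M' : ℝ} {F G : (Fin n → ℝ) → ℝ}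

theorem log_two_le_log_two_mul (hM : 1 ≤ M) : Real.log 2 ≤ Real.log (2 * M) :=
  Real.log_le_log (by norm_num) (by linarith)

theorem evenForm_sq_sub_one_le (hF : Measurable F) (h0 : ∀ x, 0 ≤ F x) (hM : ∀ x, F x ≤ M)
    (hF1 : ∫ x, F x ∂gaussPi n = 1) {a : ℝ} (ha0 : 0 < a) (ha1 : a < 1) :
    evenForm (a ^ 2) F F - 1 ≤ 9 * Real.exp 96 * Real.log (2 * M) ^ 2 * a ^ 2 *
      Real.exp (288 * a * Real.log (2 * M)) := by
  have hM1 := one_le_of_integral_eq_one hF h0 hM hF1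
  have hL := log_two_le_log_two_mul hM1
  have hl2 := Real.log_two_gt_d9
  have hlogM : Real.log M ≤ Real.log (2 * M) := Real.log_le_log (by linarith) (by linarith)
  set L := Real.log (2 * M) with hLdef
  have hL0 : 0 < L := by linarith
  have hMabs : ∀ x, |F x| ≤ M := fun x ↦ by rw [abs_of_nonneg (h0 x)]; exact hM x
  have hF2 : MemLp F 2 (gaussPi n) := MemLp.of_bound hF.aestronglyMeasurable M
    (Filter.Eventually.of_forall hMabs)
  have hexp : ∀ u : ℝ, 0 < u → u < 1 → evenForm (u ^ 2) F F ≤ Real.exp (288 * u * L) :=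
    fun u h1 h2 ↦ (evenForm_sq_le_exp hF h0 hM hF1 h1 h2).trans (by gcongr)
  have he1 : 1 ≤ Real.exp (288 * a * L) := Real.one_le_exp (by positivity)
  rcases le_or_gt a (1 / (3 * L)) with hc | hc
  · set r := 1 / (3 * L) with hr
    have hr0 : 0 < r := by positivity
    have hr2 : r ≤ 1 / 2 := by
      rw [hr]; exact one_div_le_one_div_of_le (by norm_num) (by linarith)
    obtain ⟨C, hC, hCb⟩ := exists_evenForm_sq_sub_one_le hF hMabs hF1
    have habs : ∀ u : ℝ, 0 < u → u ≤ r → |u| < 1 := fun u h1 h2 ↦ by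
      rw [abs_of_pos h1]; linarith
    have key := le_div_mul_of_sq_le (β := fun t ↦ evenForm t F F - 1) (ρ := r ^ 2) (C := C)
      (by positivity) (fun t h1 h2 ↦ ?_) (fun t h1 h2 ↦ ?_) (fun t h1 h2 ↦ ?_)
      (t := a ^ 2) (by positivity) (by gcongr)
    · calc evenForm (a ^ 2) F F - 1 ≤ _ := key
        _ ≤ a ^ 2 / r ^ 2 * Real.exp 96 := by
            gcongr
            have := hexp r hr0 (by linarith)
            have e : 288 * r * L = 96 := by rw [hr]; field_simp; norm_num
            rw [e] at this
            linarith
        _ = 9 * Real.exp 96 * L ^ 2 * a ^ 2 * 1 := by rw [hr]; field_simp; norm_num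
        _ ≤ _ := by gcongr
    all_goals
      obtain ⟨u, hu, rfl⟩ : ∃ u : ℝ, 0 < u ∧ u ^ 2 = t :=
        ⟨√t, Real.sqrt_pos.2 h1, Real.sq_sqrt h1.le⟩
      have hur : u ≤ r := (pow_le_pow_iff_left₀ hu.le hr0.le two_ne_zero).1 h2
    · exact hCb u hu.le (hur.trans hr2)
    · exact evenForm_sq_sub_one_nonneg (habs u hu hur) hF hF2 hF1
    · have hv0 : 0 < u ^ 2 / r := by positivity
      have hv : u ^ 2 / r ≤ r := by rw [div_le_iff₀ hr0]; nlinarith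
      have := sq_evenForm_mul_sub_one_le (habs r hr0 le_rfl) (habs _ hv0 hv) hF hF hF2 hF2 hF1 hF1
      have e1 : r * (u ^ 2 / r) = u ^ 2 := by field_simp
      rw [e1, div_pow (u ^ 2)] at this
      exact this
  · have h9 : 1 ≤ 9 * L ^ 2 * a ^ 2 := by
      rw [div_lt_iff₀ (by positivity)] at hc
      nlinarith
    have h96 : 1 ≤ Real.exp 96 := Real.one_le_exp (by norm_num)
    calc evenForm (a ^ 2) F F - 1 ≤ Real.exp (288 * a * L) := by linarith [hexp a ha0 ha1]
      _ = 1 * 1 * Real.exp (288 * a * L) := by ring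
      _ ≤ Real.exp 96 * (9 * L ^ 2 * a ^ 2) * Real.exp (288 * a * L) := by gcongr
      _ = _ := by ring

theorem evenForm_comm {r : ℝ} (hr : |r| < 1) (hFm : Measurable F) (hGm : Measurable G)
    (hF : MemLp F 2 (gaussPi n)) (hG : MemLp G 2 (gaussPi n)) :
    evenForm r F G = evenForm r G F := by
  rw [evenForm, integral_mul_evenOp_comm hr hFm hGm hF hG, evenForm]
  simp only [mul_comm]

/-- The decorrelation estimate for the even Mehler form at negative parameters. -/
theorem abs_evenForm_neg_sq_sub_one_le (hF : Measurable F) (hF0 : ∀ x, 0 ≤ F x)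
    (hFM : ∀ x, F x ≤ M) (hF1 : ∫ x, F x ∂gaussPi n = 1) (hG : Measurable G)
    (hG0 : ∀ x, 0 ≤ G x) (hGM : ∀ x, G x ≤ M') (hG1 : ∫ x, G x ∂gaussPi n = 1)
    {τ : ℝ} (hτ0 : τ ≠ 0) (hτ : |τ| ≤ 1 / 2) :
    |evenForm (-τ ^ 2) F G - 1| ≤ 9 * Real.exp 144 * (Real.log (2 * M) * Real.log (2 * M')) *
      τ ^ 2 * Real.exp (432 * (Real.log (2 * M) * Real.log (2 * M')) * τ ^ 2) := by
  have hM1 := one_le_of_integral_eq_one hF hF0 hFM hF1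
  have hM1' := one_le_of_integral_eq_one hG hG0 hGM hG1
  have hF2 : MemLp F 2 (gaussPi n) := MemLp.of_bound hF.aestronglyMeasurable M
    (Filter.Eventually.of_forall fun x ↦ by rw [Real.norm_of_nonneg (hF0 x)]; exact hFM x)
  have hG2 : MemLp G 2 (gaussPi n) := MemLp.of_bound hG.aestronglyMeasurable M'
    (Filter.Eventually.of_forall fun x ↦ by rw [Real.norm_of_nonneg (hG0 x)]; exact hGM x)
  have hτ2 : 0 < τ ^ 2 := by positivity
  have hτ4 : τ ^ 2 ≤ 1 / 4 := by
    rw [← sq_abs]; nlinarith [abs_nonneg τ]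
  wlog hML : Real.log (2 * M') ≤ Real.log (2 * M) generalizing M M' F G
  · have := this hG hG0 hGM hG1 hF hF0 hFM hF1 hM1' hM1 hG2 hF2 (le_of_not_ge hML)
    rw [evenForm_comm (by rw [abs_neg, abs_of_pos hτ2]; linarith) hF hG hF2 hG2,
      mul_comm (Real.log (2 * M))]
    exact this
  have hL := log_two_le_log_two_mul hM1
  have hL' := log_two_le_log_two_mul hM1'
  have hl2 := Real.log_two_gt_d9
  have hbF := fun a h1 h2 ↦ evenForm_sq_sub_one_le (a := a) hF hF0 hFM hF1 h1 h2
  have hbG := fun a h1 h2 ↦ evenForm_sq_sub_one_le (a := a) hG hG0 hGM hG1 h1 h2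
  set L := Real.log (2 * M)
  set L' := Real.log (2 * M')
  have hL0 : 0 < L := by linarith
  have hL0' : 0 < L' := by linarith
  have key : ∀ a b : ℝ, 0 < a → a < 1 → 0 < b → b < 1 → a * b = τ ^ 2 →
      |evenForm (-τ ^ 2) F G - 1| ≤ 9 * Real.exp 96 * (L * L') * τ ^ 2 *
        Real.exp (144 * (a * L + b * L')) := by
    intro a b ha0 ha1 hb0 hb1 hab
    have h1 := sq_evenForm_mul_sub_one_le (r := -a) (r' := b)
      (by rwa [abs_neg, abs_of_pos ha0]) (by rwa [abs_of_pos hb0]) hF hG hF2 hG2 hF1 hG1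
    rw [neg_sq, neg_mul, hab] at h1
    refine abs_le_of_sq_le_sq (h1.trans ?_) (by positivity)
    have hG0 := evenForm_sq_sub_one_nonneg (by rwa [abs_of_pos hb0]) hG hG2 hG1
    calc _ ≤ (9 * Real.exp 96 * L ^ 2 * a ^ 2 * Real.exp (288 * a * L)) *
          (9 * Real.exp 96 * L' ^ 2 * b ^ 2 * Real.exp (288 * b * L')) :=
          mul_le_mul (hbF a ha0 ha1) (hbG b hb0 hb1) hG0 (by positivity)
      _ = _ := by
          have : Real.exp (144 * (a * L + b * L')) ^ 2
              = Real.exp (288 * a * L) * Real.exp (288 * b * L') := by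
            rw [← Real.exp_nat_mul, ← Real.exp_add]; push_cast; ring_nf
          rw [← hab, mul_pow (9 * Real.exp 96 * (L * L') * (a * b)), this]
          ring
  have fin : ∀ w, w ≤ 48 + 432 * (L * L') * τ ^ 2 → 9 * Real.exp 96 * (L * L') * τ ^ 2 * Real.exp w
      ≤ 9 * Real.exp 144 * (L * L') * τ ^ 2 * Real.exp (432 * (L * L') * τ ^ 2) := by
    intro w hw
    calc _ ≤ 9 * Real.exp 96 * (L * L') * τ ^ 2 * Real.exp (48 + 432 * (L * L') * τ ^ 2) := by
          gcongr
      _ = _ := by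
          rw [Real.exp_add, show (144 : ℝ) = 96 + 48 by norm_num, Real.exp_add]; ring
  rcases lt_or_ge (3 * τ ^ 2 * L') 1 with hc | hc
  · refine (key (3 * τ ^ 2 * L') (1 / (3 * L')) (by positivity) hc (by positivity)
      (by rw [div_lt_one (by positivity)]; linarith) (by field_simp)).trans (fin _ ?_)
    have : 144 * (3 * τ ^ 2 * L' * L + 1 / (3 * L') * L') = 48 + 432 * (L * L') * τ ^ 2 := by
      field_simp; ring
    exact this.le
  · refine (key (2 * τ ^ 2) (1 / 2) (by positivity) (by linarith) (by norm_num) (by norm_num)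
      (by ring)).trans (fin _ ?_)
    have h1 : L ≤ 3 * τ ^ 2 * L' * L := le_mul_of_one_le_left hL0.le hc
    have h2 : 2 * τ ^ 2 * L ≤ 1 / 2 * L := by gcongr; linarith
    nlinarith
end

section
variable {E : Type*} [NormedAddCommGroup E] [InnerProductSpace ℝ E]

/-- The direction of a vector. -/
noncomputable def unitDir (x : E) : E := ‖x‖⁻¹ • x

theorem unitDir_smul {c : ℝ} (hc : 0 < c) (x : E) : unitDir (c • x) = unitDir x := by
  rw [unitDir, unitDir, norm_smul, smul_smul, Real.norm_of_nonneg hc.le, mul_inv]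
  congr 1
  field_simp

theorem norm_unitDir {x : E} (hx : x ≠ 0) : ‖unitDir x‖ = 1 := norm_smul_inv_norm hx
end

section
variable {E : Type*} [NormedAddCommGroup E] [InnerProductSpace ℝ E] [FiniteDimensional ℝ E]
  [MeasurableSpace E] [BorelSpace E]

/-- The density of the standard Gaussian as a function of the norm. -/
noncomputable def gaussDensity (d : ℕ) (t : ℝ) : ℝ :=
  ((2 * Real.pi) ^ (d / 2 : ℝ))⁻¹ * Real.exp (-t ^ 2 / 2)

theorem gaussDensity_pos (d : ℕ) (t : ℝ) : 0 < gaussDensity d t := by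
  unfold gaussDensity; positivity

theorem continuous_gaussDensity (d : ℕ) : Continuous (gaussDensity d) := by
  unfold gaussDensity; fun_prop

theorem integrable_gaussDensity_norm :
    Integrable (fun x : E ↦ gaussDensity (Module.finrank ℝ E) ‖x‖) := by
  have := (GaussianFourier.integrable_cexp_neg_mul_sq_norm_add (V := E) (b := (1 / 2 : ℂ))
    (by norm_num) 0 0).re
  refine (this.const_mul ((2 * Real.pi) ^ (Module.finrank ℝ E / 2 : ℝ))⁻¹).congr
    (Filter.Eventually.of_forall fun x ↦ ?_)
  have e : -(1 / 2 : ℂ) * (‖x‖ : ℂ) ^ 2 + 0 * (inner ℝ (0 : E) x : ℝ)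
      = ((-‖x‖ ^ 2 / 2 : ℝ) : ℂ) := by push_cast; ring
  beta_reduce
  rw [e, ← Complex.ofReal_exp, gaussDensity]
  rfl

variable (E) in
theorem stdGaussian_eq_withDensity :
    stdGaussian E = (volume : Measure E).withDensity
      fun x ↦ ENNReal.ofReal (gaussDensity (Module.finrank ℝ E) ‖x‖) := by
  have hm : Measurable fun x : E ↦ ENNReal.ofReal (gaussDensity (Module.finrank ℝ E) ‖x‖) :=
    ((continuous_gaussDensity _).comp continuous_norm).measurable.ennreal_ofReal
  have : IsFiniteMeasure ((volume : Measure E).withDensity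
      fun x ↦ ENNReal.ofReal (gaussDensity (Module.finrank ℝ E) ‖x‖)) :=
    isFiniteMeasure_withDensity_ofReal integrable_gaussDensity_norm.2
  refine Measure.ext_of_charFun (funext fun t ↦ ?_)
  rw [charFun_stdGaussian, charFun_apply, integral_withDensity_eq_integral_toReal_smul hm
    (Filter.Eventually.of_forall fun x ↦ ENNReal.ofReal_lt_top)]
  have h := GaussianFourier.integral_cexp_neg_mul_sq_norm_add (V := E) (b := (1 / 2 : ℂ))
    (by norm_num) Complex.I t
  have hpt : ∀ x : E, (ENNReal.ofReal (gaussDensity (Module.finrank ℝ E) ‖x‖)).toReal •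
      Complex.exp ((inner ℝ x t : ℝ) * Complex.I)
      = (((2 * Real.pi) ^ (Module.finrank ℝ E / 2 : ℝ))⁻¹ : ℝ) *
        Complex.exp (-(1 / 2 : ℂ) * (‖x‖ : ℂ) ^ 2 + Complex.I * (inner ℝ t x : ℝ)) := by
    intro x
    rw [ENNReal.toReal_ofReal (gaussDensity_pos _ _).le, gaussDensity, Complex.real_smul,
      Complex.ofReal_mul, mul_assoc, Complex.ofReal_exp, ← Complex.exp_add, real_inner_comm]
    push_cast
    congr 2
    ring
  simp_rw [hpt]
  rw [integral_const_mul, h]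
  have h2 : ((Real.pi : ℂ) / (1 / 2)) ^ (Module.finrank ℝ E / 2 : ℂ)
      = (((2 * Real.pi) ^ (Module.finrank ℝ E / 2 : ℝ) : ℝ) : ℂ) := by
    rw [Complex.ofReal_cpow (by positivity)]
    push_cast
    congr 1
    ring
  rw [h2, ← mul_assoc, ← Complex.ofReal_mul, inv_mul_cancel₀ (by positivity), Complex.ofReal_one,
    one_mul]
  congr 1
  rw [Complex.I_sq]; ring

theorem integral_stdGaussian (u : E → ℝ) : ∫ x, u x ∂stdGaussian E
    = ∫ x, gaussDensity (Module.finrank ℝ E) ‖x‖ * u x := by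
  have hm : Measurable fun x : E ↦ ENNReal.ofReal (gaussDensity (Module.finrank ℝ E) ‖x‖) :=
    ((continuous_gaussDensity _).comp continuous_norm).measurable.ennreal_ofReal
  rw [stdGaussian_eq_withDensity, integral_withDensity_eq_integral_toReal_smul hm
    (Filter.Eventually.of_forall fun x ↦ ENNReal.ofReal_lt_top)]
  refine integral_congr_ae (Filter.Eventually.of_forall fun x ↦ ?_)
  simp only [ENNReal.toReal_ofReal (gaussDensity_pos _ _).le, smul_eq_mul]

theorem stdGaussian_absolutelyContinuous : stdGaussian E ≪ (volume : Measure E) := by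
  rw [stdGaussian_eq_withDensity]; exact withDensity_absolutelyContinuous _ _

/-- Change of variables by dilation under the standard Gaussian measure. -/
theorem integral_stdGaussian_smul (u : E → ℝ) {c : ℝ} (hc : 0 < c) :
    ∫ x, u x ∂stdGaussian E = c ^ Module.finrank ℝ E *
      ∫ x, u (c • x) * Real.exp ((1 - c ^ 2) * ‖x‖ ^ 2 / 2) ∂stdGaussian E := by
  rw [integral_stdGaussian, integral_stdGaussian]
  have h := Measure.integral_comp_smul (volume : Measure E)
    (fun x ↦ gaussDensity (Module.finrank ℝ E) ‖x‖ * u x) c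
  rw [abs_of_pos (by positivity), smul_eq_mul, eq_inv_mul_iff_mul_eq₀ (by positivity)] at h
  rw [← h]
  congr 1
  refine integral_congr_ae (Filter.Eventually.of_forall fun x ↦ ?_)
  simp only [gaussDensity, norm_smul, Real.norm_of_nonneg hc.le]
  have e : Real.exp (-(c * ‖x‖) ^ 2 / 2)
      = Real.exp (-‖x‖ ^ 2 / 2) * Real.exp ((1 - c ^ 2) * ‖x‖ ^ 2 / 2) := by
    rw [← Real.exp_add]; congr 1; ring
  rw [e]
  ring

theorem measurable_unitDir : Measurable (unitDir : E → E) :=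
  (measurable_norm.inv).smul measurable_id

/-- The direction of a standard Gaussian vector is uniformly distributed on the sphere. -/
theorem map_unitDir_stdGaussian [Nontrivial E] : (stdGaussian E).map unitDir
    = (((volume : Measure E).toSphere Set.univ)⁻¹ • (volume : Measure E).toSphere).map
      Subtype.val := by
  set σ := (volume : Measure E).toSphere
  set ρ : ℝ → ℝ≥0∞ := fun t ↦ ENNReal.ofReal (gaussDensity (Module.finrank ℝ E) t) with hρ
  have hρm : Measurable ρ := (continuous_gaussDensity _).measurable.ennreal_ofReal
  set κ := ∫⁻ r : Set.Ioi (0 : ℝ), ρ r ∂Measure.volumeIoiPow (Module.finrank ℝ E - 1)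
  have key : ∀ A : Set E, MeasurableSet A →
      (stdGaussian E).map unitDir A = σ (Subtype.val ⁻¹' A) * κ := by
    intro A hA
    have hA' : MeasurableSet (unitDir ⁻¹' A : Set E) := measurable_unitDir hA
    have hsm : MeasurableSet (Subtype.val ⁻¹' A : Set (sphere (0 : E) 1)) :=
      measurable_subtype_coe hA
    rw [Measure.map_apply measurable_unitDir hA, stdGaussian_eq_withDensity,
      withDensity_apply _ hA', ← lintegral_indicator hA',
      ← setLIntegral_univ, ← setLIntegral_congr (s := ({0}ᶜ : Set E))
        (by rw [ae_eq_univ, compl_compl]; exact measure_singleton _),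
      ← lintegral_subtype_comap (measurableSet_singleton (0 : E)).compl]
    have hmp := (volume : Measure E).measurePreserving_homeomorphUnitSphereProd
    set H : sphere (0 : E) 1 × Set.Ioi (0 : ℝ) → ℝ≥0∞ := fun p ↦
      (Subtype.val ⁻¹' A : Set (sphere (0 : E) 1)).indicator 1 p.1 * ρ p.2
    have hH : ∀ x : ({0}ᶜ : Set E), (unitDir ⁻¹' A).indicator
        (fun x : E ↦ ENNReal.ofReal (gaussDensity (Module.finrank ℝ E) ‖x‖)) x
        = H (homeomorphUnitSphereProd E x) := by
      intro x
      have h1 : ((homeomorphUnitSphereProd E x).1 : E) = unitDir (x : E) := by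
        simp [unitDir]
      have h2 : ((homeomorphUnitSphereProd E x).2 : ℝ) = ‖(x : E)‖ := by simp
      by_cases hx : unitDir (x : E) ∈ A
      · have hx' : (homeomorphUnitSphereProd E x).1 ∈
          (Subtype.val ⁻¹' A : Set (sphere (0 : E) 1)) := by rw [Set.mem_preimage, h1]; exact hx
        simp only [H]
        rw [Set.indicator_of_mem (by exact hx), Set.indicator_of_mem hx', h2]
        simp [hρ]
      · have hx' : (homeomorphUnitSphereProd E x).1 ∉
          (Subtype.val ⁻¹' A : Set (sphere (0 : E) 1)) := by rw [Set.mem_preimage, h1]; exact hx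
        simp only [H]
        rw [Set.indicator_of_notMem (by exact hx), Set.indicator_of_notMem hx', zero_mul]
    simp_rw [hH]
    rw [hmp.lintegral_comp_emb (Homeomorph.measurableEmbedding _) H]
    have hpm := lintegral_prod_mul (μ := σ)
      (ν := Measure.volumeIoiPow (Module.finrank ℝ E - 1))
      (f := (Subtype.val ⁻¹' A : Set (sphere (0 : E) 1)).indicator 1) (g := fun r ↦ ρ r)
      ((measurable_one.indicator hsm).aemeasurable) (hρm.comp measurable_subtype_coe).aemeasurable
    rw [lintegral_indicator_one hsm] at hpm
    exact hpm
  have hu := key Set.univ MeasurableSet.univ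
  have : IsProbabilityMeasure ((stdGaussian E).map unitDir) :=
    Measure.isProbabilityMeasure_map measurable_unitDir.aemeasurable
  rw [measure_univ, Set.preimage_univ] at hu
  have hκ : κ = (σ Set.univ)⁻¹ := by
    exact ENNReal.eq_inv_of_mul_eq_one_left (by rw [mul_comm]; exact hu.symm)
  ext A hA
  rw [key A hA, Measure.map_apply measurable_subtype_coe hA, Measure.smul_apply, hκ, smul_eq_mul,
    mul_comm]
end

section
variable {E : Type*} [NormedAddCommGroup E] [InnerProductSpace ℝ E]

/-- The component of `y` orthogonal to the unit vector `θ`. -/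
noncomputable def perpPart (θ y : E) : E := y - (inner ℝ y θ : ℝ) • θ

theorem continuous_perpPart : Continuous fun p : E × E ↦ perpPart p.1 p.2 := by
  unfold perpPart; fun_prop

theorem continuous_perpPart_right (θ : E) : Continuous (perpPart θ) := by
  unfold perpPart; fun_prop

theorem inner_perpPart_left (θ y t : E) :
    inner ℝ (perpPart θ y) t = (inner ℝ y (perpPart θ t) : ℝ) := by
  simp only [perpPart, inner_sub_left, inner_sub_right, real_inner_smul_left, real_inner_smul_right,
    real_inner_comm θ]
  ring

theorem norm_sq_perpPart {θ : E} (hθ : ‖θ‖ = 1) (t : E) :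
    ‖perpPart θ t‖ ^ 2 = ‖t‖ ^ 2 - (inner ℝ t θ : ℝ) ^ 2 := by
  rw [perpPart, norm_sub_sq_real, real_inner_smul_right, norm_smul, hθ, Real.norm_eq_abs, mul_one,
    sq_abs]
  ring
end

section
variable {E : Type*} [NormedAddCommGroup E] [InnerProductSpace ℝ E] [FiniteDimensional ℝ E]
  [MeasurableSpace E] [BorelSpace E]

theorem integral_cexp_inner_stdGaussian (t : E) :
    ∫ x, Complex.exp ((inner ℝ x t : ℝ) * Complex.I) ∂stdGaussian E
      = Complex.exp (-‖t‖ ^ 2 / 2) := by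
  rw [← charFun_stdGaussian, charFun_apply]

theorem map_perpPart_add_stdGaussian {θ : E} (hθ : ‖θ‖ = 1) :
    ((stdGaussian E).prod (gaussianReal 0 1)).map (fun p ↦ perpPart θ p.1 + p.2 • θ)
      = stdGaussian E := by
  have hc : Continuous fun p : E × ℝ ↦ perpPart θ p.1 + p.2 • θ := by
    unfold perpPart; fun_prop
  have : IsProbabilityMeasure (((stdGaussian E).prod (gaussianReal 0 1)).map
      (fun p ↦ perpPart θ p.1 + p.2 • θ)) :=
    Measure.isProbabilityMeasure_map hc.measurable.aemeasurable
  refine Measure.ext_of_charFun (funext fun t ↦ ?_)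
  rw [charFun_stdGaussian, charFun_apply, integral_map hc.measurable.aemeasurable
    (by fun_prop)]
  have e : ∀ p : E × ℝ, Complex.exp ((inner ℝ (perpPart θ p.1 + p.2 • θ) t : ℝ) * Complex.I)
      = Complex.exp ((inner ℝ p.1 (perpPart θ t) : ℝ) * Complex.I) *
        Complex.exp ((inner ℝ p.2 (inner ℝ θ t : ℝ) : ℝ) * Complex.I) := by
    intro p
    rw [← Complex.exp_add, inner_add_left, inner_perpPart_left, real_inner_smul_left]
    simp only [Real.inner_apply]
    push_cast
    congr 1
    ring
  simp_rw [e]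
  rw [integral_prod_mul (fun x ↦ Complex.exp ((inner ℝ x (perpPart θ t) : ℝ) * Complex.I))
    (fun r : ℝ ↦ Complex.exp ((inner ℝ r (inner ℝ θ t : ℝ) : ℝ) * Complex.I)),
    integral_cexp_inner_stdGaussian, ← charFun_apply, charFun_gaussianReal, ← Complex.exp_add]
  congr 1
  have := norm_sq_perpPart hθ t
  rw [← Complex.ofReal_pow, this, real_inner_comm]
  push_cast
  ring

theorem map_linearIsometry_stdGaussian {F : Type*} [NormedAddCommGroup F] [InnerProductSpace ℝ F]
    [FiniteDimensional ℝ F] [MeasurableSpace F] [BorelSpace F] {θ : E} (hθ : ‖θ‖ = 1)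
    (e : F →ₗᵢ[ℝ] E) (he : LinearMap.range e.toLinearMap = (Submodule.span ℝ {θ})ᗮ) :
    (stdGaussian F).map e = (stdGaussian E).map (perpPart θ) := by
  have hcm := (continuous_perpPart_right θ).measurable
  have := Measure.isProbabilityMeasure_map (μ := stdGaussian F) e.continuous.measurable.aemeasurable
  have := Measure.isProbabilityMeasure_map (μ := stdGaussian E) hcm.aemeasurable
  refine Measure.ext_of_charFun (funext fun t ↦ ?_)
  rw [charFun_apply, charFun_apply, integral_map e.continuous.measurable.aemeasurable (by fun_prop),
    integral_map hcm.aemeasurable (by fun_prop)]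
  simp_rw [inner_perpPart_left]
  have hmem : perpPart θ t ∈ LinearMap.range e.toLinearMap := by
    rw [he, Submodule.mem_orthogonal_singleton_iff_inner_left, perpPart, inner_sub_left,
      real_inner_smul_left, real_inner_self_eq_norm_sq, hθ]
    ring
  obtain ⟨u, hu⟩ := hmem
  have hu' : e u = perpPart θ t := hu
  have hin : ∀ w : F, (inner ℝ (e w) t : ℝ) = inner ℝ w u := by
    intro w
    have hw : e w ∈ (Submodule.span ℝ {θ})ᗮ := he ▸ ⟨w, rfl⟩
    rw [Submodule.mem_orthogonal_singleton_iff_inner_left] at hw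
    rw [← e.inner_map_map, hu', perpPart, inner_sub_right, real_inner_smul_right, hw]
    ring
  simp_rw [hin]
  rw [integral_cexp_inner_stdGaussian, integral_cexp_inner_stdGaussian, ← hu', e.norm_map]

/-- A standard Gaussian vector is almost surely not a multiple of a given vector. -/
theorem ae_perpPart_ne_zero (hE : 2 ≤ Module.finrank ℝ E) (θ : E) :
    ∀ᵐ y ∂stdGaussian E, perpPart θ y ≠ 0 := by
  refine stdGaussian_absolutelyContinuous.ae_le ?_
  have hne : Submodule.span ℝ {θ} ≠ ⊤ := by
    intro h
    have h1 := finrank_span_le_card (R := ℝ) ({θ} : Set E)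
    rw [h, finrank_top] at h1
    simp at h1
    omega
  have h0 := Measure.addHaar_submodule (volume : Measure E) _ hne
  refine measure_mono_null (fun y hy ↦ ?_) h0
  simp only [Set.mem_compl_iff, Set.mem_ofPred_eq, not_not, perpPart] at hy
  rw [SetLike.mem_coe, Submodule.mem_span_singleton]
  exact ⟨_, (sub_eq_zero.1 hy).symm⟩

theorem ae_ne_zero_stdGaussian [Nontrivial E] : ∀ᵐ y ∂stdGaussian E, y ≠ 0 := by
  refine stdGaussian_absolutelyContinuous.ae_le ?_
  exact Measure.ae_ne volume 0
end

/-- The expectation of `exp (-τ² ‖X‖² / 2)` for a standard Gaussian vector `X` in dimension `d`. -/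
noncomputable def gaussDecay (d : ℕ) (τ : ℝ) : ℝ := (√(1 + τ ^ 2))⁻¹ ^ d

theorem gaussDecay_pos (d : ℕ) (τ : ℝ) : 0 < gaussDecay d τ := by
  have : 0 < √(1 + τ ^ 2) := Real.sqrt_pos.2 (by positivity)
  unfold gaussDecay; positivity

theorem continuous_gaussDecay (d : ℕ) : Continuous (gaussDecay d) := by
  unfold gaussDecay
  refine Continuous.pow (Continuous.inv₀ (by fun_prop) fun τ ↦ ?_) d
  exact (Real.sqrt_pos.2 (by positivity)).ne'

section
variable {E : Type*} [NormedAddCommGroup E] [InnerProductSpace ℝ E] [FiniteDimensional ℝ E]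
  [MeasurableSpace E] [BorelSpace E]

/-- A function on a vector space that is invariant under positive dilations. -/
def IsRadial (F : E → ℝ) : Prop := ∀ c : ℝ, 0 < c → ∀ x, F (c • x) = F x

theorem isRadial_comp_unitDir (f : E → ℝ) : IsRadial fun x ↦ f (unitDir x) := fun c hc x ↦ by
  simp only [unitDir_smul hc]

theorem one_sub_inv_sqrt_sq (τ : ℝ) :
    1 - (√(1 + τ ^ 2))⁻¹ ^ 2 = τ ^ 2 * (√(1 + τ ^ 2))⁻¹ ^ 2 := by
  have h : (0 : ℝ) < 1 + τ ^ 2 := by positivity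
  rw [inv_pow, Real.sq_sqrt h.le]
  field_simp
  ring

theorem IsRadial.integral_mul_exp {H : E → ℝ} (hH : IsRadial H) (τ : ℝ) :
    ∫ x, H x * Real.exp (-τ ^ 2 * ‖x‖ ^ 2 / 2) ∂stdGaussian E
      = gaussDecay (Module.finrank ℝ E) τ * ∫ x, H x ∂stdGaussian E := by
  have hs : 0 < √(1 + τ ^ 2) := Real.sqrt_pos.2 (by positivity)
  have hc : 0 < (√(1 + τ ^ 2))⁻¹ := inv_pos.2 hs
  rw [integral_stdGaussian_smul _ hc, gaussDecay]
  congr 1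
  refine integral_congr_ae (Filter.Eventually.of_forall fun x ↦ ?_)
  beta_reduce
  rw [hH _ hc, mul_assoc, ← Real.exp_add, norm_smul, Real.norm_of_nonneg hc.le,
    one_sub_inv_sqrt_sq]
  have : -τ ^ 2 * ((√(1 + τ ^ 2))⁻¹ * ‖x‖) ^ 2 / 2
      + τ ^ 2 * (√(1 + τ ^ 2))⁻¹ ^ 2 * ‖x‖ ^ 2 / 2 = 0 := by ring
  rw [this, Real.exp_zero, mul_one]

theorem integral_exp_norm_sq (τ : ℝ) :
    ∫ x, Real.exp (-τ ^ 2 * ‖x‖ ^ 2 / 2) ∂stdGaussian E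
      = gaussDecay (Module.finrank ℝ E) τ := by
  simpa using IsRadial.integral_mul_exp (H := fun _ : E ↦ 1) (fun _ _ _ ↦ rfl) τ

theorem integral_cos_inner_stdGaussian (t : E) :
    ∫ x, Real.cos (inner ℝ x t) ∂stdGaussian E = Real.exp (-‖t‖ ^ 2 / 2) := by
  have h := congrArg Complex.re (integral_cexp_inner_stdGaussian t)
  have hi : Integrable (fun x ↦ Complex.exp ((inner ℝ x t : ℝ) * Complex.I)) (stdGaussian E) := by
    refine Integrable.of_bound (C := 1) (by fun_prop) (Filter.Eventually.of_forall fun x ↦ ?_)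
    rw [Complex.norm_exp_ofReal_mul_I]
  have h2 : (∫ x, Complex.exp ((inner ℝ x t : ℝ) * Complex.I) ∂stdGaussian E).re
      = ∫ x, (Complex.exp ((inner ℝ x t : ℝ) * Complex.I)).re ∂stdGaussian E :=
    (integral_re hi).symm
  rw [h2] at h
  simp_rw [Complex.exp_ofReal_mul_I_re] at h
  rw [h, ← Complex.ofReal_pow, ← Complex.ofReal_neg, ← Complex.ofReal_ofNat, ← Complex.ofReal_div,
    Complex.exp_ofReal_re]

/-- The cosine transform of `F` at frequency `τ y` under the standard Gaussian measure. -/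
noncomputable def cosTransform (F : E → ℝ) (τ : ℝ) (y : E) : ℝ :=
  ∫ x, F x * Real.cos (τ * inner ℝ x y) ∂stdGaussian E

theorem measurable_cosTransform {F : E → ℝ} (hF : Measurable F) :
    Measurable fun p : ℝ × E ↦ cosTransform F p.1 p.2 := by
  have : StronglyMeasurable fun p : (ℝ × E) × E ↦
      F p.2 * Real.cos (p.1.1 * inner ℝ p.2 p.1.2) :=
    ((hF.comp measurable_snd).mul (by fun_prop)).stronglyMeasurable
  exact this.integral_prod_right'.measurable

theorem measurable_cosTransform_right {F : E → ℝ} (hF : Measurable F) (τ : ℝ) :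
    Measurable (cosTransform F τ) := by
  have hm0 : Measurable fun y : E ↦ (τ, y) := measurable_prodMk_left
  have := (measurable_cosTransform hF).comp hm0
  exact this

theorem abs_cosTransform_le {F : E → ℝ} {M : ℝ} (hFM : ∀ x, |F x| ≤ M)
    (τ : ℝ) (y : E) : |cosTransform F τ y| ≤ M := by
  have := norm_integral_le_of_norm_le_const (μ := stdGaussian E) (C := M)
    (f := fun x ↦ F x * Real.cos (τ * inner ℝ x y)) (Filter.Eventually.of_forall fun x ↦ by
      rw [norm_mul, Real.norm_eq_abs, Real.norm_eq_abs]
      calc _ ≤ M * 1 := mul_le_mul (hFM x) (Real.abs_cos_le_one _) (abs_nonneg _)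
            ((abs_nonneg _).trans (hFM x))
        _ = M := mul_one M)
  rw [cosTransform]
  simpa using this

theorem integral_cosTransform_sq {F : E → ℝ} (hF : Measurable F) {M : ℝ} (hFM : ∀ x, |F x| ≤ M)
    (τ : ℝ) : ∫ y, cosTransform F τ y ^ 2 ∂stdGaussian E
      = ∫ p : E × E, F p.1 * F p.2 *
        (∫ y, Real.cos (τ * inner ℝ p.1 y) * Real.cos (τ * inner ℝ p.2 y) ∂stdGaussian E)
        ∂(stdGaussian E).prod (stdGaussian E) := by
  have e : ∀ y, cosTransform F τ y ^ 2 = ∫ p : E × E, F p.1 * F p.2 *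
      (Real.cos (τ * inner ℝ p.1 y) * Real.cos (τ * inner ℝ p.2 y))
      ∂(stdGaussian E).prod (stdGaussian E) := by
    intro y
    rw [sq, cosTransform, ← integral_prod_mul (fun x ↦ F x * Real.cos (τ * inner ℝ x y))
      (fun x ↦ F x * Real.cos (τ * inner ℝ x y))]
    refine integral_congr_ae (Filter.Eventually.of_forall fun p ↦ ?_)
    beta_reduce
    ring
  simp_rw [e]
  rw [integral_integral_swap]
  · simp_rw [integral_const_mul]
  · refine Integrable.of_bound (C := M * M * (1 * 1)) ?_ (Filter.Eventually.of_forall fun p ↦ ?_)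
    · refine Measurable.aestronglyMeasurable ?_
      refine Measurable.mul ((hF.comp (measurable_fst.comp measurable_snd)).mul
        (hF.comp (measurable_snd.comp measurable_snd))) ?_
      fun_prop
    · rw [Function.uncurry, norm_mul, norm_mul, norm_mul]
      have hM : 0 ≤ M := (abs_nonneg _).trans (hFM 0)
      gcongr
      · exact hFM _
      · exact hFM _
      · exact Real.abs_cos_le_one _
      · exact Real.abs_cos_le_one _

theorem integral_cos_mul_cos_nonneg (τ : ℝ) (x x' : E) :
    0 ≤ ∫ y, Real.cos (τ * inner ℝ x y) * Real.cos (τ * inner ℝ x' y) ∂stdGaussian E := by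
  have e : ∀ y : E, Real.cos (τ * inner ℝ x y) * Real.cos (τ * inner ℝ x' y)
      = (1 / 2) * (Real.cos (inner ℝ y (τ • (x - x'))) + Real.cos (inner ℝ y (τ • (x + x')))) := by
    intro y
    rw [real_inner_smul_right, real_inner_smul_right, inner_sub_right, inner_add_right,
      real_inner_comm y x, real_inner_comm y x', mul_sub τ, mul_add τ, Real.cos_sub, Real.cos_add]
    ring
  have hi : ∀ t : E, Integrable (fun y ↦ Real.cos (inner ℝ y t)) (stdGaussian E) := fun t ↦
    Integrable.of_bound (C := 1) (by fun_prop)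
      (Filter.Eventually.of_forall fun x ↦ Real.abs_cos_le_one _)
  simp_rw [e]
  rw [integral_const_mul, integral_add (hi _) (hi _), integral_cos_inner_stdGaussian,
    integral_cos_inner_stdGaussian]
  positivity

theorem integral_cosTransform_sq_le {F : E → ℝ} (hF : Measurable F) {M : ℝ}
    (hFM : ∀ x, |F x| ≤ M) (τ : ℝ) : ∫ y, cosTransform F τ y ^ 2 ∂stdGaussian E
      ≤ M ^ 2 * gaussDecay (Module.finrank ℝ E) (√2 * τ) := by
  have h1 : cosTransform (fun _ : E ↦ 1) τ = fun y ↦ Real.exp (-τ ^ 2 * ‖y‖ ^ 2 / 2) := by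
    funext y
    simp only [cosTransform, one_mul]
    have := integral_cos_inner_stdGaussian (τ • y)
    simp_rw [real_inner_smul_right] at this
    rw [this, norm_smul, mul_pow, Real.norm_eq_abs, sq_abs]
    congr 1; ring
  have h2 : gaussDecay (Module.finrank ℝ E) (√2 * τ)
      = ∫ y, cosTransform (fun _ : E ↦ 1) τ y ^ 2 ∂stdGaussian E := by
    rw [h1, ← integral_exp_norm_sq]
    refine integral_congr_ae (Filter.Eventually.of_forall fun p ↦ ?_)
    beta_reduce
    rw [← Real.exp_nat_mul, mul_pow, Real.sq_sqrt (by norm_num)]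
    congr 1; push_cast; ring
  have hM : 0 ≤ M := (abs_nonneg _).trans (hFM 0)
  rw [h2, integral_cosTransform_sq hF hFM, integral_cosTransform_sq measurable_const (M := 1)
    (by simp), ← integral_const_mul]
  have hk : Measurable fun p : E × E ↦
      ∫ y, Real.cos (τ * inner ℝ p.1 y) * Real.cos (τ * inner ℝ p.2 y) ∂stdGaussian E := by
    have : StronglyMeasurable fun p : (E × E) × E ↦
        Real.cos (τ * inner ℝ p.1.1 p.2) * Real.cos (τ * inner ℝ p.1.2 p.2) :=
      Continuous.stronglyMeasurable (by fun_prop)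
    exact this.integral_prod_right'.measurable
  have hk1 : ∀ p : E × E,
      |∫ y, Real.cos (τ * inner ℝ p.1 y) * Real.cos (τ * inner ℝ p.2 y) ∂stdGaussian E| ≤ 1 := by
    intro p
    have := norm_integral_le_of_norm_le_const (μ := stdGaussian E) (C := 1)
      (f := fun y ↦ Real.cos (τ * inner ℝ p.1 y) * Real.cos (τ * inner ℝ p.2 y))
      (Filter.Eventually.of_forall fun x ↦ by
        rw [norm_mul, Real.norm_eq_abs, Real.norm_eq_abs]
        exact mul_le_one₀ (Real.abs_cos_le_one _) (abs_nonneg _) (Real.abs_cos_le_one _))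
    simpa using this
  refine integral_mono ?_ ?_ fun p ↦ ?_
  · refine Integrable.of_bound (C := M * M * 1) (((hF.comp measurable_fst).mul
      (hF.comp measurable_snd)).mul hk).aestronglyMeasurable
      (Filter.Eventually.of_forall fun p ↦ ?_)
    rw [norm_mul, norm_mul]
    gcongr
    · exact hFM _
    · exact hFM _
    · exact hk1 p
  · refine Integrable.const_mul (Integrable.of_bound (C := 1) (by
      simp only [one_mul]; exact hk.aestronglyMeasurable)
      (Filter.Eventually.of_forall fun p ↦ ?_)) _
    simpa using hk1 p
  · beta_reduce
    rw [one_mul, one_mul]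
    refine mul_le_mul_of_nonneg_right ?_ (integral_cos_mul_cos_nonneg τ p.1 p.2)
    refine (le_abs_self _).trans ?_
    rw [abs_mul, sq]
    exact mul_le_mul (hFM _) (hFM _) (abs_nonneg _) hM

theorem integral_abs_cosTransform_le {F : E → ℝ} (hF : Measurable F) {M : ℝ}
    (hFM : ∀ x, |F x| ≤ M) (τ : ℝ) : ∫ y, |cosTransform F τ y| ∂stdGaussian E
      ≤ M * √(gaussDecay (Module.finrank ℝ E) (√2 * τ)) := by
  have hM : 0 ≤ M := (abs_nonneg _).trans (hFM 0)
  have hm := measurable_cosTransform_right hF τ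
  have hb := abs_cosTransform_le hFM τ
  have i2 : Integrable (fun y ↦ cosTransform F τ y ^ 2) (stdGaussian E) :=
    Integrable.of_bound (C := M ^ 2) (hm.pow_const 2).aestronglyMeasurable
      (Filter.Eventually.of_forall fun y ↦ by
        rw [norm_pow]; exact pow_le_pow_left₀ (norm_nonneg _) (hb y) 2)
  have i1 : Integrable (fun y ↦ |cosTransform F τ y|) (stdGaussian E) :=
    Integrable.of_bound (C := M) hm.abs.aestronglyMeasurable
      (Filter.Eventually.of_forall fun y ↦ by rw [Real.norm_eq_abs, abs_abs]; exact hb y)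
  have h := sq_integral_mul_le (μ := stdGaussian E) (f := fun y ↦ |cosTransform F τ y|)
    (g := fun _ ↦ 1) (by simpa using i2) (by simp) (by simpa using i1)
  simp only [mul_one, one_pow, sq_abs, integral_const, probReal_univ, smul_eq_mul] at h
  refine abs_le_of_sq_le_sq' ?_ ?_ |>.2
  · rw [mul_pow, Real.sq_sqrt (gaussDecay_pos _ _).le]
    exact h.trans (integral_cosTransform_sq_le hF hFM τ)
  · positivity
end

section
variable {E : Type*} [NormedAddCommGroup E] [InnerProductSpace ℝ E] [FiniteDimensional ℝ E]
  [MeasurableSpace E] [BorelSpace E]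

/-- The correlation of `F` and `G` through the kernel `cos (τ ⟨x, y⟩)`. -/
noncomputable def cosForm (F G : E → ℝ) (τ : ℝ) : ℝ :=
  ∫ y, G y * cosTransform F τ y ∂stdGaussian E

theorem measurable_cosForm {F G : E → ℝ} (hF : Measurable F) (hG : Measurable G) :
    Measurable (cosForm F G) := by
  have : StronglyMeasurable fun p : ℝ × E ↦ G p.2 * cosTransform F p.1 p.2 :=
    ((hG.comp measurable_snd).mul (measurable_cosTransform hF)).stronglyMeasurable
  exact this.integral_prod_right'.measurable

theorem abs_cosForm_le {F G : E → ℝ} (hF : Measurable F) {M M' : ℝ}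
    (hFM : ∀ x, |F x| ≤ M) (hGM : ∀ x, |G x| ≤ M') (τ : ℝ) :
    |cosForm F G τ| ≤ M' * (M * √(gaussDecay (Module.finrank ℝ E) (√2 * τ))) := by
  have hM' : 0 ≤ M' := (abs_nonneg _).trans (hGM 0)
  refine le_trans ?_ (mul_le_mul_of_nonneg_left (integral_abs_cosTransform_le hF hFM τ) hM')
  rw [← integral_const_mul, cosForm, ← Real.norm_eq_abs (∫ y, _ ∂_)]
  have i1 : Integrable (fun y ↦ |cosTransform F τ y|) (stdGaussian E) :=
    Integrable.of_bound (C := M) (measurable_cosTransform_right hF τ).abs.aestronglyMeasurable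
      (Filter.Eventually.of_forall fun y ↦ by
        rw [Real.norm_eq_abs, abs_abs]; exact abs_cosTransform_le hFM τ y)
  refine norm_integral_le_of_norm_le (i1.const_mul M') (Filter.Eventually.of_forall fun y ↦ ?_)
  rw [norm_mul]
  exact mul_le_mul_of_nonneg_right (hGM y) (norm_nonneg _)

theorem cosForm_eq_dilation {F G : E → ℝ} (hF : IsRadial F) (hG : IsRadial G) (τ : ℝ) :
    cosForm F G τ = gaussDecay (Module.finrank ℝ E) τ * ∫ y, G y *
      (∫ x, gaussDecay (Module.finrank ℝ E) τ * Real.cos (τ / (1 + τ ^ 2) * inner ℝ x y) *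
        Real.exp (τ ^ 2 / (1 + τ ^ 2) * (‖x‖ ^ 2 + ‖y‖ ^ 2) / 2) * F x ∂stdGaussian E)
      ∂stdGaussian E := by
  have hs : 0 < √(1 + τ ^ 2) := Real.sqrt_pos.2 (by positivity)
  have hc : 0 < (√(1 + τ ^ 2))⁻¹ := inv_pos.2 hs
  have hc2 : (√(1 + τ ^ 2))⁻¹ ^ 2 = (1 + τ ^ 2)⁻¹ := by
    rw [inv_pow, Real.sq_sqrt (by positivity)]
  rw [cosForm, integral_stdGaussian_smul _ hc, one_sub_inv_sqrt_sq, ← gaussDecay]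
  congr 1
  refine integral_congr_ae (Filter.Eventually.of_forall fun y ↦ ?_)
  beta_reduce
  rw [hG _ hc, cosTransform, integral_stdGaussian_smul _ hc, one_sub_inv_sqrt_sq, ← gaussDecay,
    mul_assoc, mul_assoc, mul_comm (∫ x, _ ∂_), ← integral_const_mul, ← integral_const_mul]
  congr 1
  refine integral_congr_ae (Filter.Eventually.of_forall fun x ↦ ?_)
  beta_reduce
  rw [hF _ hc, real_inner_smul_left, real_inner_smul_right, hc2]
  have e1 : τ * ((√(1 + τ ^ 2))⁻¹ * ((√(1 + τ ^ 2))⁻¹ * inner ℝ x y))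
      = τ / (1 + τ ^ 2) * inner ℝ x y := by
    rw [div_eq_mul_inv, ← hc2]; ring
  have e2 : Real.exp (τ ^ 2 / (1 + τ ^ 2) * (‖x‖ ^ 2 + ‖y‖ ^ 2) / 2)
      = Real.exp (τ ^ 2 * (1 + τ ^ 2)⁻¹ * ‖x‖ ^ 2 / 2) *
        Real.exp (τ ^ 2 * (1 + τ ^ 2)⁻¹ * ‖y‖ ^ 2 / 2) := by
    rw [← Real.exp_add]; congr 1; ring
  rw [e1, e2]
  ring
end

section
variable {n : ℕ}

theorem integral_gaussPi_toLp (u : EuclideanSpace ℝ (Fin n) → ℝ) :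
    ∫ x, u (WithLp.toLp 2 x) ∂gaussPi n = ∫ x, u x ∂stdGaussian (EuclideanSpace ℝ (Fin n)) := by
  rw [← map_pi_eq_stdGaussian]
  exact ((MeasurableEquiv.toLp 2 (Fin n → ℝ)).measurableEmbedding.integral_map u).symm

theorem evenMehler_neg_sq (τ : ℝ) (x y : Fin n → ℝ) :
    evenMehler (-τ ^ 2) y x = gaussDecay n τ *
      Real.cos (τ / (1 + τ ^ 2) * inner ℝ (WithLp.toLp 2 x : EuclideanSpace ℝ (Fin n))
        (WithLp.toLp 2 y)) *
      Real.exp (τ ^ 2 / (1 + τ ^ 2) * (‖(WithLp.toLp 2 x : EuclideanSpace ℝ (Fin n))‖ ^ 2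
        + ‖(WithLp.toLp 2 y : EuclideanSpace ℝ (Fin n))‖ ^ 2) / 2) := by
  have hpos : (0 : ℝ) < 1 + τ ^ 2 := by positivity
  have hpc : (1 + (τ : ℂ) ^ 2) ≠ 0 := by exact_mod_cast hpos.ne'
  have hz : (Complex.I * τ) ^ 2 = ((-τ ^ 2 : ℝ) : ℂ) := by
    rw [mul_pow, Complex.I_sq]; push_cast; ring
  set p : ℝ := inner ℝ (WithLp.toLp 2 x : EuclideanSpace ℝ (Fin n)) (WithLp.toLp 2 y) with hp
  set q : ℝ := ‖(WithLp.toLp 2 x : EuclideanSpace ℝ (Fin n))‖ ^ 2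
        + ‖(WithLp.toLp 2 y : EuclideanSpace ℝ (Fin n))‖ ^ 2 with hq
  have hp' : p = ∑ i, x i * y i := by
    rw [hp, PiLp.inner_apply]; simp [mul_comm]
  have hq' : q = ∑ i, (x i ^ 2 + y i ^ 2) := by
    rw [hq, EuclideanSpace.norm_sq_eq, EuclideanSpace.norm_sq_eq, ← Finset.sum_add_distrib]
    simp
  have key : ∀ z : ℂ, mehlerPi z (-τ ^ 2) y x = (gaussDecay n τ : ℂ) *
      Complex.exp ((z * p / (1 + τ ^ 2)) + (τ ^ 2 / (1 + τ ^ 2) * q / 2 : ℝ)) := by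
    intro z
    simp only [mehlerPi, mehler]
    rw [Finset.prod_mul_distrib, Finset.prod_const, ← Complex.exp_sum, Finset.card_univ,
      Fintype.card_fin, gaussDecay]
    rw [show 1 - -τ ^ 2 = 1 + τ ^ 2 by ring, Complex.ofReal_pow, hp', hq']
    congr 2
    push_cast
    rw [← Finset.sum_div, Finset.sum_sub_distrib, ← Finset.mul_sum]
    simp only [mul_assoc, ← Finset.mul_sum]
    have e : ∑ i, (y i : ℂ) * (x i : ℂ) = ∑ i, (x i : ℂ) * (y i : ℂ) :=
      Finset.sum_congr rfl fun i _ ↦ mul_comm _ _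
    have e' : ∑ i, ((y i : ℂ) ^ 2 + (x i : ℂ) ^ 2) = ∑ i, ((x i : ℂ) ^ 2 + (y i : ℂ) ^ 2) :=
      Finset.sum_congr rfl fun i _ ↦ add_comm _ _
    rw [e, e', sub_neg_eq_add]
    field_simp
    ring
  have hfin : (evenMehler (-τ ^ 2) y x : ℂ) = ((gaussDecay n τ *
      Real.cos (τ / (1 + τ ^ 2) * p) * Real.exp (τ ^ 2 / (1 + τ ^ 2) * q / 2) : ℝ) : ℂ) := by
    rw [ofReal_evenMehler hz, key, key, Complex.exp_add, Complex.exp_add, ← Complex.ofReal_exp]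
    push_cast [Complex.cos]
    rw [show Complex.I * τ * p / (1 + τ ^ 2) = τ / (1 + τ ^ 2) * p * Complex.I by ring,
      show -(Complex.I * τ) * p / (1 + τ ^ 2) = -(τ / (1 + τ ^ 2) * p) * Complex.I by ring]
    ring
  exact_mod_cast hfin

theorem cosForm_eq_evenForm {F G : EuclideanSpace ℝ (Fin n) → ℝ} (hF : IsRadial F)
    (hG : IsRadial G) (τ : ℝ) : cosForm F G τ = gaussDecay n τ *
      evenForm (-τ ^ 2) (fun x ↦ G (WithLp.toLp 2 x)) (fun x ↦ F (WithLp.toLp 2 x)) := by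
  rw [cosForm_eq_dilation hF hG, finrank_euclideanSpace_fin, ← integral_gaussPi_toLp, evenForm]
  congr 1
  refine integral_congr_ae (Filter.Eventually.of_forall fun y ↦ ?_)
  beta_reduce
  rw [← integral_gaussPi_toLp, evenOp]
  congr 1
  refine integral_congr_ae (Filter.Eventually.of_forall fun x ↦ ?_)
  beta_reduce
  rw [evenMehler_neg_sq]
end

theorem integral_cos_mul_exp_neg_sq {ε : ℝ} (hε : 0 < ε) (u : ℝ) :
    ∫ τ, Real.cos (τ * u) * Real.exp (-(ε ^ 2 / 2) * τ ^ 2)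
      = √(2 * Real.pi) / ε * Real.exp (-(u ^ 2 / (2 * ε ^ 2))) := by
  have hb : 0 < (((ε ^ 2 / 2 : ℝ) : ℂ)).re := by rw [Complex.ofReal_re]; positivity
  have h := congrArg Complex.re (fourierIntegral_gaussian hb u)
  have e : ∀ τ : ℝ, Complex.exp (Complex.I * u * τ) * Complex.exp (-((ε ^ 2 / 2 : ℝ) : ℂ) * τ ^ 2)
      = Complex.exp ((τ * u : ℝ) * Complex.I) * (Real.exp (-(ε ^ 2 / 2) * τ ^ 2) : ℝ) := by
    intro τ
    push_cast
    congr 2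
    ring
  simp_rw [e] at h
  have hi : Integrable fun τ : ℝ ↦
      Complex.exp ((τ * u : ℝ) * Complex.I) * (Real.exp (-(ε ^ 2 / 2) * τ ^ 2) : ℝ) := by
    refine (integrable_exp_neg_mul_sq (b := ε ^ 2 / 2) (by positivity)).mono' (by fun_prop)
      (Filter.Eventually.of_forall fun τ ↦ ?_)
    rw [norm_mul, Complex.norm_exp_ofReal_mul_I, one_mul, Complex.norm_real,
      Real.norm_of_nonneg (Real.exp_pos _).le]
  have h2 : (∫ τ : ℝ, Complex.exp ((τ * u : ℝ) * Complex.I) *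
      (Real.exp (-(ε ^ 2 / 2) * τ ^ 2) : ℝ)).re = ∫ τ : ℝ, (Complex.exp ((τ * u : ℝ) * Complex.I) *
      (Real.exp (-(ε ^ 2 / 2) * τ ^ 2) : ℝ)).re := (integral_re hi).symm
  rw [h2] at h
  simp_rw [Complex.re_mul_ofReal, Complex.exp_ofReal_mul_I_re] at h
  rw [h]
  have h3 : ((Real.pi : ℂ) / ((ε ^ 2 / 2 : ℝ) : ℂ)) ^ (1 / 2 : ℂ)
      = ((√(2 * Real.pi) / ε : ℝ) : ℂ) := by
    rw [← Complex.ofReal_div, show (1 / 2 : ℂ) = ((1 / 2 : ℝ) : ℂ) by push_cast; rfl,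
      ← Complex.ofReal_cpow (by positivity), ← Real.sqrt_eq_rpow]
    congr 1
    rw [show Real.pi / (ε ^ 2 / 2) = 2 * Real.pi / ε ^ 2 by field_simp,
      Real.sqrt_div (by positivity), Real.sqrt_sq hε.le]
  have h4 : Complex.exp (-(u : ℂ) ^ 2 / (4 * ((ε ^ 2 / 2 : ℝ) : ℂ)))
      = ((Real.exp (-(u ^ 2 / (2 * ε ^ 2))) : ℝ) : ℂ) := by
    push_cast
    congr 1
    ring
  rw [h3, h4, ← Complex.ofReal_mul, Complex.ofReal_re]

theorem gaussDecay_le_of_le {m n : ℕ} (h : m ≤ n) (τ : ℝ) : gaussDecay n τ ≤ gaussDecay m τ := by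
  have h1 : 1 ≤ √(1 + τ ^ 2) := Real.one_le_sqrt.2 (by nlinarith)
  exact pow_le_pow_of_le_one (by positivity) (inv_le_one_of_one_le₀ h1) h

theorem gaussDecay_two (τ : ℝ) : gaussDecay 2 τ = (1 + τ ^ 2)⁻¹ := by
  rw [gaussDecay, inv_pow, Real.sq_sqrt (by positivity)]

theorem sqrt_gaussDecay_four (τ : ℝ) : √(gaussDecay 4 τ) = (1 + τ ^ 2)⁻¹ := by
  rw [gaussDecay, show 4 = 2 * 2 from rfl, pow_mul, inv_pow, Real.sq_sqrt (by positivity),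
    Real.sqrt_sq (by positivity)]

theorem integrable_gaussDecay {d : ℕ} (hd : 2 ≤ d) : Integrable (gaussDecay d) := by
  refine integrable_inv_one_add_sq.mono' (continuous_gaussDecay d).aestronglyMeasurable
    (Filter.Eventually.of_forall fun τ ↦ ?_)
  rw [Real.norm_of_nonneg (gaussDecay_pos _ _).le, ← gaussDecay_two]
  exact gaussDecay_le_of_le hd τ

theorem sqrt_gaussDecay_le {d : ℕ} (hd : 4 ≤ d) (τ : ℝ) :
    √(gaussDecay d (√2 * τ)) ≤ (1 + τ ^ 2)⁻¹ := by
  refine (Real.sqrt_le_sqrt (gaussDecay_le_of_le hd _)).trans ?_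
  rw [sqrt_gaussDecay_four, mul_pow, Real.sq_sqrt (by norm_num)]
  gcongr
  nlinarith [sq_nonneg τ]

section
variable {E : Type*} [NormedAddCommGroup E] [InnerProductSpace ℝ E] [FiniteDimensional ℝ E]
  [MeasurableSpace E] [BorelSpace E]

theorem integrable_cosForm {F G : E → ℝ} (hE : 4 ≤ Module.finrank ℝ E) (hF : Measurable F)
    (hG : Measurable G) {M M' : ℝ} (hFM : ∀ x, |F x| ≤ M) (hGM : ∀ x, |G x| ≤ M') :
    Integrable (cosForm F G) := by
  refine (integrable_inv_one_add_sq.const_mul (M' * M)).mono'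
    (measurable_cosForm hF hG).aestronglyMeasurable (Filter.Eventually.of_forall fun τ ↦ ?_)
  have hM : 0 ≤ M := (abs_nonneg _).trans (hFM 0)
  have hM' : 0 ≤ M' := (abs_nonneg _).trans (hGM 0)
  refine (abs_cosForm_le hF hFM hGM τ).trans ?_
  rw [mul_assoc]
  gcongr
  exact sqrt_gaussDecay_le hE τ

theorem norm_mul_mul_le {a b c M M' K : ℝ} (ha : |a| ≤ M) (hb : |b| ≤ M') (hc : |c| ≤ K) :
    ‖a * b * c‖ ≤ M * M' * K := by
  rw [norm_mul, norm_mul]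
  exact mul_le_mul (mul_le_mul ha hb (abs_nonneg _) ((abs_nonneg _).trans ha)) hc (abs_nonneg _)
    (mul_nonneg ((abs_nonneg _).trans ha) ((abs_nonneg _).trans hb))

theorem cosForm_eq_integral_prod {F G : E → ℝ} (hF : Measurable F) (hG : Measurable G) {M M' : ℝ}
    (hFM : ∀ x, |F x| ≤ M) (hGM : ∀ x, |G x| ≤ M') (τ : ℝ) :
    cosForm F G τ = ∫ p : E × E, F p.1 * G p.2 * Real.cos (τ * inner ℝ p.1 p.2)
      ∂(stdGaussian E).prod (stdGaussian E) := by
  rw [integral_prod_symm]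
  · refine integral_congr_ae (Filter.Eventually.of_forall fun y ↦ ?_)
    beta_reduce
    rw [cosTransform, ← integral_const_mul]
    refine integral_congr_ae (Filter.Eventually.of_forall fun x ↦ ?_)
    beta_reduce
    ring
  · refine Integrable.of_bound (C := M * M' * 1) (((hF.comp measurable_fst).mul
      (hG.comp measurable_snd)).mul (by fun_prop)).aestronglyMeasurable
      (Filter.Eventually.of_forall fun p ↦ ?_)
    exact norm_mul_mul_le (hFM _) (hGM _) (Real.abs_cos_le_one _)

theorem integral_cosForm_mul_exp {F G : E → ℝ} (hF : Measurable F) (hG : Measurable G) {M M' : ℝ}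
    (hFM : ∀ x, |F x| ≤ M) (hGM : ∀ x, |G x| ≤ M') {ε : ℝ} (hε : 0 < ε) :
    ∫ τ, cosForm F G τ * Real.exp (-(ε ^ 2 / 2) * τ ^ 2) = ∫ x, F x * (∫ y, G y *
      (√(2 * Real.pi) / ε * Real.exp (-((inner ℝ x y) ^ 2 / (2 * ε ^ 2)))) ∂stdGaussian E)
      ∂stdGaussian E := by
  simp_rw [cosForm_eq_integral_prod hF hG hFM hGM, ← integral_mul_const]
  have hi : Integrable (Function.uncurry fun (τ : ℝ) (p : E × E) ↦
      F p.1 * G p.2 * Real.cos (τ * inner ℝ p.1 p.2) * Real.exp (-(ε ^ 2 / 2) * τ ^ 2))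
      ((volume : Measure ℝ).prod ((stdGaussian E).prod (stdGaussian E))) := by
    have h1 : Integrable (fun z : ℝ × (E × E) ↦ Real.exp (-(ε ^ 2 / 2) * z.1 ^ 2) * (1 : ℝ))
        ((volume : Measure ℝ).prod ((stdGaussian E).prod (stdGaussian E))) :=
      Integrable.mul_prod (integrable_exp_neg_mul_sq (b := ε ^ 2 / 2) (by positivity))
        (integrable_const (1 : ℝ))
    refine (h1.const_mul (M * M')).mono' ?_ (Filter.Eventually.of_forall fun z ↦ ?_)
    · refine Measurable.aestronglyMeasurable ?_
      refine Measurable.mul (Measurable.mul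
        ((hF.comp (measurable_fst.comp measurable_snd)).mul
        (hG.comp (measurable_snd.comp measurable_snd))) ?_) ?_
      · fun_prop
      · fun_prop
    · rw [Function.uncurry, norm_mul, mul_one, Real.norm_of_nonneg (Real.exp_pos _).le]
      refine mul_le_mul_of_nonneg_right ?_ (Real.exp_pos _).le
      exact (norm_mul_mul_le (hFM _) (hGM _) (Real.abs_cos_le_one _)).trans (mul_one _).le
  rw [integral_integral_swap hi]
  simp_rw [mul_assoc (F _ * G _), integral_const_mul, integral_cos_mul_exp_neg_sq hε]
  rw [integral_prod]
  · simp_rw [mul_assoc (F _), integral_const_mul]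
  · refine Integrable.of_bound (C := M * M' * (√(2 * Real.pi) / ε))
      (((hF.comp measurable_fst).mul (hG.comp measurable_snd)).mul
        (by fun_prop)).aestronglyMeasurable
      (Filter.Eventually.of_forall fun p ↦ norm_mul_mul_le (hFM _) (hGM _) ?_)
    rw [abs_of_nonneg (by positivity)]
    refine mul_le_of_le_one_right (by positivity) (Real.exp_le_one_iff.2 ?_)
    rw [neg_nonpos]; positivity

theorem integral_mul_exp_inner_sq {G : E → ℝ} (hG : Measurable G) {M' : ℝ}
    (hGM : ∀ x, |G x| ≤ M') {θ : E} (hθ : ‖θ‖ = 1) (ρ : ℝ) {ε : ℝ} (hε : 0 < ε) :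
    ∫ y, G y * (√(2 * Real.pi) / ε * Real.exp (-((ρ * inner ℝ θ y) ^ 2 / (2 * ε ^ 2))))
      ∂stdGaussian E = ∫ y, (∫ v : ℝ, G (perpPart θ y + (ε * v) • θ) *
        (Real.exp (-(ε * v) ^ 2 / 2) * Real.exp (-v ^ 2 * ρ ^ 2 / 2))) ∂stdGaussian E := by
  have hc : Continuous fun p : E × ℝ ↦ perpPart θ p.1 + p.2 • θ := by
    unfold perpPart; fun_prop
  have hm : Measurable fun y ↦
      G y * (√(2 * Real.pi) / ε * Real.exp (-((ρ * inner ℝ θ y) ^ 2 / (2 * ε ^ 2)))) :=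
    hG.mul (by fun_prop)
  have hb : ∀ y, ‖G y * (√(2 * Real.pi) / ε *
      Real.exp (-((ρ * inner ℝ θ y) ^ 2 / (2 * ε ^ 2))))‖ ≤ M' * (√(2 * Real.pi) / ε) := by
    intro y
    rw [norm_mul]
    refine mul_le_mul (hGM y) ?_ (norm_nonneg _) ((abs_nonneg _).trans (hGM 0))
    rw [Real.norm_of_nonneg (by positivity)]
    refine mul_le_of_le_one_right (by positivity) (Real.exp_le_one_iff.2 ?_)
    rw [neg_nonpos]; positivity
  have h0 := integral_map (μ := (stdGaussian E).prod (gaussianReal 0 1)) hc.measurable.aemeasurable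
    hm.aestronglyMeasurable
  rw [map_perpPart_add_stdGaussian hθ] at h0
  rw [h0, integral_prod]
  · refine integral_congr_ae (Filter.Eventually.of_forall fun y ↦ ?_)
    beta_reduce
    rw [integral_gaussianReal_eq_integral_smul one_ne_zero]
    have h := Measure.integral_comp_mul_left (fun t ↦ gaussianPDFReal 0 1 t •
      (G (perpPart θ y + t • θ) * (√(2 * Real.pi) / ε *
        Real.exp (-((ρ * inner ℝ θ (perpPart θ y + t • θ)) ^ 2 / (2 * ε ^ 2)))))) ε
    rw [abs_of_pos (inv_pos.2 hε), smul_eq_mul, eq_inv_mul_iff_mul_eq₀ hε.ne'] at h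
    rw [← h, ← integral_const_mul]
    refine integral_congr_ae (Filter.Eventually.of_forall fun v ↦ ?_)
    beta_reduce
    have hin : inner ℝ θ (perpPart θ y + (ε * v) • θ) = ε * v := by
      rw [inner_add_right, real_inner_smul_right, perpPart, inner_sub_right, real_inner_smul_right,
        real_inner_self_eq_norm_sq, hθ, real_inner_comm]
      ring
    rw [hin, gaussianPDFReal, smul_eq_mul]
    have hsq : 0 < √(2 * Real.pi) := by positivity
    have e1 : Real.exp (-(ε * v - 0) ^ 2 / (2 * (1 : ℝ≥0))) = Real.exp (-(ε * v) ^ 2 / 2) := by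
      congr 1; push_cast; ring
    have e2 : Real.exp (-((ρ * (ε * v)) ^ 2 / (2 * ε ^ 2))) = Real.exp (-v ^ 2 * ρ ^ 2 / 2) := by
      congr 1; field_simp
    rw [e1, e2]
    simp only [NNReal.coe_one, mul_one]
    field_simp
  · refine Integrable.of_bound (C := M' * (√(2 * Real.pi) / ε))
      (hm.comp hc.measurable).aestronglyMeasurable (Filter.Eventually.of_forall fun p ↦ hb _)
end

section
variable {E : Type*} [NormedAddCommGroup E] [InnerProductSpace ℝ E]

/-- The integrand obtained by disintegrating a Gaussian vector along the direction of another one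
and rescaling the component along that direction. -/
noncomputable def tubeIntegrand (F G : E → ℝ) (ε : ℝ) (z : (E × E) × ℝ) : ℝ :=
  F z.1.1 * G (perpPart (unitDir z.1.1) z.1.2 + (ε * z.2) • unitDir z.1.1) *
    (Real.exp (-(ε * z.2) ^ 2 / 2) * Real.exp (-z.2 ^ 2 * ‖z.1.1‖ ^ 2 / 2))

theorem norm_tubeIntegrand_le {F G : E → ℝ} {M M' : ℝ} (hFM : ∀ x, |F x| ≤ M)
    (hGM : ∀ x, |G x| ≤ M') (ε : ℝ) (z : (E × E) × ℝ) :
    ‖tubeIntegrand F G ε z‖ ≤ M * M' * Real.exp (-z.2 ^ 2 * ‖z.1.1‖ ^ 2 / 2) := by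
  refine norm_mul_mul_le (hFM _) (hGM _) ?_
  rw [abs_of_nonneg (by positivity)]
  refine mul_le_of_le_one_left (Real.exp_pos _).le (Real.exp_le_one_iff.2 ?_)
  have := sq_nonneg (ε * z.2)
  linarith
end

section
variable {E : Type*} [NormedAddCommGroup E] [InnerProductSpace ℝ E] [FiniteDimensional ℝ E]
  [MeasurableSpace E] [BorelSpace E]

variable (E) in
theorem integrable_exp_sq_mul_norm_sq (hE : 2 ≤ Module.finrank ℝ E) :
    Integrable (fun z : (E × E) × ℝ ↦ Real.exp (-z.2 ^ 2 * ‖z.1.1‖ ^ 2 / 2))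
      (((stdGaussian E).prod (stdGaussian E)).prod volume) := by
  have hprod : ∀ v : ℝ, ∫ p : E × E, Real.exp (-v ^ 2 * ‖p.1‖ ^ 2 / 2)
      ∂(stdGaussian E).prod (stdGaussian E) = gaussDecay (Module.finrank ℝ E) v := by
    intro v
    rw [← integral_exp_norm_sq]
    have := integral_prod_mul (μ := stdGaussian E) (ν := stdGaussian E)
      (fun x : E ↦ Real.exp (-v ^ 2 * ‖x‖ ^ 2 / 2)) (fun _ : E ↦ (1 : ℝ))
    simpa using this
  rw [integrable_prod_iff' (by fun_prop)]
  refine ⟨Filter.Eventually.of_forall fun v ↦ ?_, ?_⟩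
  · refine Integrable.of_bound (C := 1) (by fun_prop) (Filter.Eventually.of_forall fun p ↦ ?_)
    rw [Real.norm_of_nonneg (Real.exp_pos _).le]
    refine Real.exp_le_one_iff.2 ?_
    have := mul_nonneg (sq_nonneg v) (sq_nonneg ‖p.1‖)
    linarith
  · simp_rw [Real.norm_of_nonneg (Real.exp_pos _).le, hprod]
    exact integrable_gaussDecay hE

theorem measurable_perpPart_unitDir :
    Measurable fun p : E × E ↦ perpPart (unitDir p.1) p.2 :=
  continuous_perpPart.measurable.comp
    ((measurable_unitDir.comp measurable_fst).prodMk measurable_snd)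

theorem measurable_tubeIntegrand {F G : E → ℝ} (hF : Measurable F) (hG : Measurable G) (ε : ℝ) :
    Measurable (tubeIntegrand F G ε) := by
  have h1 : Measurable fun z : (E × E) × ℝ ↦ F z.1.1 :=
    hF.comp (measurable_fst.comp measurable_fst)
  have hu : Measurable fun z : (E × E) × ℝ ↦ unitDir z.1.1 :=
    measurable_unitDir.comp (measurable_fst.comp measurable_fst)
  have h2 : Measurable fun z : (E × E) × ℝ ↦
      perpPart (unitDir z.1.1) z.1.2 + (ε * z.2) • unitDir z.1.1 :=
    (measurable_perpPart_unitDir.comp measurable_fst).add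
      ((measurable_snd.const_mul ε).smul hu)
  exact (h1.mul (hG.comp h2)).mul (by fun_prop)

theorem integrable_tubeIntegrand (hE : 2 ≤ Module.finrank ℝ E) {F G : E → ℝ} (hF : Measurable F)
    (hG : Measurable G) {M M' : ℝ} (hFM : ∀ x, |F x| ≤ M) (hGM : ∀ x, |G x| ≤ M') (ε : ℝ) :
    Integrable (tubeIntegrand F G ε) (((stdGaussian E).prod (stdGaussian E)).prod volume) :=
  ((integrable_exp_sq_mul_norm_sq E hE).const_mul (M * M')).mono'
    (measurable_tubeIntegrand hF hG ε).aestronglyMeasurable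
    (Filter.Eventually.of_forall (norm_tubeIntegrand_le hFM hGM ε))

theorem integral_tubeIntegrand (hE : 2 ≤ Module.finrank ℝ E) {F G : E → ℝ} (hF : Measurable F)
    (hG : Measurable G) {M M' : ℝ} (hFM : ∀ x, |F x| ≤ M) (hGM : ∀ x, |G x| ≤ M') {ε : ℝ}
    (hε : 0 < ε) :
    ∫ z, tubeIntegrand F G ε z ∂((stdGaussian E).prod (stdGaussian E)).prod volume
      = ∫ τ, cosForm F G τ * Real.exp (-(ε ^ 2 / 2) * τ ^ 2) := by
  have : Nontrivial E := Module.nontrivial_of_finrank_pos (R := ℝ) (by omega)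
  have hi := integrable_tubeIntegrand hE hF hG hFM hGM ε
  rw [integral_prod _ hi, integral_prod _ hi.integral_prod_left,
    integral_cosForm_mul_exp hF hG hFM hGM hε]
  refine integral_congr_ae (ae_ne_zero_stdGaussian.mono fun x hx ↦ ?_)
  beta_reduce
  have hin : ∀ y, (inner ℝ x y : ℝ) = ‖x‖ * inner ℝ (unitDir x) y := by
    intro y
    rw [unitDir, real_inner_smul_left, ← mul_assoc, mul_inv_cancel₀ (norm_ne_zero_iff.2 hx),
      one_mul]
  simp_rw [hin]
  rw [integral_mul_exp_inner_sq hG hGM (norm_unitDir hx) ‖x‖ hε, ← integral_const_mul]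
  refine integral_congr_ae (Filter.Eventually.of_forall fun y ↦ ?_)
  beta_reduce
  rw [← integral_const_mul]
  refine integral_congr_ae (Filter.Eventually.of_forall fun v ↦ ?_)
  simp only [tubeIntegrand, mul_assoc]

theorem integral_tubeIntegrand_zero (hE : 2 ≤ Module.finrank ℝ E) {F G : E → ℝ}
    (hF : Measurable F) (hG : Measurable G) {M M' : ℝ} (hFM : ∀ x, |F x| ≤ M)
    (hGM : ∀ x, |G x| ≤ M') (hFr : IsRadial F) :
    ∫ z, tubeIntegrand F G 0 z ∂((stdGaussian E).prod (stdGaussian E)).prod volume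
      = (∫ v, gaussDecay (Module.finrank ℝ E) v) *
        ∫ p : E × E, F p.1 * G (perpPart (unitDir p.1) p.2)
          ∂(stdGaussian E).prod (stdGaussian E) := by
  rw [integral_prod_symm _ (integrable_tubeIntegrand hE hF hG hFM hGM 0), ← integral_mul_const]
  refine integral_congr_ae (Filter.Eventually.of_forall fun v ↦ ?_)
  beta_reduce
  have hm : Measurable fun p : E × E ↦ F p.1 * G (perpPart (unitDir p.1) p.2) :=
    (hF.comp measurable_fst).mul (hG.comp measurable_perpPart_unitDir)
  have hb : ∀ p : E × E, ‖F p.1 * G (perpPart (unitDir p.1) p.2)‖ ≤ M * M' := by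
    intro p
    rw [norm_mul]
    exact mul_le_mul (hFM _) (hGM _) (abs_nonneg _) ((abs_nonneg _).trans (hFM 0))
  have e : ∀ p : E × E, tubeIntegrand F G 0 (p, v)
      = F p.1 * G (perpPart (unitDir p.1) p.2) * Real.exp (-v ^ 2 * ‖p.1‖ ^ 2 / 2) := by
    intro p
    simp [tubeIntegrand]
  simp_rw [e]
  rw [integral_prod, integral_prod]
  · simp_rw [integral_mul_const, integral_const_mul]
    refine IsRadial.integral_mul_exp (H := fun x ↦ F x *
      ∫ y, G (perpPart (unitDir x) y) ∂stdGaussian E) (fun c hc x ↦ ?_) v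
    simp only [hFr c hc, unitDir_smul hc]
  · exact Integrable.of_bound (C := M * M') hm.aestronglyMeasurable
      (Filter.Eventually.of_forall hb)
  · refine Integrable.of_bound (C := M * M' * 1) (hm.mul (by fun_prop)).aestronglyMeasurable
      (Filter.Eventually.of_forall fun p ↦ ?_)
    refine norm_mul_mul_le (hFM _) (hGM _) ?_
    rw [abs_of_nonneg (Real.exp_pos _).le]
    refine Real.exp_le_one_iff.2 ?_
    have := mul_nonneg (sq_nonneg v) (sq_nonneg ‖p.1‖)
    linarith

theorem integral_cosForm_of_continuous (hE : 4 ≤ Module.finrank ℝ E) {F : E → ℝ}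
    (hF : Measurable F) {M M' : ℝ} (hFM : ∀ x, |F x| ≤ M) (hFr : IsRadial F) {g : E → ℝ}
    (hg : Continuous g) (hgM : ∀ x, |g x| ≤ M') :
    ∫ τ, cosForm F (fun y ↦ g (unitDir y)) τ = (∫ v, gaussDecay (Module.finrank ℝ E) v) *
      ∫ p : E × E, F p.1 * g (unitDir (perpPart (unitDir p.1) p.2))
        ∂(stdGaussian E).prod (stdGaussian E) := by
  set G : E → ℝ := fun y ↦ g (unitDir y) with hGdef
  have hG : Measurable G := hg.measurable.comp measurable_unitDir
  have hGM : ∀ x, |G x| ≤ M' := fun x ↦ hgM _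
  have hE2 : 2 ≤ Module.finrank ℝ E := by omega
  have hΨ := integrable_cosForm hE hF hG hFM hGM
  have t1 : Filter.Tendsto (fun ε : ℝ ↦ ∫ τ, cosForm F G τ * Real.exp (-(ε ^ 2 / 2) * τ ^ 2))
      (nhdsWithin 0 (Set.Ioi 0)) (nhds (∫ τ, cosForm F G τ)) := by
    refine tendsto_integral_filter_of_dominated_convergence (fun τ ↦ |cosForm F G τ|)
      (Filter.Eventually.of_forall fun ε ↦ hΨ.1.mul (by fun_prop))
      (Filter.Eventually.of_forall fun ε ↦ Filter.Eventually.of_forall fun τ ↦ ?_) hΨ.abs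
      (Filter.Eventually.of_forall fun τ ↦ ?_)
    · rw [norm_mul, Real.norm_of_nonneg (Real.exp_pos _).le]
      refine mul_le_of_le_one_right (norm_nonneg _) (Real.exp_le_one_iff.2 ?_)
      have := mul_nonneg (sq_nonneg ε) (sq_nonneg τ)
      linarith
    · have hc : Continuous fun ε : ℝ ↦ cosForm F G τ * Real.exp (-(ε ^ 2 / 2) * τ ^ 2) := by
        fun_prop
      have := hc.tendsto 0
      simp only [ne_eq, OfNat.ofNat_ne_zero, not_false_eq_true, zero_pow, zero_div, neg_zero,
        zero_mul, Real.exp_zero, mul_one] at this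
      exact this.mono_left nhdsWithin_le_nhds
  have t2 : Filter.Tendsto
      (fun ε : ℝ ↦ ∫ z, tubeIntegrand F G ε z ∂((stdGaussian E).prod (stdGaussian E)).prod volume)
      (nhdsWithin 0 (Set.Ioi 0))
      (nhds (∫ z, tubeIntegrand F G 0 z ∂((stdGaussian E).prod (stdGaussian E)).prod volume)) := by
    refine tendsto_integral_filter_of_dominated_convergence _
      (Filter.Eventually.of_forall fun ε ↦ (measurable_tubeIntegrand hF hG ε).aestronglyMeasurable)
      (Filter.Eventually.of_forall fun ε ↦ Filter.Eventually.of_forall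
        (norm_tubeIntegrand_le hFM hGM ε))
      ((integrable_exp_sq_mul_norm_sq E hE2).const_mul (M * M')) ?_
    have hms : MeasurableSet {p : E × E | perpPart (unitDir p.1) p.2 ≠ 0} :=
      (measurable_perpPart_unitDir (measurableSet_singleton 0)).compl
    have hae : ∀ᵐ z : (E × E) × ℝ ∂((stdGaussian E).prod (stdGaussian E)).prod volume,
        perpPart (unitDir z.1.1) z.1.2 ≠ 0 := by
      have h := (Measure.ae_prod_iff_ae_ae (μ := stdGaussian E) (ν := stdGaussian E) hms).2
        (Filter.Eventually.of_forall fun x ↦ ae_perpPart_ne_zero hE2 (unitDir x))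
      exact Measure.quasiMeasurePreserving_fst.ae h
    refine hae.mono fun z hz ↦ ?_
    have hcu : ContinuousAt G (perpPart (unitDir z.1.1) z.1.2) := by
      refine hg.continuousAt.comp ?_
      exact (continuousAt_id.norm.inv₀ (norm_ne_zero_iff.2 hz)).smul continuousAt_id
    have hl : Filter.Tendsto
        (fun ε : ℝ ↦ perpPart (unitDir z.1.1) z.1.2 + (ε * z.2) • unitDir z.1.1)
        (nhds 0) (nhds (perpPart (unitDir z.1.1) z.1.2)) := by
      have hc : Continuous fun ε : ℝ ↦
        perpPart (unitDir z.1.1) z.1.2 + (ε * z.2) • unitDir z.1.1 := by fun_prop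
      simpa using hc.tendsto 0
    have hl2 : Filter.Tendsto (fun ε : ℝ ↦ Real.exp (-(ε * z.2) ^ 2 / 2) *
        Real.exp (-z.2 ^ 2 * ‖z.1.1‖ ^ 2 / 2)) (nhds 0)
        (nhds (Real.exp (-(0 * z.2) ^ 2 / 2) * Real.exp (-z.2 ^ 2 * ‖z.1.1‖ ^ 2 / 2))) := by
      have hc : Continuous fun ε : ℝ ↦ Real.exp (-(ε * z.2) ^ 2 / 2) *
        Real.exp (-z.2 ^ 2 * ‖z.1.1‖ ^ 2 / 2) := by fun_prop
      exact hc.tendsto 0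
    have hfin := ((hcu.tendsto.comp hl).const_mul (F z.1.1)).mul hl2
    have h0 : tubeIntegrand F G 0 z = F z.1.1 * G (perpPart (unitDir z.1.1) z.1.2) *
        (Real.exp (-(0 * z.2) ^ 2 / 2) * Real.exp (-z.2 ^ 2 * ‖z.1.1‖ ^ 2 / 2)) := by
      simp [tubeIntegrand]
    rw [h0]
    exact hfin.mono_left nhdsWithin_le_nhds
  have t3 := t2.congr' (eventually_nhdsWithin_of_forall fun ε hε ↦
    integral_tubeIntegrand hE2 hF hG hFM hGM hε)
  rw [tendsto_nhds_unique t1 t3, integral_tubeIntegrand_zero hE2 hF hG hFM hGM hFr]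
end

section
variable {α β E : Type*} [MeasurableSpace α] [MeasurableSpace β] [MeasurableSpace E]

/-- The image under `T` of the measure with density the positive part of `w`. -/
noncomputable def pushDensity (μ : Measure α) (w : α → ℝ) (T : α → E) : Measure E :=
  (μ.withDensity fun x ↦ ENNReal.ofReal (w x)).map T

theorem isFiniteMeasure_pushDensity {μ : Measure α} {w : α → ℝ} (hw : Integrable w μ) (T : α → E) :
    IsFiniteMeasure (pushDensity μ w T) := by
  have := isFiniteMeasure_withDensity_ofReal hw.2
  unfold pushDensity
  infer_instance

theorem integral_pushDensity {μ : Measure α} {w : α → ℝ} (hw : Measurable w) {T : α → E}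
    (hT : Measurable T) {g : E → ℝ} (hg : Measurable g) :
    ∫ x, g x ∂pushDensity μ w T = ∫ x, max (w x) 0 * g (T x) ∂μ := by
  rw [pushDensity, integral_map hT.aemeasurable hg.aestronglyMeasurable,
    integral_withDensity_eq_integral_toReal_smul hw.ennreal_ofReal
      (Filter.Eventually.of_forall fun x ↦ ENNReal.ofReal_lt_top)]
  simp only [ENNReal.toReal_ofReal', smul_eq_mul]

theorem integrable_mul_comp_of_abs_le {μ : Measure α} {w : α → ℝ} (hw : Integrable w μ) {T : α → E}
    (hT : Measurable T) {g : E → ℝ} (hg : Measurable g) {K : ℝ} (hgK : ∀ x, |g x| ≤ K) :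
    Integrable (fun x ↦ w x * g (T x)) μ :=
  hw.mul_bdd (hg.comp hT).aestronglyMeasurable (Filter.Eventually.of_forall fun x ↦ hgK (T x))

theorem integral_mul_comp_eq_sub {μ : Measure α} {w : α → ℝ} (hwm : Measurable w)
    (hw : Integrable w μ) {T : α → E} (hT : Measurable T) {g : E → ℝ} (hg : Measurable g) {K : ℝ}
    (hgK : ∀ x, |g x| ≤ K) :
    ∫ x, w x * g (T x) ∂μ
      = ∫ x, g x ∂pushDensity μ w T - ∫ x, g x ∂pushDensity μ (fun x ↦ -w x) T := by
  rw [integral_pushDensity hwm hT hg, integral_pushDensity (w := fun x ↦ -w x) hwm.neg hT hg,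
    ← integral_sub
    (integrable_mul_comp_of_abs_le hw.pos_part hT hg hgK)
    (integrable_mul_comp_of_abs_le hw.neg_part hT hg hgK)]
  refine integral_congr_ae (Filter.Eventually.of_forall fun x ↦ ?_)
  beta_reduce
  rw [← sub_mul]
  congr 1
  rcases le_total 0 (w x) with h | h
  · rw [max_eq_left h, max_eq_right (by linarith)]; ring
  · rw [max_eq_right h, max_eq_left (by linarith)]; ring

theorem integrable_of_abs_le {ν : Measure E} [IsFiniteMeasure ν] {g : E → ℝ} (hg : Measurable g)
    {K : ℝ} (hgK : ∀ x, |g x| ≤ K) : Integrable g ν :=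
  Integrable.of_bound (C := K) hg.aestronglyMeasurable (Filter.Eventually.of_forall hgK)

/-- An identity between weighted integrals that holds for continuous bounded test functions holds
for measurable bounded ones. -/
theorem integral_mul_comp_eq_of_continuous [TopologicalSpace E] [HasOuterApproxClosed E]
    [BorelSpace E] {μ : Measure α} {ν : Measure β} {v : α → ℝ} {w : β → ℝ} (hvm : Measurable v)
    (hwm : Measurable w) (hv : Integrable v μ) (hw : Integrable w ν) {S : α → E} {T : β → E}
    (hS : Measurable S) (hT : Measurable T)
    (h : ∀ g : E → ℝ, Continuous g → (∃ K, ∀ x, |g x| ≤ K) →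
      ∫ x, v x * g (S x) ∂μ = ∫ y, w y * g (T y) ∂ν)
    {g : E → ℝ} (hg : Measurable g) {K : ℝ} (hgK : ∀ x, |g x| ≤ K) :
    ∫ x, v x * g (S x) ∂μ = ∫ y, w y * g (T y) ∂ν := by
  have f1 := isFiniteMeasure_pushDensity hv S
  have f2 := isFiniteMeasure_pushDensity hw T
  have f3 : IsFiniteMeasure (pushDensity μ (fun x ↦ -v x) S) := isFiniteMeasure_pushDensity hv.neg S
  have f4 : IsFiniteMeasure (pushDensity ν (fun x ↦ -w x) T) := isFiniteMeasure_pushDensity hw.neg T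
  have hadd : ∀ g : E → ℝ, Measurable g → (∃ K, ∀ x, |g x| ≤ K) →
      (∫ x, v x * g (S x) ∂μ - ∫ y, w y * g (T y) ∂ν
        = ∫ x, g x ∂(pushDensity μ v S + pushDensity ν (fun x ↦ -w x) T)
          - ∫ x, g x ∂(pushDensity ν w T + pushDensity μ (fun x ↦ -v x) S)) := by
    rintro g hg ⟨K, hgK⟩
    rw [integral_add_measure (integrable_of_abs_le hg hgK) (integrable_of_abs_le hg hgK),
      integral_add_measure (integrable_of_abs_le hg hgK) (integrable_of_abs_le hg hgK),
      integral_mul_comp_eq_sub hvm hv hS hg hgK, integral_mul_comp_eq_sub hwm hw hT hg hgK]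
    ring
  have heq : pushDensity μ v S + pushDensity ν (fun x ↦ -w x) T
      = pushDensity ν w T + pushDensity μ (fun x ↦ -v x) S := by
    refine ext_of_forall_integral_eq_of_IsFiniteMeasure fun φ ↦ ?_
    have hb : ∃ K, ∀ x, |φ x| ≤ K := ⟨‖φ‖, fun x ↦ φ.norm_coe_le_norm x⟩
    have h1 := hadd φ φ.continuous.measurable hb
    rw [h φ φ.continuous hb, sub_self] at h1
    exact (sub_eq_zero.1 h1.symm)
  have h2 := hadd g hg ⟨K, hgK⟩
  rw [heq, sub_self] at h2
  exact sub_eq_zero.1 h2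
end

section
variable {E : Type*} [NormedAddCommGroup E] [InnerProductSpace ℝ E] [FiniteDimensional ℝ E]
  [MeasurableSpace E] [BorelSpace E]

theorem integrable_cosTransform_prod (hE : 4 ≤ Module.finrank ℝ E) {F : E → ℝ}
    (hF : Measurable F) {M : ℝ} (hFM : ∀ x, |F x| ≤ M) :
    Integrable (fun p : ℝ × E ↦ cosTransform F p.1 p.2) (volume.prod (stdGaussian E)) := by
  have hm := measurable_cosTransform hF
  have hM : 0 ≤ M := (abs_nonneg _).trans (hFM 0)
  rw [integrable_prod_iff hm.aestronglyMeasurable]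
  refine ⟨Filter.Eventually.of_forall fun τ ↦
    integrable_of_abs_le (measurable_cosTransform_right hF τ) (abs_cosTransform_le hFM τ), ?_⟩
  refine (integrable_inv_one_add_sq.const_mul M).mono'
    hm.norm.stronglyMeasurable.integral_prod_right'.aestronglyMeasurable
    (Filter.Eventually.of_forall fun τ ↦ ?_)
  rw [Real.norm_of_nonneg (integral_nonneg fun y ↦ norm_nonneg _)]
  refine (integral_abs_cosTransform_le hF hFM τ).trans ?_
  gcongr
  exact sqrt_gaussDecay_le hE τ

theorem integral_cosForm_eq (hE : 4 ≤ Module.finrank ℝ E) {F G : E → ℝ}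
    (hF : Measurable F) {M M' : ℝ} (hFM : ∀ x, |F x| ≤ M) (hG : Measurable G)
    (hGM : ∀ x, |G x| ≤ M') :
    ∫ τ, cosForm F G τ = ∫ y, (∫ τ, cosTransform F τ y) * G y ∂stdGaussian E := by
  have hi : Integrable (Function.uncurry fun (τ : ℝ) (y : E) ↦ G y * cosTransform F τ y)
      (volume.prod (stdGaussian E)) :=
    (integrable_cosTransform_prod hE hF hFM).bdd_mul (hG.comp measurable_snd).aestronglyMeasurable
      (Filter.Eventually.of_forall fun p ↦ hGM p.2)
  simp only [cosForm]
  rw [integral_integral_swap hi]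
  simp_rw [integral_const_mul, mul_comm (G _)]

theorem integral_cosForm (hE : 4 ≤ Module.finrank ℝ E) {F : E → ℝ}
    (hF : Measurable F) {M M' : ℝ} (hFM : ∀ x, |F x| ≤ M) (hFr : IsRadial F) {g : E → ℝ}
    (hg : Measurable g) (hgM : ∀ x, |g x| ≤ M') :
    ∫ τ, cosForm F (fun y ↦ g (unitDir y)) τ = (∫ v, gaussDecay (Module.finrank ℝ E) v) *
      ∫ x, F x * (∫ y, g (unitDir (perpPart (unitDir x) y)) ∂stdGaussian E) ∂stdGaussian E := by
  set N := ∫ v, gaussDecay (Module.finrank ℝ E) v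
  have hT : Measurable fun p : E × E ↦ unitDir (perpPart (unitDir p.1) p.2) :=
    measurable_unitDir.comp measurable_perpPart_unitDir
  have hiF : Integrable (fun p : E × E ↦ N * F p.1) ((stdGaussian E).prod (stdGaussian E)) :=
    (integrable_of_abs_le (hF.comp measurable_fst) fun p ↦ hFM p.1).const_mul N
  have hW : Integrable (fun y ↦ ∫ τ, cosTransform F τ y) (stdGaussian E) :=
    (integrable_cosTransform_prod hE hF hFM).integral_prod_right
  have hWm : Measurable fun y : E ↦ ∫ τ, cosTransform F τ y :=
    (measurable_cosTransform hF).stronglyMeasurable.integral_prod_left'.measurable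
  have key := integral_mul_comp_eq_of_continuous (w := fun p : E × E ↦ N * F p.1) hWm
    ((hF.comp measurable_fst).const_mul N) hW hiF measurable_unitDir hT (fun g hg ⟨K, hgK⟩ ↦ by
      rw [← integral_cosForm_eq (G := fun y ↦ g (unitDir y)) hE hF hFM
        (hg.measurable.comp measurable_unitDir) (fun x ↦ hgK (unitDir x)),
    integral_cosForm_of_continuous hE hF hFM hFr hg hgK,
        ← integral_const_mul]
      refine integral_congr_ae (Filter.Eventually.of_forall fun p ↦ ?_)
      exact (mul_assoc _ _ _).symm) hg hgM
  rw [integral_cosForm_eq (G := fun y ↦ g (unitDir y)) hE hF hFM (hg.comp measurable_unitDir)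
    (fun x ↦ hgM (unitDir x)), key,
    integral_prod _ (integrable_mul_comp_of_abs_le hiF hT hg hgM), ← integral_const_mul]
  refine integral_congr_ae (Filter.Eventually.of_forall fun x ↦ ?_)
  dsimp only
  rw [integral_const_mul, mul_assoc]
end

section
variable {n : ℕ}

theorem integral_uSphere (hn : 0 < n) {h : EuclideanSpace ℝ (Fin n) → ℝ} (hh : Measurable h) :
    ∫ ω, h ω ∂uSphere n = ∫ x, h (unitDir x) ∂stdGaussian (EuclideanSpace ℝ (Fin n)) := by
  have : Nontrivial (EuclideanSpace ℝ (Fin n)) :=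
    Module.nontrivial_of_finrank_pos (R := ℝ) (by rw [finrank_euclideanSpace_fin]; exact hn)
  rw [← integral_map measurable_unitDir.aemeasurable hh.aestronglyMeasurable,
    map_unitDir_stdGaussian, ← uSphere,
    integral_map measurable_subtype_coe.aemeasurable hh.aestronglyMeasurable]

theorem exists_linearIsometry_range_eq_orthogonal (θ : sphere (0 : EuclideanSpace ℝ (Fin n)) 1) :
    ∃ e : EuclideanSpace ℝ (Fin (n - 1)) →ₗᵢ[ℝ] EuclideanSpace ℝ (Fin n),
      LinearMap.range e.toLinearMap
        = (Submodule.span ℝ {(θ : EuclideanSpace ℝ (Fin n))})ᗮ := by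
  set K := (Submodule.span ℝ {(θ : EuclideanSpace ℝ (Fin n))})ᗮ
  have hK : Module.finrank ℝ K = n - 1 := by
    have h1 := Submodule.finrank_add_finrank_orthogonal
      (Submodule.span ℝ {(θ : EuclideanSpace ℝ (Fin n))})
    rw [finrank_span_singleton (ne_zero_of_mem_unit_sphere θ), finrank_euclideanSpace_fin] at h1
    have h2 : 1 + Module.finrank ℝ K = n := h1
    omega
  refine ⟨K.subtypeₗᵢ.comp
    ((stdOrthonormalBasis ℝ K).reindex (finCongr hK)).repr.symm.toLinearIsometry, ?_⟩
  ext x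
  constructor
  · rintro ⟨w, rfl⟩
    exact (((stdOrthonormalBasis ℝ K).reindex (finCongr hK)).repr.symm w).2
  · intro hx
    refine ⟨((stdOrthonormalBasis ℝ K).reindex (finCongr hK)).repr ⟨x, hx⟩, ?_⟩
    simp

/-- Extension by zero of a function on the sphere. -/
noncomputable def sphereExtend (f : sphere (0 : EuclideanSpace ℝ (Fin n)) 1 → ℝ) :
    EuclideanSpace ℝ (Fin n) → ℝ := Function.extend Subtype.val f 0

theorem sphereExtend_coe (f : sphere (0 : EuclideanSpace ℝ (Fin n)) 1 → ℝ)
    (ω : sphere (0 : EuclideanSpace ℝ (Fin n)) 1) : sphereExtend f ω = f ω :=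
  Subtype.val_injective.extend_apply f 0 ω

theorem measurable_sphereExtend {f : sphere (0 : EuclideanSpace ℝ (Fin n)) 1 → ℝ}
    (hf : Measurable f) : Measurable (sphereExtend f) :=
  (MeasurableEmbedding.subtype_coe isClosed_sphere.measurableSet).measurable_extend hf
    measurable_zero

theorem sphereExtend_nonneg {f : sphere (0 : EuclideanSpace ℝ (Fin n)) 1 → ℝ}
    (hf : ∀ ω, 0 ≤ f ω) (x : EuclideanSpace ℝ (Fin n)) : 0 ≤ sphereExtend f x := by
  by_cases hx : ∃ ω : sphere (0 : EuclideanSpace ℝ (Fin n)) 1, (ω : EuclideanSpace ℝ (Fin n)) = x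
  · obtain ⟨ω, rfl⟩ := hx
    rw [sphereExtend_coe]; exact hf ω
  · rw [sphereExtend, Function.extend_apply' _ _ _ hx]; rfl

theorem sphereExtend_le {f : sphere (0 : EuclideanSpace ℝ (Fin n)) 1 → ℝ} {M : ℝ} (hM : 0 ≤ M)
    (hf : ∀ ω, f ω ≤ M) (x : EuclideanSpace ℝ (Fin n)) : sphereExtend f x ≤ M := by
  by_cases hx : ∃ ω : sphere (0 : EuclideanSpace ℝ (Fin n)) 1, (ω : EuclideanSpace ℝ (Fin n)) = x
  · obtain ⟨ω, rfl⟩ := hx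
    rw [sphereExtend_coe]; exact hf ω
  · rw [sphereExtend, Function.extend_apply' _ _ _ hx]; exact hM

theorem integral_sphereExtend_unitDir (hn : 0 < n)
    {f : sphere (0 : EuclideanSpace ℝ (Fin n)) 1 → ℝ} (hf : Measurable f) :
    ∫ x, sphereExtend f (unitDir x) ∂stdGaussian (EuclideanSpace ℝ (Fin n))
      = ∫ ω, f ω ∂uSphere n := by
  rw [← integral_uSphere hn (measurable_sphereExtend hf)]
  simp_rw [sphereExtend_coe]

theorem equatorAvg_eq (hn : 2 ≤ n) {g : sphere (0 : EuclideanSpace ℝ (Fin n)) 1 → ℝ}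
    (hg : Measurable g) (θ : sphere (0 : EuclideanSpace ℝ (Fin n)) 1)
    (e : EuclideanSpace ℝ (Fin (n - 1)) →ₗᵢ[ℝ] EuclideanSpace ℝ (Fin n))
    (he : LinearMap.range e.toLinearMap
      = (Submodule.span ℝ {(θ : EuclideanSpace ℝ (Fin n))})ᗮ) :
    equatorAvg g e = ∫ y, sphereExtend g (unitDir (perpPart (θ : EuclideanSpace ℝ (Fin n)) y))
      ∂stdGaussian (EuclideanSpace ℝ (Fin n)) := by
  have hθ : ‖(θ : EuclideanSpace ℝ (Fin n))‖ = 1 := mem_sphere_zero_iff_norm.mp θ.2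
  have hg' := measurable_sphereExtend hg
  have hu := hg'.comp (measurable_unitDir (E := EuclideanSpace ℝ (Fin n)))
  have h1 : ∀ ω, g (sphereMap e ω) = sphereExtend g (e ω) := fun ω ↦
    (sphereExtend_coe g (sphereMap e ω)).symm
  have h2 : ∀ w, e (unitDir w) = unitDir (e w) := fun w ↦ by
    rw [unitDir, unitDir, map_smul, e.norm_map]
  rw [equatorAvg]
  simp_rw [h1]
  rw [integral_uSphere (h := fun x ↦ sphereExtend g (e x)) (by omega)
    (hg'.comp e.continuous.measurable)]
  simp_rw [h2]
  have h3 := integral_map (μ := stdGaussian (EuclideanSpace ℝ (Fin (n - 1))))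
    e.continuous.measurable.aemeasurable hu.aestronglyMeasurable
  have h4 := integral_map (μ := stdGaussian (EuclideanSpace ℝ (Fin n)))
    (continuous_perpPart_right (θ : EuclideanSpace ℝ (Fin n))).measurable.aemeasurable
    hu.aestronglyMeasurable
  rw [map_linearIsometry_stdGaussian hθ e he, h4] at h3
  exact h3.symm

/-- The pairing of `f` with the spherical Radon transform of `g` as an integral of cosine
correlations. -/
theorem integral_cosForm_sphereExtend (hn : 4 ≤ n)
    {f g : sphere (0 : EuclideanSpace ℝ (Fin n)) 1 → ℝ} (hf : Measurable f) (hg : Measurable g)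
    {M M' : ℝ} (hfM : ∀ x, |sphereExtend f x| ≤ M) (hgM : ∀ x, |sphereExtend g x| ≤ M')
    {Rg : sphere (0 : EuclideanSpace ℝ (Fin n)) 1 → ℝ}
    (hR : ∀ (θ : sphere (0 : EuclideanSpace ℝ (Fin n)) 1)
        (e : EuclideanSpace ℝ (Fin (n - 1)) →ₗᵢ[ℝ] EuclideanSpace ℝ (Fin n)),
      LinearMap.range e.toLinearMap
          = (Submodule.span ℝ {(θ : EuclideanSpace ℝ (Fin n))})ᗮ →
      Rg θ = equatorAvg g e) :
    ∫ τ, cosForm (fun x ↦ sphereExtend f (unitDir x)) (fun x ↦ sphereExtend g (unitDir x)) τ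
      = (∫ τ, gaussDecay n τ) * ∫ ω, f ω * Rg ω ∂uSphere n := by
  have hf' := measurable_sphereExtend hf
  have hg' := measurable_sphereExtend hg
  rw [integral_cosForm (F := fun x ↦ sphereExtend f (unitDir x))
    (by rw [finrank_euclideanSpace_fin]; exact hn)
    (hf'.comp measurable_unitDir) (fun x ↦ hfM (unitDir x))
    (isRadial_comp_unitDir (sphereExtend f)) hg' hgM, finrank_euclideanSpace_fin]
  congr 1
  have hk : Measurable fun θ : EuclideanSpace ℝ (Fin n) ↦
      ∫ y, sphereExtend g (unitDir (perpPart θ y)) ∂stdGaussian (EuclideanSpace ℝ (Fin n)) := by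
    have : StronglyMeasurable fun p : EuclideanSpace ℝ (Fin n) × EuclideanSpace ℝ (Fin n) ↦
        sphereExtend g (unitDir (perpPart p.1 p.2)) :=
      (hg'.comp (measurable_unitDir.comp continuous_perpPart.measurable)).stronglyMeasurable
    exact this.integral_prod_right'.measurable
  rw [← integral_uSphere (h := fun x ↦ sphereExtend f x *
    ∫ y, sphereExtend g (unitDir (perpPart x y)) ∂stdGaussian (EuclideanSpace ℝ (Fin n)))
    (by omega) (hf'.mul hk)]
  refine integral_congr_ae (Filter.Eventually.of_forall fun ω ↦ ?_)
  obtain ⟨e, he⟩ := exists_linearIsometry_range_eq_orthogonal ω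
  beta_reduce
  rw [sphereExtend_coe, hR ω e he, equatorAvg_eq (by omega) hg ω e he]
end

theorem exp_half_le_one_add {x : ℝ} (h0 : 0 ≤ x) (h1 : x ≤ 1) : Real.exp (x / 2) ≤ 1 + x := by
  have h := Real.one_sub_le_exp_neg (x / 2)
  have h2 : Real.exp (x / 2) * Real.exp (-(x / 2)) = 1 := by rw [← Real.exp_add]; simp
  nlinarith [Real.exp_pos (x / 2), Real.exp_pos (-(x / 2)), mul_nonneg h0 (sub_nonneg.2 h1)]

theorem gaussDecay_le_exp (d : ℕ) {τ : ℝ} (hτ : |τ| ≤ 1) :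
    gaussDecay d τ ≤ Real.exp (-(d / 4) * τ ^ 2) := by
  have h1 : Real.exp (τ ^ 2 / 4) ≤ √(1 + τ ^ 2) := by
    refine Real.le_sqrt_of_sq_le ?_
    rw [← Real.exp_nat_mul]
    refine le_trans (le_of_eq ?_) (exp_half_le_one_add (sq_nonneg τ)
      ((sq_le_one_iff_abs_le_one τ).2 hτ))
    congr 1; push_cast; ring
  calc gaussDecay d τ ≤ (Real.exp (τ ^ 2 / 4))⁻¹ ^ d := by
        unfold gaussDecay; gcongr
    _ = _ := by
        rw [← Real.exp_neg, ← Real.exp_nat_mul]; congr 1; ring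

theorem exp_le_gaussDecay (d : ℕ) (τ : ℝ) :
    Real.exp (-(d / 2) * τ ^ 2) ≤ gaussDecay d τ := by
  have h1 : √(1 + τ ^ 2) ≤ Real.exp (τ ^ 2 / 2) := by
    refine Real.sqrt_le_iff.2 ⟨(Real.exp_pos _).le, ?_⟩
    rw [← Real.exp_nat_mul]
    refine le_trans (le_of_eq (add_comm _ _)) ((Real.add_one_le_exp (τ ^ 2)).trans (le_of_eq ?_))
    congr 1; push_cast; ring
  calc Real.exp (-(d / 2) * τ ^ 2) = (Real.exp (τ ^ 2 / 2))⁻¹ ^ d := by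
        rw [← Real.exp_neg, ← Real.exp_nat_mul]; congr 1; ring
    _ ≤ _ := by unfold gaussDecay; gcongr

theorem sqrt_pi_div_le_integral_gaussDecay {d : ℕ} (hd : 2 ≤ d) :
    √(Real.pi / d) ≤ ∫ τ, gaussDecay d τ := by
  have hd0 : (0 : ℝ) < d := by positivity
  calc √(Real.pi / d) ≤ √(Real.pi / (d / 2)) := by
        refine Real.sqrt_le_sqrt (div_le_div_of_nonneg_left Real.pi_pos.le (by positivity) ?_)
        linarith
    _ = ∫ τ, Real.exp (-(d / 2) * τ ^ 2) := (integral_gaussian _).symm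
    _ ≤ _ := integral_mono (integrable_exp_neg_mul_sq (by positivity))
        (integrable_gaussDecay hd) (exp_le_gaussDecay d)

theorem gaussDecay_le_sqrt_gaussDecay (d : ℕ) (τ : ℝ) :
    gaussDecay d τ ≤ √(gaussDecay d (√2 * τ)) := by
  refine Real.le_sqrt_of_sq_le ?_
  rw [gaussDecay, gaussDecay, ← pow_mul, mul_comm d 2, pow_mul]
  gcongr
  rw [inv_pow]
  gcongr
  refine Real.sqrt_le_iff.2 ⟨by positivity, ?_⟩
  rw [Real.sq_sqrt (by positivity), mul_pow, Real.sq_sqrt (by norm_num)]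
  nlinarith [sq_nonneg (τ ^ 2)]

theorem gaussDecay_add (d e : ℕ) (τ : ℝ) :
    gaussDecay (d + e) τ = gaussDecay d τ * gaussDecay e τ := pow_add _ _ _

theorem gaussDecay_le_of_abs_le (d : ℕ) {τ τ' : ℝ} (h : |τ| ≤ |τ'|) :
    gaussDecay d τ' ≤ gaussDecay d τ := by
  have := sq_le_sq.2 h
  unfold gaussDecay; gcongr

theorem sqrt_gaussDecay_le_exp {d : ℕ} (hd : 8 ≤ d) {τ : ℝ} (hτ : 1 / 2 ≤ |τ|) :
    √(gaussDecay d (√2 * τ)) ≤ Real.exp (-(d / 32)) * (1 + τ ^ 2)⁻¹ := by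
  obtain ⟨k, rfl⟩ : ∃ k, d = k + 4 := ⟨d - 4, by omega⟩
  have hk : (4 : ℝ) ≤ k := by exact_mod_cast (by omega : 4 ≤ k)
  have h2 : √2 ^ 2 = (2 : ℝ) := Real.sq_sqrt (by norm_num)
  have h3 : √2 / 2 ≤ (1 : ℝ) := by nlinarith [Real.sqrt_nonneg 2]
  rw [gaussDecay_add, Real.sqrt_mul (gaussDecay_pos _ _).le]
  refine mul_le_mul ?_ (sqrt_gaussDecay_le le_rfl τ) (Real.sqrt_nonneg _) (Real.exp_pos _).le
  refine Real.sqrt_le_iff.2 ⟨(Real.exp_pos _).le, ?_⟩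
  calc gaussDecay k (√2 * τ) ≤ gaussDecay k (√2 / 2) := by
        refine gaussDecay_le_of_abs_le k ?_
        rw [abs_mul, abs_of_nonneg (by positivity), abs_of_nonneg (by positivity)]
        nlinarith [Real.sqrt_nonneg 2]
    _ ≤ Real.exp (-(k / 4) * (√2 / 2) ^ 2) := gaussDecay_le_exp k (by
        rwa [abs_of_nonneg (by positivity)])
    _ ≤ Real.exp (-((k + 4 : ℕ) / 32)) ^ 2 := by
        rw [← Real.exp_nat_mul]
        refine Real.exp_le_exp.2 ?_
        rw [div_pow, h2]
        push_cast
        linarith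

section
variable {n : ℕ} {F G : EuclideanSpace ℝ (Fin n) → ℝ} {M M' : ℝ}

theorem abs_cosForm_sub_gaussDecay_le_of_le (hF : Measurable F) (hFr : IsRadial F)
    (hF0 : ∀ x, 0 ≤ F x) (hFM : ∀ x, F x ≤ M)
    (hF1 : ∫ x, F x ∂stdGaussian (EuclideanSpace ℝ (Fin n)) = 1) (hG : Measurable G)
    (hGr : IsRadial G) (hG0 : ∀ x, 0 ≤ G x) (hGM : ∀ x, G x ≤ M')
    (hG1 : ∫ x, G x ∂stdGaussian (EuclideanSpace ℝ (Fin n)) = 1) (hn : 0 < n)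
    (hs : Real.log (2 * M) * Real.log (2 * M') ≤ n / 4000) {τ : ℝ} (hτ0 : τ ≠ 0)
    (hτ : |τ| ≤ 1 / 2) :
    |cosForm F G τ - gaussDecay n τ| ≤ 144 * Real.exp 144 *
      (Real.log (2 * M) * Real.log (2 * M') / n) * Real.exp (-(n / 16) * τ ^ 2) := by
  have hm : Measurable (WithLp.toLp 2 : (Fin n → ℝ) → EuclideanSpace ℝ (Fin n)) :=
    WithLp.measurable_toLp 2 _
  have hF1' := (integral_gaussPi_toLp F).trans hF1
  have hG1' := (integral_gaussPi_toLp G).trans hG1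
  have key := abs_evenForm_neg_sq_sub_one_le (hG.comp hm) (fun x ↦ hG0 _) (fun x ↦ hGM _) hG1'
    (hF.comp hm) (fun x ↦ hF0 _) (fun x ↦ hFM _) hF1' hτ0 hτ
  have hM := one_le_of_integral_eq_one (hF.comp hm) (fun x ↦ hF0 _) (fun x ↦ hFM _) hF1'
  have hM' := one_le_of_integral_eq_one (hG.comp hm) (fun x ↦ hG0 _) (fun x ↦ hGM _) hG1'
  rw [mul_comm (Real.log (2 * M'))] at key
  set s := Real.log (2 * M) * Real.log (2 * M') with hsdef
  have hs0 : 0 ≤ s := mul_nonneg (Real.log_nonneg (by linarith)) (Real.log_nonneg (by linarith))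
  have hn0 : (0 : ℝ) < n := by exact_mod_cast hn
  have hJ := gaussDecay_le_exp n (hτ.trans (by norm_num))
  rw [cosForm_eq_evenForm hFr hGr, ← mul_sub_one, abs_mul, abs_of_pos (gaussDecay_pos _ _)]
  have hx : τ ^ 2 ≤ 16 / n * Real.exp (n / 16 * τ ^ 2) := by
    have := Real.add_one_le_exp (n / 16 * τ ^ 2)
    rw [div_mul_eq_mul_div, le_div_iff₀ hn0]
    nlinarith
  have h1 : Real.exp (432 * s * τ ^ 2) ≤ Real.exp (n / 8 * τ ^ 2) := by
    refine Real.exp_le_exp.2 (mul_le_mul_of_nonneg_right ?_ (sq_nonneg τ))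
    linarith
  calc _ ≤ Real.exp (-(n / 4) * τ ^ 2) * (9 * Real.exp 144 * s *
        (16 / n * Real.exp (n / 16 * τ ^ 2)) * Real.exp (n / 8 * τ ^ 2)) := by
        refine mul_le_mul hJ (key.trans ?_) (abs_nonneg _) (Real.exp_pos _).le
        gcongr
    _ = 144 * Real.exp 144 * (s / n) * (Real.exp (-(n / 4) * τ ^ 2) *
        Real.exp (n / 16 * τ ^ 2) * Real.exp (n / 8 * τ ^ 2)) := by ring
    _ = _ := by
        rw [← Real.exp_add, ← Real.exp_add]
        congr 2; ring

theorem abs_cosForm_sub_gaussDecay_le_of_ge (hF : Measurable F) (hF0 : ∀ x, 0 ≤ F x)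
    (hFM : ∀ x, F x ≤ M) (hG0 : ∀ x, 0 ≤ G x) (hGM : ∀ x, G x ≤ M')
    (hM : 1 ≤ M) (hM' : 1 ≤ M') (hn : 8 ≤ n)
    (hs : Real.log (2 * M) * Real.log (2 * M') ≤ n / 4000) {τ : ℝ} (hτ : 1 / 2 ≤ |τ|) :
    |cosForm F G τ - gaussDecay n τ| ≤
      40000 * (Real.log (2 * M) * Real.log (2 * M') / n) / n * (1 + τ ^ 2)⁻¹ := by
  have hn0 : (0 : ℝ) < n := by exact_mod_cast (by omega : 0 < n)
  have hL := log_two_le_log_two_mul hM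
  have hL' := log_two_le_log_two_mul hM'
  have hl2 := Real.log_two_gt_d9
  have hMM : M * M' ≤ Real.exp (n / 64) := by
    calc M * M' ≤ (2 * M) * (2 * M') := by nlinarith
      _ = Real.exp (Real.log (2 * M) + Real.log (2 * M')) := by
        rw [Real.exp_add, Real.exp_log (by linarith), Real.exp_log (by linarith)]
      _ ≤ _ := Real.exp_le_exp.2 (by nlinarith)
  set s := Real.log (2 * M) * Real.log (2 * M') with hsdef
  have hs1 : 0.48 ≤ s := by nlinarith
  have h1 := abs_cosForm_le hF (fun x ↦ (abs_of_nonneg (hF0 x)).le.trans (hFM x))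
    (fun x ↦ (abs_of_nonneg (hG0 x)).le.trans (hGM x)) τ
  rw [finrank_euclideanSpace_fin] at h1
  have h2 := gaussDecay_le_sqrt_gaussDecay n τ
  have h3 := sqrt_gaussDecay_le_exp hn hτ
  set r := √(gaussDecay n (√2 * τ))
  have hr : 0 ≤ r := Real.sqrt_nonneg _
  have h4 : |cosForm F G τ - gaussDecay n τ| ≤ 2 * (M * M') * r := by
    refine (abs_sub _ _).trans ?_
    rw [abs_of_pos (gaussDecay_pos _ _)]
    have : r ≤ M * M' * r := le_mul_of_one_le_left hr (by nlinarith)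
    linarith
  have h5 : Real.exp (-(n / 64)) ≤ 8192 / n ^ 2 := by
    have := Real.quadratic_le_exp_of_nonneg (x := (n / 64 : ℝ)) (by positivity)
    rw [Real.exp_neg, inv_le_comm₀ (Real.exp_pos _) (by positivity), inv_div]
    refine le_trans ?_ this
    have : (0 : ℝ) ≤ n / 64 := by positivity
    linarith [show (n / 64 : ℝ) ^ 2 / 2 = n ^ 2 / 8192 by ring]
  calc |cosForm F G τ - gaussDecay n τ| ≤ 2 * (M * M') * r := h4
    _ ≤ 2 * Real.exp (n / 64) * (Real.exp (-(n / 32)) * (1 + τ ^ 2)⁻¹) := by gcongr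
    _ = 2 * Real.exp (-(n / 64)) * (1 + τ ^ 2)⁻¹ := by
        rw [show (-(n / 64) : ℝ) = n / 64 + -(n / 32) by ring, Real.exp_add]; ring
    _ ≤ _ := by
        gcongr
        calc 2 * Real.exp (-(n / 64)) ≤ 2 * (8192 / n ^ 2) := by gcongr
          _ = 16384 / n ^ 2 := by ring
          _ ≤ 40000 * s / n ^ 2 := by gcongr; linarith
          _ = _ := by field_simp

theorem abs_integral_cosForm_sub_le (hF : Measurable F) (hFr : IsRadial F)
    (hF0 : ∀ x, 0 ≤ F x) (hFM : ∀ x, F x ≤ M)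
    (hF1 : ∫ x, F x ∂stdGaussian (EuclideanSpace ℝ (Fin n)) = 1) (hG : Measurable G)
    (hGr : IsRadial G) (hG0 : ∀ x, 0 ≤ G x) (hGM : ∀ x, G x ≤ M')
    (hG1 : ∫ x, G x ∂stdGaussian (EuclideanSpace ℝ (Fin n)) = 1) (hM : 1 ≤ M) (hM' : 1 ≤ M')
    (hn : 8 ≤ n) (hs : Real.log (2 * M) * Real.log (2 * M') ≤ n / 4000) :
    |(∫ τ, cosForm F G τ) - ∫ τ, gaussDecay n τ| ≤ (576 * Real.exp 144 + 40000) *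
      (Real.log (2 * M) * Real.log (2 * M') / n) * ∫ τ, gaussDecay n τ := by
  have hn0 : (0 : ℝ) < n := by exact_mod_cast (by omega : 0 < n)
  have hiF : Integrable (cosForm F G) :=
    integrable_cosForm (by rw [finrank_euclideanSpace_fin]; omega) hF hG
      (fun x ↦ (abs_of_nonneg (hF0 x)).le.trans (hFM x))
      (fun x ↦ (abs_of_nonneg (hG0 x)).le.trans (hGM x))
  have hiJ : Integrable (gaussDecay n) := integrable_gaussDecay (by omega)
  have hs0 : 0 ≤ Real.log (2 * M) * Real.log (2 * M') / n := div_nonneg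
    (mul_nonneg (Real.log_nonneg (by linarith)) (Real.log_nonneg (by linarith))) hn0.le
  have near := fun τ : ℝ ↦ abs_cosForm_sub_gaussDecay_le_of_le hF hFr hF0 hFM hF1 hG hGr hG0 hGM
    hG1 (by omega) hs (τ := τ)
  have far := fun τ : ℝ ↦ abs_cosForm_sub_gaussDecay_le_of_ge hF hF0 hFM hG0 hGM hM hM' hn hs
    (τ := τ)
  set t := Real.log (2 * M) * Real.log (2 * M') / n
  have i1 : Integrable fun τ : ℝ ↦ 144 * Real.exp 144 * t * Real.exp (-(n / 16) * τ ^ 2) :=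
    (integrable_exp_neg_mul_sq (by positivity)).const_mul _
  have i2 : Integrable fun τ : ℝ ↦ 40000 * t / n * (1 + τ ^ 2)⁻¹ :=
    integrable_inv_one_add_sq.const_mul _
  rw [← integral_sub hiF hiJ, ← Real.norm_eq_abs]
  refine (norm_integral_le_of_norm_le (i1.add i2) ?_).trans ?_
  · have h0 : ∀ᵐ τ : ℝ, τ ≠ 0 := by simp [ae_iff]
    filter_upwards [h0] with τ hτ0
    rw [Real.norm_eq_abs, Pi.add_apply]
    rcases le_total |τ| (1 / 2) with hτ | hτ
    · exact (near τ hτ0 hτ).trans (le_add_of_nonneg_right (by positivity))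
    · exact (far τ hτ).trans (le_add_of_nonneg_left (by positivity))
  · have e := integral_add i1 i2
    rw [integral_const_mul, integral_const_mul, integral_gaussian, integral_univ_inv_one_add_sq]
      at e
    refine e.le.trans ?_
    have hq : √(Real.pi / (n / 16)) = 4 * √(Real.pi / n) := by
      rw [show Real.pi / (n / 16) = 4 ^ 2 * (Real.pi / n) by field_simp; norm_num,
        Real.sqrt_mul (by norm_num), Real.sqrt_sq (by norm_num)]
    have hq2 : √(Real.pi / n) ^ 2 = Real.pi / n := Real.sq_sqrt (by positivity)
    have hq1 : √(Real.pi / n) ≤ 1 := by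
      rw [Real.sqrt_le_one, div_le_one hn0]
      have : (8 : ℝ) ≤ n := by exact_mod_cast hn
      linarith [Real.pi_lt_four]
    have hN := sqrt_pi_div_le_integral_gaussDecay (d := n) (by omega)
    have hq0 := Real.sqrt_nonneg (Real.pi / n)
    rw [hq]
    calc _ = 576 * Real.exp 144 * t * √(Real.pi / n) + 40000 * t * (√(Real.pi / n) ^ 2) := by
          rw [hq2]; ring
      _ ≤ 576 * Real.exp 144 * t * √(Real.pi / n) + 40000 * t * √(Real.pi / n) := by
          gcongr; nlinarith
      _ = (576 * Real.exp 144 + 40000) * t * √(Real.pi / n) := by ring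
      _ ≤ _ := by gcongr
end

/-- Main symmetric sampling statement: there are universal constants `c, C > 0` such
that for bounded measurable `f, g : S^{n-1} → [0,∞)` with `∫f dσ = ∫g dσ = 1` and
`s = log(2‖f‖_∞)·log(2‖g‖_∞) ≤ cn`, one has `|∫_{𝒱ₙ} f(x)g(y) dσ_𝒱 - 1| ≤ Cs/n`.
The integral over the manifold `𝒱ₙ` of orthonormal pairs equals `∫ f·R(g) dσ`, where
`R(g)` is the spherical Radon transform of `g`, characterized here by its values
through isometric parametrizations of the equators. -/
theorem symmetric_sampling :
    ∃ c : ℝ, 0 < c ∧ ∃ C : ℝ, 0 < C ∧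
      ∀ (n : ℕ) (_ : 2 ≤ n) (f g : sphere (0 : EuclideanSpace ℝ (Fin n)) 1 → ℝ),
        Measurable f → Measurable g → (∀ x, 0 ≤ f x) → (∀ x, 0 ≤ g x) →
        (∫ x, f x ∂uSphere n) = 1 → (∫ x, g x ∂uSphere n) = 1 →
        ∀ Mf Mg : ℝ, (∀ x, f x ≤ Mf) → (∀ x, g x ≤ Mg) →
        ∀ Rg : sphere (0 : EuclideanSpace ℝ (Fin n)) 1 → ℝ, Measurable Rg →
        (∀ (θ : sphere (0 : EuclideanSpace ℝ (Fin n)) 1)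
            (e : EuclideanSpace ℝ (Fin (n - 1)) →ₗᵢ[ℝ] EuclideanSpace ℝ (Fin n)),
          LinearMap.range e.toLinearMap
              = (Submodule.span ℝ {(θ : EuclideanSpace ℝ (Fin n))})ᗮ →
          Rg θ = equatorAvg g e) →
        Real.log (2 * Mf) * Real.log (2 * Mg) ≤ c * n →
        |(∫ x, f x * Rg x ∂uSphere n) - 1|
          ≤ C * (Real.log (2 * Mf) * Real.log (2 * Mg)) / n := by
  refine ⟨1 / 4000, by norm_num, 576 * Real.exp 144 + 40000, by positivity, ?_⟩
  intro n hn2 f g hf hg hf0 hg0 hf1 hg1 Mf Mg hfM hgM Rg _ hR hs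
  have hnonneg : ∀ {h : sphere (0 : EuclideanSpace ℝ (Fin n)) 1 → ℝ} {M : ℝ}, (∀ x, 0 ≤ h x) →
      (∀ x, h x ≤ M) → 0 ≤ M := fun h0 hM ↦
    (h0 ⟨EuclideanSpace.single ⟨0, by omega⟩ 1, by simp⟩).trans (hM _)
  have hf' := (measurable_sphereExtend hf).comp (measurable_unitDir (E := EuclideanSpace ℝ (Fin n)))
  have hg' := (measurable_sphereExtend hg).comp (measurable_unitDir (E := EuclideanSpace ℝ (Fin n)))
  have hfe := sphereExtend_le (hnonneg hf0 hfM) hfM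
  have hge := sphereExtend_le (hnonneg hg0 hgM) hgM
  have hf1' := (integral_sphereExtend_unitDir (by omega) hf).trans hf1
  have hg1' := (integral_sphereExtend_unitDir (by omega) hg).trans hg1
  have hm : Measurable (WithLp.toLp 2 : (Fin n → ℝ) → EuclideanSpace ℝ (Fin n)) :=
    WithLp.measurable_toLp 2 _
  have hMf := one_le_of_integral_eq_one (hf'.comp hm) (fun _ ↦ sphereExtend_nonneg hf0 _)
    (fun _ ↦ hfe _) ((integral_gaussPi_toLp fun x ↦ sphereExtend f (unitDir x)).trans hf1')
  have hMg := one_le_of_integral_eq_one (hg'.comp hm) (fun _ ↦ sphereExtend_nonneg hg0 _)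
    (fun _ ↦ hge _) ((integral_gaussPi_toLp fun x ↦ sphereExtend g (unitDir x)).trans hg1')
  have hL := log_two_le_log_two_mul hMf
  have hL' := log_two_le_log_two_mul hMg
  have hl2 := Real.log_two_gt_d9
  have hn : 8 ≤ n := by
    have : (8 : ℝ) ≤ n := by nlinarith
    exact_mod_cast this
  have hN : 0 < ∫ τ, gaussDecay n τ := lt_of_lt_of_le
    (Real.sqrt_pos.2 (div_pos Real.pi_pos (by positivity)))
    (sqrt_pi_div_le_integral_gaussDecay (by omega))
  have key := abs_integral_cosForm_sub_le hf' (isRadial_comp_unitDir (sphereExtend f))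
    (fun _ ↦ sphereExtend_nonneg hf0 _) (fun _ ↦ hfe _) hf1' hg'
    (isRadial_comp_unitDir (sphereExtend g)) (fun _ ↦ sphereExtend_nonneg hg0 _) (fun _ ↦ hge _)
    hg1' hMf hMg hn (by linarith)
  have e := integral_cosForm_sphereExtend (by omega) hf hg
    (fun x ↦ (abs_of_nonneg (sphereExtend_nonneg hf0 x)).le.trans (hfe x))
    (fun x ↦ (abs_of_nonneg (sphereExtend_nonneg hg0 x)).le.trans (hge x)) hR
  replace key := (congrArg (fun z ↦ |z - ∫ τ, gaussDecay n τ|) e).symm.le.trans key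
  rw [← mul_sub_one, abs_mul, abs_of_pos hN, mul_comm] at key
  rw [mul_div_assoc]
  exact le_of_mul_le_mul_right key hN
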